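/- If the Riemann Hypothesis is true, then for all real x ≥ 43.1, |Σ_{p ≤ x} (log p)/p - log x - E| ≤ 3(log x)² / (8π√x), where E = B - C with B the Mertens constant and C the Euler–Mascheroni constant. -/

import Mathlib

namespace MRH
open Complex

noncomputable def xi (s : ℂ) : ℂ := s * (s - 1) * completedRiemannZeta₀ s + 1

lemma xi_diff : Differentiable ℂ xi := by
  unfold xi
  have := differentiable_completedZeta₀
  fun_prop

lemma xi_one_sub (s : ℂ) : xi (1 - s) = xi s := by
  unfold xi
  rw [completedRiemannZeta₀_one_sub]; ring

lemma xi_one : xi 1 = 1 := by simp [xi]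

lemma xi_eq {s : ℂ} (h0 : 0 < s.re) (h1 : s ≠ 1) :
    xi s = s * (s - 1) * Gammaℝ s * riemannZeta s := by
  have hs : s ≠ 0 := by rintro rfl; simp at h0
  have hs1 : s - 1 ≠ 0 := sub_ne_zero.mpr h1
  have hs2 : 1 - s ≠ 0 := sub_ne_zero.mpr h1.symm
  have hG := Gammaℝ_ne_zero_of_re_pos h0
  rw [riemannZeta_def_of_ne_zero hs, completedRiemannZeta_eq, xi]
  field_simp
  ring

lemma zeta_ne_zero (hRH : RiemannHypothesis) {s : ℂ} (h : 1 / 2 < s.re) (h1 : s ≠ 1) :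
    riemannZeta s ≠ 0 := by
  intro h0
  have := hRH s h0 ?_ h1
  · linarith
  · rintro ⟨n, rfl⟩
    have : (-2 * ((n : ℂ) + 1)).re = -2 * (n + 1) := by simp
    rw [this] at h
    have : (0:ℝ) ≤ n := n.cast_nonneg
    linarith

lemma xi_ne_zero (hRH : RiemannHypothesis) {s : ℂ} (h : 1 / 2 < s.re) : xi s ≠ 0 := by
  by_cases h1 : s = 1
  · rw [h1, xi_one]; exact one_ne_zero
  rw [xi_eq (by linarith) h1]
  have hs : s ≠ 0 := by rintro rfl; simp at h; linarith
  have hs1 : s - 1 ≠ 0 := sub_ne_zero.mpr h1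
  exact mul_ne_zero (mul_ne_zero (mul_ne_zero hs hs1) (Gammaℝ_ne_zero_of_re_pos (by linarith)))
    (zeta_ne_zero hRH h h1)

lemma Gammaℝ_conj (s : ℂ) : Gammaℝ (starRingEnd ℂ s) = starRingEnd ℂ (Gammaℝ s) := by
  rw [Gammaℝ_def, Gammaℝ_def, map_mul, ← Complex.Gamma_conj]
  congr 1
  · have h : (Real.pi : ℂ) = starRingEnd ℂ (Real.pi : ℂ) := by simp
    have h2 := Complex.cpow_conj (Real.pi : ℂ) (-s/2) (by
      rw [Complex.arg_ofReal_of_nonneg Real.pi_pos.le]; exact Real.pi_pos.ne)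
    rw [← h] at h2
    rw [← h2]
    have h3 : starRingEnd ℂ 2 = 2 := Complex.conj_ofNat 2
    simp [map_div₀, h3]
  · have h3 : starRingEnd ℂ 2 = 2 := Complex.conj_ofNat 2
    simp [map_div₀, h3]

lemma xi_conj {s : ℂ} (h : 0 < s.re) : xi (starRingEnd ℂ s) = starRingEnd ℂ (xi s) := by
  by_cases h1 : s = 1
  · simp [h1, xi_one]
  have h1' : starRingEnd ℂ s ≠ 1 := by
    intro h2; apply h1; simpa using congrArg (starRingEnd ℂ) h2
  rw [xi_eq h h1, xi_eq (by simpa using h) h1', riemannZeta_conj, Gammaℝ_conj]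
  simp

/-- boundedness of completed zeta in strips -/
lemma cz0_bound (a b : ℝ) : ∃ C : ℝ, 0 ≤ C ∧ ∀ s : ℂ, a ≤ s.re → s.re ≤ b →
    ‖completedRiemannZeta₀ s‖ ≤ C := by
  set P := HurwitzZeta.hurwitzEvenFEPair 0 with hP
  have hconv : ∀ s : ℂ, MellinConvergent P.f_modif s := fun s =>
    (P.isStrongFEPair_toStrongFEPair.hasMellin s).1
  set I : ℝ → ℝ := fun σ => ∫ t in Set.Ioi (0:ℝ), ‖(t:ℂ) ^ ((σ:ℂ) - 1) • P.f_modif t‖ with hI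
  have hint : ∀ σ : ℝ, MeasureTheory.IntegrableOn
      (fun t : ℝ => ‖(t:ℂ) ^ ((σ:ℂ) - 1) • P.f_modif t‖) (Set.Ioi 0) := fun σ => (hconv σ).norm
  have hI0 : ∀ σ, 0 ≤ I σ := fun σ => MeasureTheory.integral_nonneg fun _ => norm_nonneg _
  refine ⟨(I (a/2) + I (b/2)) / 2, by linarith [hI0 (a/2), hI0 (b/2)], fun s ha hb => ?_⟩
  have e : completedRiemannZeta₀ s = (mellin P.f_modif (s/2)) / 2 := rfl
  rw [e, norm_div, Complex.norm_ofNat]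
  gcongr
  rw [mellin]
  refine (MeasureTheory.norm_integral_le_integral_norm _).trans ?_
  rw [hI, ← MeasureTheory.integral_add (hint _) (hint _)]
  refine MeasureTheory.setIntegral_mono_on (hconv _).norm ((hint _).add (hint _))
    measurableSet_Ioi fun t ht => ?_
  have ht : (0:ℝ) < t := ht
  simp only [norm_smul, Complex.norm_cpow_eq_rpow_re_of_pos ht, ← add_mul, Pi.add_apply]
  gcongr
  have hr : (s/2 - 1).re = s.re/2 - 1 := by simp
  have hra : (((a/2:ℝ):ℂ) - 1).re = a/2 - 1 := by simp
  have hrb : (((b/2:ℝ):ℂ) - 1).re = b/2 - 1 := by simp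
  rw [hr, hra, hrb]
  rcases le_total 1 t with h | h
  · have := Real.rpow_le_rpow_of_exponent_le h (show s.re/2-1 ≤ b/2-1 by linarith)
    have h2 := Real.rpow_nonneg ht.le (a/2-1)
    linarith
  · have := Real.rpow_le_rpow_of_exponent_ge ht h (show a/2-1 ≤ s.re/2-1 by linarith)
    have h2 := Real.rpow_nonneg ht.le (b/2-1)
    linarith

lemma xi_bound (a b : ℝ) : ∃ C : ℝ, 1 ≤ C ∧ ∀ s : ℂ, a ≤ s.re → s.re ≤ b →
    ‖xi s‖ ≤ C * (1 + |s.im|) ^ 2 := by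
  obtain ⟨C, hC, h⟩ := cz0_bound a b
  set m := |a| + |b| + 1 with hm
  have ha0 := abs_nonneg a
  have hb0 := abs_nonneg b
  have hm1 : 1 ≤ m := by linarith
  refine ⟨(m + 1) * (m + 1) * C + 1, by nlinarith [mul_nonneg (mul_nonneg (by linarith : 0 ≤ m+1) (by linarith : 0 ≤ m+1)) hC], fun s h1 h2 => ?_⟩
  have hre : |s.re| ≤ m := by
    rw [abs_le]; constructor
    · linarith [neg_abs_le a]
    · linarith [le_abs_self b]
  have ht := abs_nonneg s.im
  have hs : ‖s‖ ≤ (m + 1) * (1 + |s.im|) := by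
    have := Complex.norm_le_abs_re_add_abs_im s
    nlinarith
  have hs1 : ‖s - 1‖ ≤ (m + 1) * (1 + |s.im|) := by
    have := Complex.norm_le_abs_re_add_abs_im s
    have h3 : ‖s - 1‖ ≤ ‖s‖ + ‖(1:ℂ)‖ := norm_sub_le _ _
    rw [norm_one] at h3
    nlinarith
  unfold xi
  calc ‖s * (s - 1) * completedRiemannZeta₀ s + 1‖ ≤ ‖s * (s - 1) * completedRiemannZeta₀ s‖ + ‖(1:ℂ)‖ :=
        norm_add_le _ _
    _ ≤ ((m + 1) * (1 + |s.im|)) * ((m + 1) * (1 + |s.im|)) * C + 1 := by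
        rw [norm_mul, norm_mul, norm_one]
        gcongr
        exact h s h1 h2
    _ ≤ _ := by
        have : 1 ≤ (1 + |s.im|)^2 := by nlinarith
        nlinarith

end MRH


namespace MRH
section
open Complex Filter Topology

noncomputable def psiR (x : ℝ) : ℝ := deriv (Real.log ∘ Real.Gamma) x

lemma lg_diff {x : ℝ} (hx : 0 < x) : DifferentiableAt ℝ (Real.log ∘ Real.Gamma) x := by
  refine ((Real.differentiableAt_Gamma ?_).log (Real.Gamma_ne_zero ?_)) <;>
    exact fun m => ne_of_gt (by have : (0:ℝ) ≤ m := m.cast_nonneg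
                                linarith)

lemma psiR_cast {x : ℝ} (hx : 0 < x) : Complex.digamma x = (psiR x : ℂ) := by
  have hne : ∀ m : ℕ, x ≠ -m := fun m => ne_of_gt (by
    have : (0:ℝ) ≤ m := m.cast_nonneg
    linarith)
  have h1 : HasDerivAt Complex.Gamma (deriv Complex.Gamma x) (x:ℂ) :=
    (Complex.differentiableAt_Gamma _ (fun m => by exact_mod_cast hne m)).hasDerivAt
  have h2 := h1.comp_ofReal
  have h3 := (Real.differentiableAt_Gamma hne).hasDerivAt.ofReal_comp
  have h4 : (fun y : ℝ => Complex.Gamma y) = fun y : ℝ => ((Real.Gamma y : ℝ) : ℂ) := by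
    ext y; exact Complex.Gamma_ofReal y
  rw [h4] at h2
  have h5 := h2.unique h3
  rw [Complex.digamma_def, logDeriv_apply, h5, Complex.Gamma_ofReal, psiR]
  have : deriv (Real.log ∘ Real.Gamma) x = deriv Real.Gamma x / Real.Gamma x := by
    rw [Function.comp_def, deriv.log (Real.differentiableAt_Gamma hne) (Real.Gamma_pos_of_pos hx).ne']
  rw [this]; push_cast; rfl

lemma psiR_le_log {x : ℝ} (hx : 0 < x) : psiR x ≤ Real.log x := by
  have := Real.convexOn_log_Gamma.deriv_le_slope (x := x) (y := x + 1) hx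
    (show (0:ℝ) < x + 1 by linarith) (by linarith) (lg_diff hx)
  refine this.trans (le_of_eq ?_)
  rw [slope_def_field]
  simp only [Function.comp, Real.Gamma_add_one hx.ne', Real.log_mul hx.ne' (Real.Gamma_pos_of_pos hx).ne']
  ring

lemma psiR_mono {x y : ℝ} (hx : 0 < x) (hxy : x ≤ y) : psiR x ≤ psiR y :=
  Real.convexOn_log_Gamma.monotoneOn_deriv (fun _ h => lg_diff h) hx (hx.trans_le hxy) hxy

lemma psiR_add_one {x : ℝ} (hx : 0 < x) : psiR (x + 1) = psiR x + 1 / x := by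
  have := Complex.digamma_apply_add_one (x:ℂ) (fun m h => by
    have h2 : x = -m := by exact_mod_cast h
    have : (0:ℝ) ≤ m := m.cast_nonneg
    linarith)
  have e : ((x:ℂ) + 1) = ((x + 1 : ℝ) : ℂ) := by push_cast; rfl
  rw [e, psiR_cast hx, psiR_cast (by linarith)] at this
  rw [one_div]
  exact_mod_cast this

lemma psiR_one : psiR 1 = - Real.eulerMascheroniConstant := by
  have := psiR_cast one_pos
  rw [Complex.ofReal_one, Complex.digamma_one] at this
  exact_mod_cast this.symm

lemma psiR_add_nat {x : ℝ} (hx : 0 < x) (n : ℕ) :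
    psiR (x + n) = psiR x + ∑ k ∈ Finset.range n, 1 / (k + x) := by
  induction n with
  | zero => simp
  | succ n ih =>
    rw [Finset.sum_range_succ, ← add_assoc, ← ih, Nat.cast_succ, ← add_assoc,
      psiR_add_one (by positivity), add_comm x]

/-- the digamma term -/
noncomputable def dt (s : ℂ) (k : ℕ) : ℂ := 1 / (k + 1) - 1 / (k + s)

lemma ks_ne {s : ℂ} (hs : 0 < s.re) (k : ℕ) : (k:ℂ) + s ≠ 0 := by
  intro h
  have := congrArg Complex.re h
  simp at this
  have h2 : (0:ℝ) ≤ k := k.cast_nonneg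
  linarith

lemma k1_ne (k : ℕ) : (k:ℂ) + 1 ≠ 0 := by exact_mod_cast Nat.succ_ne_zero k

lemma dt_eq {s : ℂ} (hs : 0 < s.re) (k : ℕ) : dt s k = (s - 1) / ((k + 1) * (k + s)) := by
  have := ks_ne hs k
  have := k1_ne k
  unfold dt; field_simp; ring

lemma ks_norm {s : ℂ} {e : ℝ} (he : 0 < e) (he1 : e ≤ 1) (hs : e ≤ s.re) (k : ℕ) :
    e * (k + 1) ≤ ‖(k:ℂ) + s‖ := by
  have h : ((k:ℂ) + s).re ≤ ‖(k:ℂ) + s‖ := Complex.re_le_norm _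
  simp at h
  have : (0:ℝ) ≤ k := k.cast_nonneg
  nlinarith

lemma dt_norm {s : ℂ} {e : ℝ} (he : 0 < e) (he1 : e ≤ 1) (hs : e ≤ s.re) (k : ℕ) :
    ‖dt s k‖ ≤ (‖s‖ + 1) / e * (1 / ((k:ℝ) + 1) ^ 2) := by
  rw [dt_eq (he.trans_le hs), norm_div, norm_mul]
  have h1 : ‖s - 1‖ ≤ ‖s‖ + 1 := by
    have := norm_sub_le s 1
    rwa [norm_one] at this
  have h2 : ‖(k:ℂ) + 1‖ = k + 1 := by
    have : (k:ℂ) + 1 = ((k + 1 : ℕ) : ℂ) := by push_cast; rfl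
    rw [this, Complex.norm_natCast]; push_cast; rfl
  rw [h2]
  have h3 := ks_norm he he1 hs k
  calc ‖s - 1‖ / ((k + 1) * ‖(k:ℂ) + s‖) ≤ (‖s‖ + 1) / ((k + 1) * (e * (k + 1))) := by
        gcongr
    _ = _ := by field_simp

lemma sq_summable : Summable (fun k : ℕ => 1 / ((k:ℝ) + 1) ^ 2) := by
  have := (summable_nat_add_iff 1).mpr (Real.summable_one_div_nat_pow.mpr (by norm_num : 1 < 2))
  simpa using this

lemma dt_summable {s : ℂ} (hs : 0 < s.re) : Summable (dt s) := by
  have he : 0 < min s.re 1 := lt_min hs one_pos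
  exact Summable.of_norm_bounded (sq_summable.mul_left _)
    (fun k => dt_norm he (min_le_right _ _) (min_le_left _ _) k)

lemma dtsum_diff {s : ℂ} (hs : 0 < s.re) : DifferentiableAt ℂ (fun s => ∑' k, dt s k) s := by
  set e := min (s.re / 2) 1
  have he : 0 < e := lt_min (by linarith) one_pos
  set U : Set ℂ := {z | e < z.re} ∩ Metric.ball 0 (‖s‖ + 1)
  have hU : IsOpen U := (isOpen_lt continuous_const Complex.continuous_re).inter Metric.isOpen_ball
  have hsU : s ∈ U := by
    refine ⟨?_, by simp⟩
    have : e ≤ s.re / 2 := min_le_left _ _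
    show e < s.re
    linarith
  have := differentiableOn_tsum_of_summable_norm (F := fun k s => dt s k) (U := U)
    (sq_summable.mul_left ((‖s‖ + 1 + 1) / e)) (fun k z hz => ?_) hU (fun k z hz => ?_)
  · exact this.differentiableAt (hU.mem_nhds hsU)
  · have hz' : 0 < z.re := he.trans hz.1
    have := ks_ne hz' k
    unfold dt
    exact DifferentiableAt.differentiableWithinAt (by fun_prop (disch := assumption))
  · refine (dt_norm he (min_le_right _ _) (le_of_lt hz.1) k).trans ?_
    gcongr
    have := hz.2
    simp at this
    exact this.le

lemma psiR_tsum {x : ℝ} (hx : 1 ≤ x) (hx2 : x ≤ 2) :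
    (∑' k, dt x k) = (psiR x + Real.eulerMascheroniConstant : ℝ) := by
  have hx0 : 0 < x := by linarith
  have hs := (dt_summable (s := x) (by simpa using hx0)).hasSum.tendsto_sum_nat
  refine tendsto_nhds_unique hs ?_
  have e : ∀ n : ℕ, ∑ k ∈ Finset.range n, dt x k =
      ((psiR (1 + n) - psiR (x + n) + (psiR x + Real.eulerMascheroniConstant) : ℝ) : ℂ) := by
    intro n
    rw [psiR_add_nat hx0, psiR_add_nat one_pos, psiR_one]
    unfold dt
    rw [Finset.sum_sub_distrib]
    push_cast
    ring
  simp_rw [e]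
  refine (Complex.continuous_ofReal.tendsto _).comp ?_
  have h : Tendsto (fun n : ℕ => psiR (1 + n) - psiR (x + n)) atTop (𝓝 0) := by
    refine tendsto_of_tendsto_of_tendsto_of_le_of_le' (g := fun n : ℕ => -(1 / ((n:ℝ) + 1))) (h := fun _ => 0)
      (by simpa using (tendsto_one_div_add_atTop_nhds_zero_nat (𝕜 := ℝ)).neg) tendsto_const_nhds ?_ ?_
    · filter_upwards with n
      have h1 := psiR_add_one (x := 1 + n) (by positivity)
      have h2 := psiR_mono (x := x + n) (y := 1 + n + 1) (by positivity) (by linarith)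
      rw [add_comm 1 (n:ℝ)] at *
      linarith
    · filter_upwards with n
      have := psiR_mono (x := 1 + n) (y := x + n) (by positivity) (by linarith)
      linarith
  simpa using h.add_const (psiR x + Real.eulerMascheroniConstant)

lemma digamma_diff {s : ℂ} (hs : 0 < s.re) : DifferentiableAt ℂ Complex.digamma s := by
  have h : ∀ z : ℂ, 0 < z.re → ∀ m : ℕ, z ≠ -m := by
    rintro z hz m rfl
    have : (0:ℝ) ≤ m := m.cast_nonneg
    simp at hz; linarith
  have hU : IsOpen {z : ℂ | 0 < z.re} := isOpen_lt continuous_const Complex.continuous_re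
  have hd : DifferentiableOn ℂ Complex.Gamma {z : ℂ | 0 < z.re} := fun z hz =>
    (Complex.differentiableAt_Gamma z (h z hz)).differentiableWithinAt
  have := (hd.deriv hU).differentiableAt (hU.mem_nhds hs)
  exact this.div (Complex.differentiableAt_Gamma s (h s hs)) (Complex.Gamma_ne_zero (h s hs))

lemma digamma_eq {s : ℂ} (hs : 0 < s.re) :
    Complex.digamma s = -Real.eulerMascheroniConstant + ∑' k, dt s k := by
  have hU : IsOpen {z : ℂ | 0 < z.re} := isOpen_lt continuous_const Complex.continuous_re
  have h1 : AnalyticOnNhd ℂ Complex.digamma {z : ℂ | 0 < z.re} :=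
    DifferentiableOn.analyticOnNhd (fun z hz => (digamma_diff hz).differentiableWithinAt) hU
  have h2 : AnalyticOnNhd ℂ (fun s => -(Real.eulerMascheroniConstant:ℂ) + ∑' k, dt s k) {z : ℂ | 0 < z.re} :=
    DifferentiableOn.analyticOnNhd (fun z hz => ((dtsum_diff hz).const_add _).differentiableWithinAt) hU
  have hc : IsPreconnected {z : ℂ | 0 < z.re} := (convex_halfSpace_re_gt 0).isPreconnected
  refine h1.eqOn_of_preconnected_of_frequently_eq h2 hc (z₀ := 1) (by simp) ?_ hs
  have ht : Tendsto (fun n : ℕ => ((1 + 1 / ((n:ℝ) + 1) : ℝ) : ℂ)) atTop (𝓝[≠] 1) := by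
    rw [tendsto_nhdsWithin_iff]
    constructor
    · have := (tendsto_one_div_add_atTop_nhds_zero_nat (𝕜 := ℝ)).const_add 1
      have h3 := (Complex.continuous_ofReal.tendsto _).comp this
      simpa [Function.comp_def] using h3
    · filter_upwards with n
      have : (0:ℝ) < 1 / ((n:ℝ) + 1) := by positivity
      simp only [Set.mem_compl_iff, Set.mem_singleton_iff]
      intro h
      have h' : (1 + 1 / ((n:ℝ) + 1) : ℝ) = 1 := by exact_mod_cast h
      linarith
  refine ht.frequently (Frequently.of_forall fun n => ?_)
  have h4 : (0:ℝ) < 1 / ((n:ℝ) + 1) := by positivity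
  have h5 : 1 / ((n:ℝ) + 1) ≤ 1 := by
    rw [div_le_one (by positivity)]; linarith [(n.cast_nonneg : (0:ℝ) ≤ n)]
  show _ = _ + _
  rw [psiR_tsum (by linarith) (by linarith), psiR_cast (by linarith)]
  push_cast; ring

/-- Real part lower bound. -/
lemma digamma_re_ge {s : ℂ} (hs : 0 < s.re) : psiR s.re ≤ (Complex.digamma s).re := by
  have h1 := digamma_eq hs
  have h2 := digamma_eq (s := (s.re : ℂ)) (by simpa using hs)
  rw [psiR_cast hs] at h2
  have h3 : psiR s.re = (((-Real.eulerMascheroniConstant:ℝ):ℂ) + ∑' k, dt (s.re:ℂ) k).re := by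
    rw [Complex.ofReal_neg, ← h2, Complex.ofReal_re]
  have hs' : 0 < ((s.re:ℂ)).re := by simpa using hs
  rw [h3, h1, Complex.add_re, Complex.add_re, Complex.re_tsum (dt_summable hs), Complex.re_tsum (dt_summable hs')]
  rw [← Complex.ofReal_neg]
  refine add_le_add_right ?_ _
  refine Summable.tsum_le_tsum (fun k => ?_) (Complex.hasSum_re (dt_summable hs').hasSum).summable (Complex.hasSum_re (dt_summable hs).hasSum).summable
  unfold dt
  have hk : (0:ℝ) ≤ k := k.cast_nonneg
  have hp : 0 < (k:ℝ) + s.re := by linarith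
  rw [Complex.sub_re, Complex.sub_re]
  refine sub_le_sub_left ?_ _
  have e1 : (1 / ((k:ℂ) + s)).re = ((k:ℝ) + s.re) / (((k:ℝ) + s.re)^2 + s.im^2) := by
    rw [one_div, Complex.inv_re, Complex.normSq_apply]; simp; ring
  have e2 : (1 / ((k:ℂ) + (s.re:ℂ))).re = 1 / ((k:ℝ) + s.re) := by
    have : (1 / ((k:ℂ) + (s.re:ℂ))) = ((1 / ((k:ℝ) + s.re) : ℝ) : ℂ) := by push_cast; rfl
    rw [this, Complex.ofReal_re]
  rw [e1, e2, div_le_div_iff₀ (by positivity) hp]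
  nlinarith [sq_nonneg s.im]

end
end MRH


namespace MRH
section
open Complex Filter Topology ArithmeticFunction

noncomputable def fx (s : ℂ) : ℂ := logDeriv xi s
noncomputable def LL (s : ℂ) : ℂ := LSeries (fun n => (Λ n : ℂ)) s

lemma fx_diff (hRH : RiemannHypothesis) {s : ℂ} (hs : 1/2 < s.re) : DifferentiableAt ℂ fx s := by
  unfold fx logDeriv
  exact (xi_diff.analyticAt s).deriv.differentiableAt.div xi_diff.differentiableAt (xi_ne_zero hRH hs)

lemma re_ne_zero {s : ℂ} (h : 0 < s.re) : s ≠ 0 := by rintro rfl; simp at h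

lemma re_ne_one {s : ℂ} (h : 1 < s.re) : s ≠ 1 := by rintro rfl; simp at h

lemma re_half (s : ℂ) : (s/2).re = s.re/2 := by
  simp

lemma gamma_ne {z : ℂ} (hz : 0 < z.re) : ∀ m : ℕ, z ≠ -m := by
  rintro m rfl
  have : (0:ℝ) ≤ m := m.cast_nonneg
  simp at hz; linarith

lemma fx_eq {s : ℂ} (hs : 1 < s.re) :
    fx s = 1 / s + 1 / (s - 1) - Real.log Real.pi / 2 + digamma (s / 2) / 2 - LL s := by
  have hs0 : s ≠ 0 := re_ne_zero (by linarith)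
  have hs1 : s - 1 ≠ 0 := sub_ne_zero.mpr (re_ne_one hs)
  have h2 : 0 < (s/2).re := by rw [re_half]; linarith
  have hpi : (Real.pi : ℂ) ≠ 0 := by exact_mod_cast Real.pi_pos.ne'
  have ev : xi =ᶠ[𝓝 s] fun z => z * ((z - 1) * (((Real.pi:ℂ) ^ (-z / 2) * Complex.Gamma (z / 2)) * riemannZeta z)) := by
    filter_upwards [(isOpen_lt continuous_const Complex.continuous_re).mem_nhds hs] with z hz
    have hz : 1 < z.re := hz
    rw [xi_eq (by linarith) (re_ne_one hz), Gammaℝ_def]; ring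
  have hG := Complex.Gamma_ne_zero (gamma_ne h2)
  have hz := riemannZeta_ne_zero_of_one_lt_re hs
  have hp : (Real.pi:ℂ) ^ (-s / 2) ≠ 0 := by simp [Complex.cpow_eq_zero_iff, hpi]
  have d1 : HasDerivAt (fun z : ℂ => (Real.pi:ℂ) ^ (-z / 2)) ((Real.pi:ℂ) ^ (-s / 2) * Complex.log Real.pi * (-1/2)) s :=
    ((hasDerivAt_id s).neg.div_const 2).const_cpow (Or.inl hpi)
  have d2 : HasDerivAt (fun z : ℂ => Complex.Gamma (z / 2)) (deriv Complex.Gamma (s/2) * (1/2)) s :=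
    HasDerivAt.comp s (Complex.differentiableAt_Gamma _ (gamma_ne h2)).hasDerivAt ((hasDerivAt_id s).div_const 2)
  have d3 := (differentiableAt_riemannZeta (re_ne_one hs))
  have d4 : HasDerivAt (fun z : ℂ => z - 1) 1 s := (hasDerivAt_id s).sub_const 1
  unfold fx
  have e : logDeriv xi s = logDeriv (fun z => z * ((z - 1) * (((Real.pi:ℂ) ^ (-z / 2) * Complex.Gamma (z / 2)) * riemannZeta z))) s := by
    rw [logDeriv_apply, logDeriv_apply, ev.deriv_eq, ev.eq_of_nhds]
  have D := (hasDerivAt_id s).mul (d4.mul ((d1.mul d2).mul d3.hasDerivAt))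
  have D' : deriv (fun z => z * ((z - 1) * (((Real.pi:ℂ) ^ (-z / 2) * Complex.Gamma (z / 2)) * riemannZeta z))) s = _ := D.deriv
  rw [e, logDeriv_apply, D']
  rw [LL, LSeries_vonMangoldt_eq_deriv_riemannZeta_div hs]
  simp only [logDeriv_apply, digamma_def, Pi.mul_apply, id]
  rw [← Complex.ofReal_log Real.pi_pos.le]
  field_simp
  ring

lemma fx_one : fx 1 = (((Real.eulerMascheroniConstant - Real.log (4 * Real.pi)) / 2 + 1 : ℝ) : ℂ) := by
  have h : HasDerivAt xi (completedRiemannZeta₀ 1) 1 := by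
    have h0 := (differentiable_completedZeta₀ 1).hasDerivAt
    have := ((((hasDerivAt_id (1:ℂ)).mul ((hasDerivAt_id (1:ℂ)).sub_const 1)).mul h0).add_const 1)
    exact HasDerivAt.congr_deriv (f := xi) this (by simp)
  rw [fx, logDeriv_apply, h.deriv, xi_one, completedRiemannZeta₀_one]
  have : (4 * (Real.pi:ℂ)) = ((4 * Real.pi : ℝ) : ℂ) := by push_cast; rfl
  rw [this, ← Complex.ofReal_log (by positivity)]
  push_cast; ring

lemma LL_norm_le {s : ℂ} {a : ℝ} (ha : 1 < a) (hs : a ≤ s.re) :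
    ‖LL s‖ ≤ ∑' n, ‖LSeries.term (fun n => (Λ n : ℂ)) a n‖ := by
  have hsum : Summable fun n => ‖LSeries.term (fun n => (Λ n : ℂ)) a n‖ :=
    (LSeriesSummable_vonMangoldt (s := a) (by simpa using ha)).norm
  exact tsum_of_norm_bounded hsum.hasSum (fun n => LSeries.norm_term_le_of_re_le_re _ (by simpa using hs) n)

lemma vm_term (a : ℝ) (n : ℕ) : ‖LSeries.term (fun n => (Λ n : ℂ)) a n‖ = Λ n / (n:ℝ) ^ a := by
  rw [LSeries.norm_term_eq]
  split_ifs with h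
  · simp [h]
  · rw [Complex.norm_real, Real.norm_of_nonneg vonMangoldt_nonneg, Complex.ofReal_re]

lemma LL_ten {s : ℂ} (hs : 10 ≤ s.re) : ‖LL s‖ ≤ 1 / 60 := by
  refine (LL_norm_le (a := 10) (by norm_num) hs).trans ?_
  have h2 : HasSum (fun n : ℕ => (1 / 128) * (1 / (n:ℝ) ^ 2)) ((1/128) * (Real.pi ^ 2 / 6)) :=
    hasSum_zeta_two.mul_left _
  have hsum : Summable fun n => ‖LSeries.term (fun n => (Λ n : ℂ)) (10:ℝ) n‖ :=
    (LSeriesSummable_vonMangoldt (s := (10:ℝ)) (by simp)).norm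
  have := hsum.tsum_le_tsum (fun n => ?_) h2.summable
  · refine this.trans ?_
    rw [h2.tsum_eq]
    have := Real.pi_lt_d2
    nlinarith [Real.pi_pos]
  · rw [vm_term]
    rcases Nat.lt_or_ge n 2 with h | h
    · interval_cases n <;> simp
    · have hn : (2:ℝ) ≤ n := by exact_mod_cast h
      have hl : Λ n ≤ n := vonMangoldt_le_log.trans ((Real.log_le_sub_one_of_pos (by linarith)).trans (by linarith))
      have e : (n:ℝ) ^ (10:ℝ) = (n:ℝ) ^ (10:ℕ) := by exact_mod_cast Real.rpow_natCast (n:ℝ) 10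
      rw [e, div_le_iff₀ (by positivity)]
      refine hl.trans ?_
      have h7 : (2:ℝ)^7 ≤ (n:ℝ)^7 := by gcongr
      have : (1 / 128) * (1 / (n:ℝ)^2) * (n:ℝ)^10 = n * ((n:ℝ)^7/128) := by field_simp
      rw [this]
      nlinarith

lemma LL_real_nonneg {a : ℝ} (ha : 1 < a) : 0 ≤ (LL a).re := by
  have hsum := LSeriesSummable_vonMangoldt (s := (a:ℂ)) (by simpa using ha)
  rw [LL, LSeries, Complex.re_tsum hsum]
  refine tsum_nonneg fun n => ?_
  rw [LSeries.term_def]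
  split_ifs with h
  · simp
  · have : (Λ n : ℂ) / (n:ℂ)^(a:ℂ) = ((Λ n / (n:ℝ)^a : ℝ) : ℂ) := by
      push_cast [Complex.ofReal_cpow (n.cast_nonneg : (0:ℝ) ≤ n)]; rfl
    rw [this, Complex.ofReal_re]
    exact div_nonneg vonMangoldt_nonneg (by positivity)

lemma psiR_five : 17/12 ≤ psiR 5 := by
  have h := psiR_add_nat one_pos 4
  rw [psiR_one] at h
  norm_num [Finset.sum_range_succ] at h
  rw [h]
  linarith [Real.eulerMascheroniConstant_lt_two_thirds]

lemma log_pi_lt : Real.log Real.pi < 1.15 := by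
  rw [Real.log_lt_iff_lt_exp Real.pi_pos]
  have h1 := Real.pi_lt_d2
  have h2 := Real.exp_one_gt_d9
  have h3 : Real.exp 1.15 = Real.exp 1 * Real.exp 0.15 := by rw [← Real.exp_add]; norm_num
  have h4 := Real.quadratic_le_exp_of_nonneg (x := 0.15) (by norm_num)
  rw [h3]
  nlinarith

lemma one_div_re_nonneg {s : ℂ} (hs : 0 ≤ s.re) : 0 ≤ (1 / s).re := by
  rw [one_div, Complex.inv_re]; exact div_nonneg hs (Complex.normSq_nonneg _)

lemma fx_re_ten {s : ℂ} (hs : 10 ≤ s.re) : 0 ≤ (fx s).re := by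
  rw [fx_eq (by linarith)]
  have h1 := one_div_re_nonneg (s := s) (by linarith)
  have h2 := one_div_re_nonneg (s := s - 1) (by simp; linarith)
  have h3 := digamma_re_ge (s := s/2) (by rw [re_half]; linarith)
  have h4 : psiR 5 ≤ psiR (s/2).re := psiR_mono (by norm_num) (by rw [re_half]; linarith)
  have h5 := psiR_five
  have h6 := log_pi_lt
  have h7 := (Complex.re_le_norm _).trans (LL_ten hs)
  have e : (digamma (s/2) / 2).re = (digamma (s/2)).re / 2 := re_half _
  have e2 : ((Real.log Real.pi : ℂ) / 2).re = Real.log Real.pi / 2 := by rw [re_half, Complex.ofReal_re]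
  simp only [Complex.add_re, Complex.sub_re, e, e2]
  linarith

lemma fx_real_le {a : ℝ} (ha : 1 < a) :
    (fx a).re ≤ 1 / a + 1 / (a - 1) + Real.log (a / (2 * Real.pi)) / 2 := by
  rw [fx_eq (by simpa using ha)]
  have h1 : (1 / (a:ℂ)).re = 1 / a := by
    rw [show (1 / (a:ℂ)) = ((1 / a : ℝ) : ℂ) by push_cast; rfl, Complex.ofReal_re]
  have h2 : (1 / ((a:ℂ) - 1)).re = 1 / (a - 1) := by
    rw [show (1 / ((a:ℂ) - 1)) = ((1 / (a - 1) : ℝ) : ℂ) by push_cast; rfl, Complex.ofReal_re]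
  have h3 : (digamma ((a:ℂ) / 2) / 2).re = psiR (a/2) / 2 := by
    rw [re_half, show ((a:ℂ)/2) = ((a / 2 : ℝ) : ℂ) by push_cast; rfl, psiR_cast (by linarith), Complex.ofReal_re]
  have e2 : ((Real.log Real.pi : ℂ) / 2).re = Real.log Real.pi / 2 := by rw [re_half, Complex.ofReal_re]
  have h4 := psiR_le_log (x := a/2) (by linarith)
  have h5 := LL_real_nonneg ha
  simp only [Complex.add_re, Complex.sub_re, h1, h2, h3, e2]
  have h6 : Real.log (a / (2 * Real.pi)) = Real.log (a/2) - Real.log Real.pi := by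
    rw [← Real.log_div (by linarith) Real.pi_pos.ne']; congr 1; field_simp
  linarith

lemma fx_conj (s : ℂ) : fx (starRingEnd ℂ s) = starRingEnd ℂ (fx s) := by
  have hx : ∀ z, xi (starRingEnd ℂ z) = starRingEnd ℂ (xi z) := by
    intro z
    rcases lt_or_ge 0 z.re with h | h
    · exact xi_conj h
    · rw [← xi_one_sub, ← xi_one_sub z]
      have := xi_conj (s := 1 - z) (by simp; linarith)
      simpa using this
  have h2 : deriv xi (starRingEnd ℂ s) = starRingEnd ℂ (deriv xi s) := by
    have h3 : HasDerivAt xi _ (starRingEnd ℂ s) := (xi_diff s).hasDerivAt.conj_conj.congr_of_eventuallyEq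
      (Eventually.of_forall fun z => by simp [hx])
    exact h3.deriv
  simp only [fx, logDeriv_apply, h2, hx, map_div₀]

/-- growth of digamma -/
lemma digamma_growth : ∃ C : ℝ, 0 ≤ C ∧ ∀ z : ℂ, 1 ≤ z.re → ‖digamma z‖ ≤ C * Real.sqrt ‖z‖ := by
  have hS : Summable fun k : ℕ => 2 / ((k:ℝ) + 1) ^ (3/2 : ℝ) := by
    have := (summable_nat_add_iff 1).mpr (Real.summable_one_div_nat_rpow.mpr (by norm_num : (1:ℝ) < 3/2))
    have h := this.mul_left 2
    simpa [mul_one_div, div_eq_mul_inv] using h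
  refine ⟨1 + ∑' k : ℕ, 2 / ((k:ℝ) + 1) ^ (3/2 : ℝ), ?_, fun z hz => ?_⟩
  · have : 0 ≤ ∑' k : ℕ, 2 / ((k:ℝ) + 1) ^ (3/2 : ℝ) := tsum_nonneg fun k => by positivity
    linarith
  have hz1 : 1 ≤ ‖z‖ := hz.trans (Complex.re_le_norm z)
  have hsq : 1 ≤ Real.sqrt ‖z‖ := by rwa [Real.one_le_sqrt]
  rw [digamma_eq (by linarith), add_mul, ← tsum_mul_right]
  refine (norm_add_le _ _).trans (add_le_add ?_ ?_)
  · rw [norm_neg, Complex.norm_real, Real.norm_eq_abs, abs_of_pos (by linarith [Real.one_half_lt_eulerMascheroniConstant])]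
    linarith [Real.eulerMascheroniConstant_lt_two_thirds]
  · refine tsum_of_norm_bounded (hS.mul_right _).hasSum fun k => ?_
    rw [dt_eq (by linarith), norm_div, norm_mul]
    have h1 : ‖z - 1‖ ≤ 2 * ‖z‖ := by
      have := norm_sub_le z 1
      rw [norm_one] at this; linarith
    have h2 : ‖(k:ℂ) + 1‖ = k + 1 := by
      have : (k:ℂ) + 1 = ((k + 1 : ℕ) : ℂ) := by push_cast; rfl
      rw [this, Complex.norm_natCast]; push_cast; rfl
    have h3 := ks_norm one_pos le_rfl hz k
    have h4 : ‖z‖ ≤ ‖(k:ℂ) + z‖ := by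
      rw [Complex.norm_def, Complex.norm_def]
      apply Real.sqrt_le_sqrt
      rw [Complex.normSq_apply, Complex.normSq_apply]
      have : (0:ℝ) ≤ k := k.cast_nonneg
      simp
      nlinarith
    have h5 : Real.sqrt ((k:ℝ) + 1) * Real.sqrt ‖z‖ ≤ ‖(k:ℂ) + z‖ := by
      have a1 := Real.sqrt_le_sqrt h4
      have a2 := Real.sqrt_le_sqrt (show (k:ℝ) + 1 ≤ ‖(k:ℂ) + z‖ by linarith)
      calc _ ≤ Real.sqrt ‖(k:ℂ) + z‖ * Real.sqrt ‖(k:ℂ) + z‖ := by gcongr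
        _ = _ := Real.mul_self_sqrt (norm_nonneg _)
    have e : ((k:ℝ) + 1) ^ (3/2 : ℝ) = ((k:ℝ) + 1) * Real.sqrt ((k:ℝ) + 1) := by
      rw [Real.sqrt_eq_rpow, ← Real.rpow_one_add' (by positivity) (by norm_num)]; norm_num
    rw [h2, e]
    have hk : 0 < Real.sqrt ((k:ℝ) + 1) := Real.sqrt_pos.mpr (by positivity)
    calc ‖z - 1‖ / ((k + 1) * ‖(k:ℂ) + z‖) ≤ (2 * ‖z‖) / ((k + 1) * (Real.sqrt ((k:ℝ) + 1) * Real.sqrt ‖z‖)) := by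
          gcongr
      _ = 2 / (((k:ℝ) + 1) * Real.sqrt ((k:ℝ) + 1)) * (‖z‖ / Real.sqrt ‖z‖) := by
          field_simp
      _ = _ := by rw [Real.div_sqrt]

lemma fx_growth2 : ∃ C : ℝ, 0 ≤ C ∧ ∀ s : ℂ, 2 ≤ s.re → ‖fx s‖ ≤ C * Real.sqrt ‖s‖ := by
  obtain ⟨C, hC, h⟩ := digamma_growth
  set M := ∑' n, ‖LSeries.term (fun n => (Λ n : ℂ)) (2:ℝ) n‖
  have hM : 0 ≤ M := tsum_nonneg fun n => norm_nonneg _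
  have hp : 0 ≤ Real.log Real.pi := Real.log_nonneg (by linarith [Real.pi_gt_three])
  refine ⟨2 + Real.log Real.pi + C + M, by positivity, fun s hs => ?_⟩
  rw [fx_eq (by linarith)]
  have hs1 : 1 ≤ ‖s‖ := (by linarith : 1 ≤ s.re).trans (Complex.re_le_norm s)
  have hsq : 1 ≤ Real.sqrt ‖s‖ := by rwa [Real.one_le_sqrt]
  have h1 : ‖1 / s‖ ≤ 1 := by
    rw [norm_div, norm_one]; exact div_le_one_of_le₀ hs1 (by positivity)
  have h2 : ‖1 / (s - 1)‖ ≤ 1 := by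
    rw [norm_div, norm_one]; refine div_le_one_of_le₀ ?_ (by positivity)
    have := Complex.re_le_norm (s - 1)
    simp at this; linarith
  have h3 : ‖(Real.log Real.pi : ℂ) / 2‖ ≤ Real.log Real.pi := by
    rw [norm_div, Complex.norm_real, Real.norm_of_nonneg hp, Complex.norm_ofNat]; linarith
  have h4 : ‖digamma (s/2) / 2‖ ≤ C * Real.sqrt ‖s‖ := by
    have := h (s/2) (by rw [re_half]; linarith)
    rw [norm_div, Complex.norm_ofNat] at *
    have h5 : Real.sqrt (‖s‖ / 2) ≤ Real.sqrt ‖s‖ := Real.sqrt_le_sqrt (by linarith)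
    have h6 : 0 ≤ C * Real.sqrt (‖s‖ / 2) := by positivity
    have h7 : C * Real.sqrt (‖s‖ / 2) ≤ C * Real.sqrt ‖s‖ := by gcongr
    linarith
  have h5 : ‖LL s‖ ≤ M := LL_norm_le (by norm_num) hs
  refine (norm_sub_le _ _).trans ?_
  have a1 := norm_add_le (1 / s + 1 / (s - 1) - Real.log Real.pi / 2) (digamma (s / 2) / 2)
  have a2 := norm_sub_le (1 / s + 1 / (s - 1)) (Real.log Real.pi / 2 : ℂ)
  have a3 := norm_add_le (1 / s) (1 / (s - 1))
  nlinarith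

end
end MRH


namespace MRH
section
open Complex Filter Topology

lemma xi_conj' (z : ℂ) : xi (starRingEnd ℂ z) = starRingEnd ℂ (xi z) := by
  rcases lt_or_ge 0 z.re with h | h
  · exact xi_conj h
  · rw [← xi_one_sub, ← xi_one_sub z]
    have := xi_conj (s := 1 - z) (by simp; linarith)
    simpa using this

lemma xi_hasDeriv {s : ℂ} (h : xi s ≠ 0) : HasDerivAt xi (fx s * xi s) s := by
  have := (xi_diff s).hasDerivAt
  rwa [fx, logDeriv_apply, div_mul_cancel₀ _ h]

lemma line_lower (hRH : RiemannHypothesis) : ∃ K : ℝ, 0 ≤ K ∧ ∀ t : ℝ,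
    ‖(xi (11 + t * I))⁻¹‖ ≤ Real.exp (K * (12 + |t|) ^ 2) := by
  obtain ⟨C, hC, hf⟩ := fx_growth2
  set D := ‖(xi 11)⁻¹‖
  have hD : 0 ≤ D := norm_nonneg _
  have key : ∀ T : ℝ, 0 ≤ T → ‖(xi (11 + T * I))⁻¹‖ ≤ Real.exp ((C + D) * (12 + T) ^ 2) := by
    intro T hT
    have hre : ∀ u : ℝ, (11 + (u:ℂ) * I).re = 11 := by intro u; simp
    have hne : ∀ u : ℝ, xi (11 + u * I) ≠ 0 := fun u => xi_ne_zero hRH (by rw [hre]; norm_num)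
    have hd : ∀ u : ℝ, HasDerivAt (fun u : ℝ => (xi (11 + u * I))⁻¹)
        (-(I * fx (11 + u * I) * (xi (11 + u * I))⁻¹)) u := by
      intro u
      have h1 : HasDerivAt (fun u : ℝ => 11 + (u:ℂ) * I) I u := by
        simpa using ((hasDerivAt_id u).ofReal_comp.mul_const I).const_add 11
      have h2 : HasDerivAt (fun u : ℝ => xi (11 + u * I)) (fx (11 + u * I) * xi (11 + u * I) * I) u :=
        HasDerivAt.comp (h₂ := xi) (h := fun u : ℝ => 11 + (u:ℂ) * I) u (xi_hasDeriv (hne u)) h1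
      have h3 := h2.inv (hne u)
      refine h3.congr_deriv ?_
      have := hne u
      field_simp
    have := norm_le_gronwallBound_of_norm_deriv_right_le (a := 0) (b := T) (δ := D) (K := C * Real.sqrt (11 + T)) (ε := 0)
      (f := fun u : ℝ => (xi (11 + u * I))⁻¹) (f' := fun u => -(I * fx (11 + u * I) * (xi (11 + u * I))⁻¹))
      (fun u _ => (hd u).continuousAt.continuousWithinAt) (fun u _ => (hd u).hasDerivWithinAt) (by simp [D])
      (fun u hu => ?_) T ⟨hT, le_rfl⟩
    · rw [gronwallBound_ε0, sub_zero] at this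
      refine this.trans ?_
      have e1 : D ≤ Real.exp D := by linarith [Real.add_one_le_exp D]
      calc D * Real.exp (C * Real.sqrt (11 + T) * T) ≤ Real.exp D * Real.exp (C * Real.sqrt (11 + T) * T) := by gcongr
        _ = Real.exp (D + C * (Real.sqrt (11 + T) * T)) := by rw [← Real.exp_add]; ring_nf
        _ ≤ _ := by
          apply Real.exp_le_exp.mpr
          have : Real.sqrt (11 + T) ≤ 12 + T := by
            rw [Real.sqrt_le_left (by linarith)]; nlinarith
          have h2 : Real.sqrt (11 + T) * T ≤ (12 + T) ^ 2 := by nlinarith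
          have h3 : C * (Real.sqrt (11 + T) * T) ≤ C * (12 + T) ^ 2 := by gcongr
          have h4 : D * 1 ≤ D * (12 + T)^2 := by gcongr; nlinarith
          linarith
    · rw [norm_neg, norm_mul, norm_mul, norm_I, one_mul, add_zero]
      gcongr
      refine (hf _ (by rw [hre]; norm_num)).trans ?_
      gcongr
      refine (norm_add_le _ _).trans ?_
      rw [norm_mul, norm_I, Complex.norm_real, Real.norm_of_nonneg hu.1]
      simp; exact hu.2.le
  refine ⟨C + D, by positivity, fun t => ?_⟩
  rcases le_total 0 t with h | h
  · rw [abs_of_nonneg h]; exact key t h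
  · rw [abs_of_nonpos h]
    have h1 := key (-t) (by linarith)
    have h2 : (11 + ((-t:ℝ):ℂ) * I) = starRingEnd ℂ (11 + t * I) := by
      simp [map_add, map_mul, Complex.conj_ofNat]
    rw [h2, xi_conj', norm_inv, RCLike.norm_conj, ← norm_inv] at h1
    exact h1

lemma den_bound (hRH : RiemannHypothesis) {h : ℝ} (hh : 0 < h) (hh1 : h < 1) : ∃ K : ℝ, 0 ≤ K ∧ ∀ s : ℂ, 1/2 + h ≤ s.re → s.re ≤ 12 →
    ‖(xi s)⁻¹‖ ≤ Real.exp (K * (12 + |s.im|) ^ 2) := by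
  obtain ⟨K, hK, hl⟩ := line_lower hRH
  obtain ⟨C, hC, hx⟩ := xi_bound 0 22
  refine ⟨K + 21 * (C + 1 + K) / h, by positivity, fun s h1 h2 => ?_⟩
  set t := s.im
  set c : ℂ := 11 + t * I
  have hcre : c.re = 11 := by simp [c]
  have hcim : c.im = t := by simp [c]
  have ht := abs_nonneg t
  have hball : ∀ z ∈ Metric.ball (0:ℂ) 10.5, 1/2 < (c + z).re ∧ (c + z).re ≤ 22 ∧ |(c+z).im| ≤ |t| + 11 := by
    intro z hz
    have hz : ‖z‖ < 10.5 := by simpa using hz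
    have a1 := (abs_le.mp (Complex.abs_re_le_norm z))
    have a2 := Complex.abs_im_le_norm z
    rw [Complex.add_re, Complex.add_im, hcre, hcim]
    refine ⟨by norm_num at *; linarith, by norm_num at *; linarith, ?_⟩
    refine (abs_add_le _ _).trans ?_
    norm_num at *; linarith
  have hd : DifferentiableOn ℂ (fun z => fx (c + z)) (Metric.ball 0 10.5) := fun z hz =>
    (DifferentiableAt.comp z (fx_diff hRH (hball z hz).1) (by fun_prop)).differentiableWithinAt
  obtain ⟨L, hL⟩ := hd.isExactOn_ball
  have h0 : (0:ℂ) ∈ Metric.ball (0:ℂ) 10.5 := by simp; norm_num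
  have hcne : xi c ≠ 0 := xi_ne_zero hRH (by rw [hcre]; norm_num)
  have hne : ∀ z ∈ Metric.ball (0:ℂ) 10.5, xi (c + z) ≠ 0 := fun z hz => xi_ne_zero hRH (hball z hz).1
  have hder : ∀ z ∈ Metric.ball (0:ℂ) 10.5, HasDerivAt (fun z => xi (c + z) * Complex.exp (-L z)) 0 z := by
    intro z hz
    have b1 : HasDerivAt (fun z => xi (c + z)) (fx (c+z) * xi (c+z)) z := by
      have := HasDerivAt.comp (h₂ := xi) (h := fun z : ℂ => c + z) z (xi_hasDeriv (hne z hz)) ((hasDerivAt_id z).const_add c)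
      rw [mul_one] at this
      exact this
    have b2 := (hL z hz).neg.cexp
    refine (b1.mul b2).congr_deriv ?_
    simp only [Pi.neg_apply]
    ring
  have hconst : ∀ z ∈ Metric.ball (0:ℂ) 10.5, xi (c + z) * Complex.exp (-L z) = xi c * Complex.exp (-L 0) := by
    intro z hz
    have := Metric.isOpen_ball.is_const_of_deriv_eq_zero (convex_ball _ _).isPreconnected
      (fun z hz => (hder z hz).differentiableAt.differentiableWithinAt) (fun z hz => (hder z hz).deriv) hz h0
    simpa using this
  have hxi : ∀ z ∈ Metric.ball (0:ℂ) 10.5, xi (c + z) = xi c * Complex.exp (L z - L 0) := by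
    intro z hz
    have := hconst z hz
    rw [sub_eq_add_neg, Complex.exp_add, mul_comm (cexp (L z)), ← mul_assoc, ← this, mul_assoc, ← Complex.exp_add]
    simp
  set M := (C + 1 + K) * (12 + |t|) ^ 2
  have hM : 0 < M := by positivity
  have hmaps : Set.MapsTo (fun z => L z - L 0) (Metric.ball 0 10.5) {z | z.re ≤ M} := by
    intro z hz
    have hn := congrArg norm (hxi z hz)
    rw [norm_mul, Complex.norm_exp] at hn
    have b1 := hx (c + z) (by linarith [(hball z hz).1]) (hball z hz).2.1
    have b2 := hl t
    have e : Real.exp (L z - L 0).re = ‖xi (c+z)‖ * ‖(xi c)⁻¹‖ := by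
      rw [hn, norm_inv]; field_simp [norm_ne_zero_iff.mpr hcne]
    show (L z - L 0).re ≤ M
    rw [← Real.exp_le_exp, e]
    have b3 : ‖xi (c+z)‖ ≤ Real.exp ((C+1) * (12 + |t|)^2) := by
      have : (1 + |(c+z).im|)^2 ≤ (12 + |t|)^2 := by
        have := (hball z hz).2.2
        exact pow_le_pow_left₀ (by positivity) (by linarith) 2
      have : C * (1 + |(c+z).im|)^2 ≤ C * (12 + |t|)^2 := by gcongr
      have h4 := Real.add_one_le_exp ((C+1) * (12 + |t|)^2)
      nlinarith
    calc ‖xi (c+z)‖ * ‖(xi c)⁻¹‖ ≤ Real.exp ((C+1) * (12 + |t|)^2) * Real.exp (K * (12 + |t|) ^ 2) := by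
          gcongr
      _ = Real.exp M := by rw [← Real.exp_add]; congr 1; ring
  have hs : s = c + (s.re - 11 : ℝ) := by
    apply Complex.ext <;> simp [c, t]
  have hzn : ‖((s.re - 11 : ℝ):ℂ)‖ ≤ 10.5 - h := by
    rw [Complex.norm_real, Real.norm_eq_abs, abs_le]; constructor <;> norm_num <;> linarith
  have hzb : ((s.re - 11 : ℝ):ℂ) ∈ Metric.ball (0:ℂ) 10.5 := by
    rw [mem_ball_zero_iff]; linarith
  have bc := Complex.borelCaratheodory_zero hM (fun z hz => ((hL z hz).differentiableAt.sub_const _).differentiableWithinAt) hmaps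
    (by norm_num) hzb (by simp)
  have bc2 : ‖L ((s.re - 11 : ℝ):ℂ) - L 0‖ ≤ 21 * M / h := by
    refine bc.trans ?_
    have : 2 * M * ‖((s.re - 11 : ℝ):ℂ)‖ ≤ 21 * M := by nlinarith [norm_nonneg ((s.re - 11 : ℝ):ℂ)]
    have : h ≤ 10.5 - ‖((s.re - 11 : ℝ):ℂ)‖ := by linarith
    gcongr
  have e2 := hxi _ hzb
  rw [← hs] at e2
  rw [e2, mul_inv, norm_mul, ← Complex.exp_neg, Complex.norm_exp]
  calc ‖(xi c)⁻¹‖ * Real.exp (-(L ((s.re - 11 : ℝ):ℂ) - L 0)).re ≤ Real.exp (K * (12 + |t|) ^ 2) * Real.exp (21 * M / h) := by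
        gcongr
        · exact hl t
        · refine (Complex.re_le_norm _).trans ?_
          rw [norm_neg]; exact bc2
    _ = _ := by rw [← Real.exp_add]; congr 1; simp only [M]; ring

lemma normsq_hasDeriv {z : ℂ} {u : ℝ} (h : xi (z + u) ≠ 0) :
    HasDerivAt (fun u : ℝ => ‖xi (z + u)‖ ^ 2) (2 * (‖xi (z+u)‖ ^ 2 * (fx (z+u)).re)) u := by
  have h1 : HasDerivAt (fun u : ℝ => z + (u:ℂ)) 1 u := by
    simpa using ((hasDerivAt_id u).ofReal_comp).const_add z
  have h2 : HasDerivAt (fun u : ℝ => xi (z + u)) (fx (z + u) * xi (z + u) * 1) u :=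
    HasDerivAt.comp (h₂ := xi) (h := fun u : ℝ => z + (u:ℂ)) u (xi_hasDeriv h) h1
  refine h2.norm_sq.congr_deriv ?_
  rw [Complex.inner, ← Complex.normSq_eq_norm_sq, Complex.normSq_apply]
  simp
  ring

lemma xi_mono_ten (hRH : RiemannHypothesis) {z : ℂ} (hz : 10 ≤ z.re) {u : ℝ} (hu : 0 ≤ u) : ‖xi z‖ ≤ ‖xi (z + u)‖ := by
  have hne : ∀ v : ℝ, 0 ≤ v → xi (z + v) ≠ 0 := fun v hv => xi_ne_zero hRH (by simp; linarith)
  have := monotoneOn_of_deriv_nonneg (convex_Ici (0:ℝ)) (f := fun u : ℝ => ‖xi (z + u)‖ ^ 2)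
    (fun v hv => (normsq_hasDeriv (hne v hv)).continuousAt.continuousWithinAt)
    (fun v hv => (normsq_hasDeriv (hne v (interior_subset hv))).differentiableAt.differentiableWithinAt)
    (fun v hv => by
      have hv' : 0 ≤ v := interior_subset hv
      rw [(normsq_hasDeriv (hne v hv')).deriv]
      have := fx_re_ten (s := z + v) (by simp; linarith)
      positivity) (Set.self_mem_Ici) (Set.mem_Ici.mpr hu) hu
  simp at this
  exact (sq_le_sq₀ (norm_nonneg _) (norm_nonneg _)).mp this

lemma xi_shift (hRH : RiemannHypothesis) {h : ℝ} (hh : 0 < h) (hh1 : h < 1) {s : ℂ} (hs : 1/2 ≤ s.re) (hs2 : s.re ≤ 11) :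
    ‖xi (s - h)‖ ≤ ‖xi (s + h)‖ := by
  have hne : ∀ z : ℂ, 1/2 ≤ z.re → xi (z + h) ≠ 0 := fun z hz => xi_ne_zero hRH (by simp; linarith)
  have hdiff : ∀ z : ℂ, 1/2 ≤ z.re → DifferentiableAt ℂ (fun z => xi (z - h) * (xi (z + h))⁻¹) z := fun z hz =>
    ((xi_diff _).comp z (by fun_prop)).mul (((xi_diff _).comp z (by fun_prop)).inv (hne z hz))
  suffices hg : ‖xi (s - h) * (xi (s + h))⁻¹‖ ≤ 1 by
    rw [norm_mul, norm_inv, ← div_eq_mul_inv, div_le_one (norm_pos_iff.mpr (hne s hs))] at hg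
    exact hg
  refine PhragmenLindelof.vertical_strip (a := 1/2) (b := 11) (f := fun z => xi (z - h) * (xi (z + h))⁻¹) ⟨?_, ?_⟩ ?_ ?_ ?_ hs hs2
  · exact fun z hz => (hdiff z hz.1.le).differentiableWithinAt
  · have : closure (Complex.re ⁻¹' Set.Ioo (1/2) 11) ⊆ {z : ℂ | 1/2 ≤ z.re} :=
      closure_minimal (fun z hz => hz.1.le) (isClosed_le continuous_const Complex.continuous_re)
    exact fun z hz => (hdiff z (this hz)).continuousAt.continuousWithinAt
  · obtain ⟨K, hK, hden⟩ := den_bound hRH hh hh1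
    obtain ⟨C, hC, hx⟩ := xi_bound (-1) 12
    refine ⟨0.1, ?_, (C + 1 + K) * (200 * Real.exp 1.2), ?_⟩
    · rw [lt_div_iff₀ (by norm_num)]; have := Real.pi_gt_three; norm_num; linarith
    refine Asymptotics.IsBigO.of_bound 1 ?_
    filter_upwards [mem_inf_of_right (mem_principal_self _)] with z hz
    have hz1 : 1/2 < z.re := hz.1
    have hz2 : z.re < 11 := hz.2
    have ht := abs_nonneg z.im
    rw [norm_mul, one_mul, Real.norm_of_nonneg (Real.exp_pos _).le]
    have b1 := hx (z - h) (by simp; linarith) (by simp; linarith)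
    have b2 := hden (z + h) (by simp; linarith) (by simp; linarith)
    have e1 : (z - h).im = z.im := by simp
    have e2 : (z + h).im = z.im := by simp
    rw [e1] at b1; rw [e2] at b2
    have b3 : ‖xi (z - h)‖ ≤ Real.exp ((C+1) * (12 + |z.im|)^2) := by
      have : C * (1 + |z.im|)^2 ≤ C * (12 + |z.im|)^2 := by gcongr; norm_num
      have h4 := Real.add_one_le_exp ((C+1) * (12 + |z.im|)^2)
      nlinarith
    calc _ ≤ Real.exp ((C+1) * (12 + |z.im|)^2) * Real.exp (K * (12 + |z.im|) ^ 2) := by gcongr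
      _ = Real.exp ((C+1+K) * (12 + |z.im|)^2) := by rw [← Real.exp_add]; congr 1; ring
      _ ≤ _ := by
        apply Real.exp_le_exp.mpr
        rw [mul_assoc]
        gcongr
        have q := Real.quadratic_le_exp_of_nonneg (x := 1.2 + 0.1 * |z.im|) (by positivity)
        rw [Real.exp_add] at q
        nlinarith
  · intro z hz
    have : z + h = 1 - starRingEnd ℂ (z - h) := by
      apply Complex.ext <;> simp [hz] ; ring
    have e : ‖xi (z + h)‖ = ‖xi (z - h)‖ := by
      rw [this, xi_one_sub, xi_conj', RCLike.norm_conj]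
    have := hne z hz.ge
    rw [norm_mul, norm_inv, e, ← e, mul_inv_cancel₀ (norm_ne_zero_iff.mpr this)]
  · intro z hz
    have := xi_mono_ten hRH (z := z - h) (by simp; linarith) (u := 2 * h) (by linarith)
    have e : z - h + ((2 * h : ℝ) : ℂ) = z + h := by push_cast; ring
    rw [e] at this
    rw [norm_mul, norm_inv, ← div_eq_mul_inv]
    exact div_le_one_of_le₀ this (norm_nonneg _)

lemma fx_re_nonneg (hRH : RiemannHypothesis) {z : ℂ} (hz : 1/2 < z.re) : 0 ≤ (fx z).re := by
  rcases le_total 10 z.re with h10 | h10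
  · exact fx_re_ten h10
  have hne : xi (z + (0:ℝ)) ≠ 0 := xi_ne_zero hRH (by simpa using hz)
  have hd := normsq_hasDeriv hne
  rw [hasDerivAt_iff_tendsto_slope] at hd
  have hd2 := hd.mono_left (nhdsWithin_mono 0 (fun x (hx : x ∈ Set.Ioi (0:ℝ)) => (ne_of_gt hx : x ≠ 0)))
  have hpos : 0 ≤ 2 * (‖xi (z+(0:ℝ))‖ ^ 2 * (fx (z+(0:ℝ))).re) := by
    refine ge_of_tendsto hd2 ?_
    have : Set.Ioo (0:ℝ) 1 ∈ 𝓝[>] (0:ℝ) := Ioo_mem_nhdsGT one_pos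
    filter_upwards [this] with u hu
    have h1 := xi_shift hRH (h := u/2) (by linarith [hu.1]) (by linarith [hu.2]) (s := z + (u/2:ℝ)) (by simp; linarith [hu.1])
      (by simp; linarith [hu.2])
    have e1 : z + (u/2:ℝ) - (u/2:ℝ) = z := by ring
    have e2 : z + (u/2:ℝ) + (u/2:ℝ) = z + u := by push_cast; ring
    rw [e1, e2] at h1
    rw [slope_def_field]
    apply div_nonneg _ (by linarith [hu.1])
    have := (sq_le_sq₀ (norm_nonneg _) (norm_nonneg _)).mpr h1
    simpa using this
  simp only [Complex.ofReal_zero, add_zero] at hpos hne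
  have h2 : 0 < ‖xi z‖ ^ 2 := by have := norm_pos_iff.mpr hne; positivity
  by_contra hcon
  push Not at hcon
  nlinarith

end
end MRH


namespace MRH
section
open Complex Filter Topology MeasureTheory

noncomputable def FF (δ : ℝ) (z : ℂ) : ℂ := fx ((1/2 + δ : ℝ) + z)
noncomputable def uu (δ t : ℝ) : ℝ := (FF δ (t * I)).re

lemma FF_diff (hRH : RiemannHypothesis) {δ : ℝ} {z : ℂ} (hz : -δ < z.re) : DifferentiableAt ℂ (FF δ) z :=
  DifferentiableAt.comp z (fx_diff hRH (by simp at *; linarith)) (by fun_prop)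

lemma FF_growth (hRH : RiemannHypothesis) {δ : ℝ} (hδ : 0 < δ) : ∃ C : ℝ, 0 ≤ C ∧ ∀ z : ℂ, 0 ≤ z.re →
    ‖FF δ z‖ ≤ C * Real.sqrt (1 + ‖z‖) := by
  obtain ⟨C, hC, hf⟩ := fx_growth2
  set A := 4 + δ with hA
  refine ⟨C * A + 3 * (1 + C * A) / δ , by positivity, fun z hz => ?_⟩
  set s : ℂ := (1/2 + δ : ℝ) + z with hs
  have hsre : s.re = 1/2 + δ + z.re := by simp [hs]
  have hsn : ‖s‖ ≤ 1/2 + δ + ‖z‖ := by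
    refine (norm_add_le _ _).trans ?_
    rw [Complex.norm_real, Real.norm_of_nonneg (by positivity)]
  have hz0 := norm_nonneg z
  have h1 : 1 ≤ Real.sqrt (1 + ‖z‖) := by rw [Real.one_le_sqrt]; linarith
  have key : ∀ w : ℂ, ‖w‖ ≤ 2 + ‖s‖ → C * Real.sqrt ‖w‖ ≤ C * A * Real.sqrt (1 + ‖z‖) := by
    intro w hw
    rw [mul_assoc]
    gcongr
    rw [Real.sqrt_le_left (by positivity), mul_pow, Real.sq_sqrt (by positivity)]
    have q1 : 4 + δ ≤ A ^ 2 := by rw [hA]; nlinarith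
    have q2 : (4 + δ) * (1 + ‖z‖) ≤ A ^ 2 * (1 + ‖z‖) := by gcongr
    nlinarith [mul_nonneg hδ.le hz0]
  show ‖fx s‖ ≤ _
  rcases le_total 2 s.re with h2 | h2
  · have := (hf s h2).trans (key s (by linarith))
    have : 0 ≤ 3 * (1 + C * A) / δ * Real.sqrt (1 + ‖z‖) := by positivity
    rw [add_mul]; linarith
  · set c : ℂ := 2 + s.im * I
    have hcre : c.re = 2 := by simp [c]
    have hball : ∀ z ∈ Metric.ball (0:ℂ) 1.5, 1/2 < (c + z).re := by
      intro z hz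
      have hz : ‖z‖ < 1.5 := by simpa using hz
      have a1 := (abs_le.mp (Complex.abs_re_le_norm z))
      rw [Complex.add_re, hcre]
      norm_num at *; linarith
    have hsc : s = c + (s.re - 2 : ℝ) := by
      apply Complex.ext <;> simp [c]
    have hzn : ‖((s.re - 2 : ℝ):ℂ)‖ ≤ 1.5 - δ := by
      rw [Complex.norm_real, Real.norm_eq_abs, abs_le]; constructor <;> norm_num <;> linarith
    have hzb : ((s.re - 2 : ℝ):ℂ) ∈ Metric.ball (0:ℂ) 1.5 := by
      rw [mem_ball_zero_iff]; linarith
    have bc := Complex.borelCaratheodory (f := fun z => -fx (c + z)) one_pos (R := 1.5)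
      (fun z hz => (DifferentiableAt.comp z (fx_diff hRH (hball z hz)) (by fun_prop)).neg.differentiableWithinAt)
      (fun z hz => by
        have := fx_re_nonneg hRH (hball z hz)
        show (-fx (c+z)).re ≤ 1
        rw [Complex.neg_re]; linarith) (by norm_num) hzb
    rw [← hsc, norm_neg, norm_neg, add_zero] at bc
    have hcn : ‖c‖ ≤ 2 + ‖s‖ := by
      refine (norm_add_le _ _).trans ?_
      rw [norm_mul, norm_I, Complex.norm_real, mul_one, Complex.norm_ofNat]
      have := Complex.abs_im_le_norm s
      rw [Real.norm_eq_abs]; linarith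
    have b2 := (hf c hcre.ge).trans (key c hcn)
    refine bc.trans ?_
    have n0 := norm_nonneg ((s.re - 2 : ℝ):ℂ)
    have hd : δ ≤ 1.5 - ‖((s.re - 2 : ℝ):ℂ)‖ := by linarith
    calc _ ≤ 2 * 1 * 1.5 / δ + (C * A * Real.sqrt (1 + ‖z‖)) * (1.5 + 1.5) / δ := by
          gcongr <;> linarith
      _ = (3 + 3 * (C * A * Real.sqrt (1 + ‖z‖))) / δ := by ring
      _ ≤ (3 * (1 + C * A) * Real.sqrt (1 + ‖z‖)) / δ := by
          gcongr; nlinarith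
      _ ≤ _ := by
          have : 0 ≤ C * A * Real.sqrt (1 + ‖z‖) := by positivity
          rw [add_mul, mul_div_right_comm]; linarith

lemma uu_nonneg (hRH : RiemannHypothesis) {δ : ℝ} (hδ : 0 < δ) (t : ℝ) : 0 ≤ uu δ t :=
  fx_re_nonneg hRH (by simp; linarith)

lemma FFline_cont (hRH : RiemannHypothesis) {δ : ℝ} (hδ : 0 < δ) : Continuous fun t : ℝ => FF δ (t * I) := by
  rw [continuous_iff_continuousAt]
  intro t
  exact ContinuousAt.comp (f := fun t : ℝ => (t:ℂ) * I) (g := FF δ) (FF_diff hRH (by simpa using hδ)).continuousAt (by fun_prop)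

lemma uu_cont (hRH : RiemannHypothesis) {δ : ℝ} (hδ : 0 < δ) : Continuous (uu δ) :=
  Complex.continuous_re.comp (FFline_cont hRH hδ)

lemma sqrt_int : Integrable fun t : ℝ => Real.sqrt (1 + |t|) / (1 + |t|) ^ 2 := by
  have := integrable_one_add_norm (E := ℝ) (μ := volume) (r := 3/2) (by simp; norm_num)
  refine this.congr (Eventually.of_forall fun t => ?_)
  have h : 0 < 1 + |t| := by positivity
  show (1 + ‖t‖) ^ (-(3/2:ℝ)) = Real.sqrt (1 + |t|) / (1 + |t|) ^ 2
  rw [Real.norm_eq_abs, Real.sqrt_eq_rpow, ← Real.rpow_natCast, ← Real.rpow_sub h]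
  norm_num

lemma FF_mul_int (hRH : RiemannHypothesis) {δ : ℝ} (hδ : 0 < δ) {g : ℝ → ℂ} (hg : AEStronglyMeasurable g)
    {K : ℝ} (hK : ∀ t, ‖g t‖ ≤ K / (1 + |t|) ^ 2) : Integrable fun t : ℝ => FF δ (t * I) * g t := by
  obtain ⟨C, hC, hf⟩ := FF_growth hRH hδ
  refine (sqrt_int.const_mul (C * K)).mono' ((FFline_cont hRH hδ).aestronglyMeasurable.mul hg)
    (Eventually.of_forall fun t => ?_)
  rw [norm_mul]
  have h1 := hf (t * I) (by simp)
  have e : ‖(t:ℂ) * I‖ = |t| := by simp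
  rw [e] at h1
  calc _ ≤ (C * Real.sqrt (1 + |t|)) * (K / (1 + |t|) ^ 2) :=
        mul_le_mul h1 (hK t) (norm_nonneg _) (by positivity)
    _ = _ := by ring

lemma uu_mul_int (hRH : RiemannHypothesis) {δ : ℝ} (hδ : 0 < δ) {g : ℝ → ℂ} (hg : AEStronglyMeasurable g)
    {K : ℝ} (hK : ∀ t, ‖g t‖ ≤ K / (1 + |t|) ^ 2) : Integrable fun t : ℝ => (uu δ t : ℂ) * g t := by
  refine (FF_mul_int hRH hδ hg hK).mono ((Complex.continuous_ofReal.comp (uu_cont hRH hδ)).aestronglyMeasurable.mul hg)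
    (Eventually.of_forall fun t => ?_)
  rw [norm_mul, norm_mul]
  gcongr
  rw [Complex.norm_real]
  exact Complex.abs_re_le_norm _

lemma kern1 {z : ℂ} (hz : 0 < z.re) (t : ℝ) : (1 + |t|) ≤ ((1 + |z.im|) / z.re + 1) * ‖z + t * I‖ := by
  have h1 : z.re ≤ ‖z + t * I‖ := by
    have := Complex.re_le_norm (z + t * I); simpa using this
  have h2 : |z.im + t| ≤ ‖z + t * I‖ := by
    have := Complex.abs_im_le_norm (z + t * I); simpa using this
  have h3 : |t| ≤ |z.im + t| + |z.im| := by
    have := abs_sub (z.im + t) z.im; simpa using this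
  have h4 : 1 + |z.im| ≤ (1 + |z.im|) / z.re * ‖z + t * I‖ := by
    rw [div_mul_eq_mul_div, le_div_iff₀ hz]; gcongr
  linarith

lemma kern_ne {z : ℂ} (hz : 0 < z.re) (t : ℝ) : z + t * I ≠ 0 := re_ne_zero (by simpa using hz)

lemma kern_fac (z : ℂ) (t : ℝ) : z ^ 2 + t ^ 2 = (z + t * I) * (z + (-t : ℝ) * I) := by
  push_cast
  have := Complex.I_sq
  linear_combination ((t:ℂ)^2) * this

lemma kern_bd {z : ℂ} (hz : 0 < z.re) : ∃ K, 0 ≤ K ∧ ∀ t : ℝ, ‖1 / (z ^ 2 + t ^ 2)‖ ≤ K / (1 + |t|) ^ 2 := by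
  refine ⟨((1 + |z.im|) / z.re + 1) ^ 2, by positivity, fun t => ?_⟩
  have h1 := kern1 hz t
  have h2 := kern1 hz (-t)
  rw [abs_neg] at h2
  have n1 : 0 < ‖z + t * I‖ := norm_pos_iff.mpr (kern_ne hz t)
  have n2 : 0 < ‖z + (-t:ℝ) * I‖ := norm_pos_iff.mpr (kern_ne hz (-t))
  rw [kern_fac, norm_div, norm_one, norm_mul, div_le_div_iff₀ (by positivity) (by positivity), one_mul]
  calc (1 + |t|) ^ 2 = (1 + |t|) * (1 + |t|) := by ring
    _ ≤ _ := mul_le_mul h1 h2 (by positivity) (by positivity)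
    _ = _ := by ring

lemma kern_meas (z : ℂ) : AEStronglyMeasurable (fun t : ℝ => (1 / (z ^ 2 + (t:ℂ) ^ 2) : ℂ)) := by
  apply Measurable.aestronglyMeasurable; fun_prop

lemma kern_int_tendsto {z : ℂ} (hz : 0 < z.re) :
    Tendsto (fun R : ℝ => ∫ t in (-R)..R, (2 * z / (z ^ 2 + (t:ℂ) ^ 2) : ℂ)) atTop (𝓝 (2 * (Real.pi:ℂ))) := by
  have hsl : ∀ t : ℝ, z + t * I ∈ slitPlane := fun t => Or.inl (by simpa using hz)
  have hd : ∀ t : ℝ, HasDerivAt (fun t : ℝ => -I * (Complex.log (z + t * I) - Complex.log (z + (-t:ℝ) * I)))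
      (2 * z / (z ^ 2 + t ^ 2)) t := by
    intro t
    have a1 : HasDerivAt (fun t : ℝ => z + (t:ℂ) * I) I t := by
      simpa using ((hasDerivAt_id t).ofReal_comp.mul_const I).const_add z
    have a2 : HasDerivAt (fun t : ℝ => z + ((-t:ℝ):ℂ) * I) (-I) t := by
      simpa using ((hasDerivAt_id t).neg.ofReal_comp.mul_const I).const_add z
    have b1 := a1.clog_real (hsl t)
    have b2 := a2.clog_real (hsl (-t))
    refine ((b1.sub b2).const_mul (-I)).congr_deriv ?_
    have n1 := kern_ne hz t
    have n2 := kern_ne hz (-t)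
    rw [kern_fac]
    have e2 : z + ((-t:ℝ):ℂ)*I = z - t*I := by push_cast; ring
    rw [e2] at n2 ⊢
    have hz2 : 2 * z = (z + t * I) + (z - t * I) := by ring
    rw [hz2]
    generalize z + t * I = A at n1 ⊢
    generalize z - t * I = B at n2 ⊢
    have := Complex.I_sq
    field_simp
    linear_combination (-A - B) * this
  have hcont : Continuous fun t : ℝ => 2 * z / (z ^ 2 + t ^ 2) := by
    refine continuous_const.div (by fun_prop) fun t => ?_
    rw [kern_fac]; exact mul_ne_zero (kern_ne hz t) (kern_ne hz (-t))
  have e : ∀ R : ℝ, ∫ t in (-R)..R, (2 * z / (z ^ 2 + (t:ℂ) ^ 2) : ℂ) =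
      -2 * I * (Complex.log (z + R * I) - Complex.log (z + (-R:ℝ) * I)) := by
    intro R
    rw [intervalIntegral.integral_eq_sub_of_hasDerivAt (fun t _ => hd t) (hcont.intervalIntegrable _ _)]
    simp only [neg_neg]; ring
  simp_rw [e]
  have e2 : ∀ᶠ R : ℝ in atTop, Complex.log (z + R * I) - Complex.log (z + (-R:ℝ) * I) =
      Complex.log (((R⁻¹:ℝ):ℂ) * z + I) - Complex.log (((R⁻¹:ℝ):ℂ) * z - I) := by
    filter_upwards [eventually_gt_atTop 0] with R hR
    have hRc : (R:ℂ) ≠ 0 := by exact_mod_cast hR.ne'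
    have m1 : z + R * I = (R:ℂ) * (((R⁻¹:ℝ):ℂ) * z + I) := by push_cast; field_simp
    have m2 : z + (-R:ℝ) * I = (R:ℂ) * (((R⁻¹:ℝ):ℂ) * z - I) := by push_cast; field_simp; ring
    have p1 : ((R⁻¹:ℝ):ℂ) * z + I ≠ 0 := by
      intro h; have := kern_ne hz R; rw [m1, h, mul_zero] at this; exact this rfl
    have p2 : ((R⁻¹:ℝ):ℂ) * z - I ≠ 0 := by
      intro h; have := kern_ne hz (-R); rw [m2, h, mul_zero] at this; exact this rfl
    rw [m1, m2, Complex.log_ofReal_mul hR p1, Complex.log_ofReal_mul hR p2]; ring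
  have e3 : Tendsto (fun R : ℝ => Complex.log (((R⁻¹:ℝ):ℂ) * z + I) - Complex.log (((R⁻¹:ℝ):ℂ) * z - I)) atTop
      (𝓝 (Complex.log I - Complex.log (-I))) := by
    have q : Tendsto (fun R : ℝ => ((R⁻¹:ℝ):ℂ) * z) atTop (𝓝 0) := by
      have := ((Complex.continuous_ofReal.tendsto 0).comp tendsto_inv_atTop_zero).mul_const z
      simpa using this
    have q1 : Tendsto (fun R : ℝ => ((R⁻¹:ℝ):ℂ) * z + I) atTop (𝓝 I) := by simpa using q.add_const I
    have q2 : Tendsto (fun R : ℝ => ((R⁻¹:ℝ):ℂ) * z - I) atTop (𝓝 (-I)) := by simpa using q.sub_const I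
    exact (q1.clog (Or.inr (by simp))).sub (q2.clog (Or.inr (by simp)))
  have e4 := (e3.congr' (e2.mono fun R h => h.symm)).const_mul (-2 * I)
  convert e4 using 2
  rw [Complex.log_I, Complex.log_neg_I]
  have := Complex.I_sq
  linear_combination (2 * (Real.pi:ℂ)) * this

end
end MRH


namespace MRH
section
open Complex Filter Topology MeasureTheory

lemma edge_bound {z : ℂ} {C R : ℝ} {F : ℂ → ℂ} (hC : 0 ≤ C) (hF : ∀ w : ℂ, 0 ≤ w.re → ‖F w‖ ≤ C * Real.sqrt (1 + ‖w‖))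
    (hz : 0 < z.re) (hR : 2 * ‖z‖ + 1 ≤ R) {w : ℂ} (hw : 0 ≤ w.re) (h1 : R ≤ ‖w‖) (h2 : ‖w‖ ≤ 2 * R) :
    ‖dslope F z w * (2 * z / (w + z))‖ ≤ 12 * C * ‖z‖ / (R * Real.sqrt R) := by
  have hz0 := norm_nonneg z
  have hR0 : 0 < R := by linarith
  have hne : w ≠ z := by rintro rfl; linarith
  rw [dslope_of_ne _ hne, slope_def_field]
  have hs : ‖F w - F z‖ ≤ 4 * C * Real.sqrt R := by
    have a1 := hF w hw
    have a2 := hF z hz.le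
    have a3 : Real.sqrt (1 + ‖w‖) ≤ 2 * Real.sqrt R := by
      rw [Real.sqrt_le_left (by positivity), mul_pow, Real.sq_sqrt hR0.le]; linarith
    have a4 : Real.sqrt (1 + ‖z‖) ≤ 2 * Real.sqrt R := by
      rw [Real.sqrt_le_left (by positivity), mul_pow, Real.sq_sqrt hR0.le]; linarith
    calc _ ≤ ‖F w‖ + ‖F z‖ := norm_sub_le _ _
      _ ≤ C * (2 * Real.sqrt R) + C * (2 * Real.sqrt R) := by
        gcongr
        · exact a1.trans (by gcongr)
        · exact a2.trans (by gcongr)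
      _ = _ := by ring
  have hd : 2/3 * R ^ 2 ≤ ‖w - z‖ * ‖w + z‖ := by
    have b1 : R ^ 2 * (2/3) ≤ ‖w ^ 2 - z ^ 2‖ := by
      have := norm_sub_norm_le (w^2) (z^2)
      rw [norm_pow, norm_pow] at this
      nlinarith
    rw [← norm_mul, show (w - z) * (w + z) = w^2 - z^2 by ring]; linarith
  have hp : 0 < ‖w - z‖ * ‖w + z‖ := lt_of_lt_of_le (by positivity) hd
  have e : ‖(F w - F z) / (w - z) * (2 * z / (w + z))‖ = ‖F w - F z‖ * (2 * ‖z‖) / (‖w - z‖ * ‖w + z‖) := by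
    rw [norm_mul, norm_div, norm_div, norm_mul, Complex.norm_ofNat, div_mul_div_comm]
  rw [e]
  have hsq := Real.mul_self_sqrt hR0.le
  have hsp : 0 < Real.sqrt R := Real.sqrt_pos.mpr hR0
  calc _ ≤ (4 * C * Real.sqrt R) * (2 * ‖z‖) / (2/3 * R ^ 2) := by gcongr
    _ = _ := by
      rw [div_eq_div_iff (by positivity) (by positivity)]
      linear_combination (8 * C * ‖z‖ * R) * hsq

lemma herglotz_rect (hRH : RiemannHypothesis) {δ : ℝ} (hδ : 0 < δ) {z : ℂ} (hz : 0 < z.re) :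
    Tendsto (fun R : ℝ => ∫ t in (-R)..R, dslope (FF δ) z (t * I) * (2 * z / (t * I + z))) atTop (𝓝 0) := by
  obtain ⟨C, hC, hF⟩ := FF_growth hRH hδ
  set g : ℂ → ℂ := fun w => dslope (FF δ) z w * (2 * z / (w + z)) with hg
  set U : Set ℂ := {w | -min δ z.re < w.re}
  have hU : IsOpen U := isOpen_lt continuous_const Complex.continuous_re
  have hm : 0 < min δ z.re := lt_min hδ hz
  have hgd : DifferentiableOn ℂ g U := by
    have h1 : DifferentiableOn ℂ (FF δ) U := fun w hw => (FF_diff hRH (by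
      have : -min δ z.re < w.re := hw
      linarith [min_le_left δ z.re])).differentiableWithinAt
    have h2 : DifferentiableOn ℂ (dslope (FF δ) z) U :=
      (Complex.differentiableOn_dslope (hU.mem_nhds (by show -min δ z.re < z.re; linarith))).mpr h1
    refine h2.mul (DifferentiableOn.div (by fun_prop) (by fun_prop) fun w hw => ?_)
    refine re_ne_zero ?_
    have : -min δ z.re < w.re := hw
    rw [Complex.add_re]
    linarith [min_le_right δ z.re]
  have hlim : Tendsto (fun R : ℝ => 48 * C * ‖z‖ / Real.sqrt R) atTop (𝓝 0) :=
    tendsto_const_nhds.div_atTop Real.tendsto_sqrt_atTop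
  refine squeeze_zero_norm' ?_ hlim
  filter_upwards [eventually_ge_atTop (2 * ‖z‖ + 1)] with R hR
  have hR0 : 0 < R := by linarith [norm_nonneg z]
  have hrect := Complex.integral_boundary_rect_eq_zero_of_differentiableOn g (-(R * I)) (R + R * I) (hgd.mono (by
    intro w hw
    have := hw.1
    have h2 : w.re ∈ Set.uIcc (0:ℝ) R := by simpa using this
    rw [Set.uIcc_of_le hR0.le] at h2
    show -min δ z.re < w.re
    linarith [h2.1]))
  have r1 : (-((R:ℂ) * I)).re = 0 := by simp
  have r2 : (-((R:ℂ) * I)).im = -R := by simp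
  have r3 : ((R:ℂ) + R * I).re = R := by simp
  have r4 : ((R:ℂ) + R * I).im = R := by simp
  rw [r1, r2, r3, r4] at hrect
  set B := 12 * C * ‖z‖ / (R * Real.sqrt R)
  have hnle : ∀ w : ℂ, |w.re| ≤ R → |w.im| ≤ R → ‖w‖ ≤ 2 * R := by
    intro w a b; have := Complex.norm_le_abs_re_add_abs_im w; linarith
  have i1 : ‖∫ x in (0:ℝ)..R, g (x + (-R:ℝ) * I)‖ ≤ B * |R - 0| := by
    refine intervalIntegral.norm_integral_le_of_norm_le_const fun x hx => ?_
    rw [Set.uIoc_of_le hR0.le] at hx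
    refine edge_bound hC hF hz hR (by simp; exact hx.1.le) ?_ (hnle _ ?_ ?_)
    · have := Complex.abs_im_le_norm ((x:ℂ) + (-R:ℝ) * I)
      simp only [Complex.add_im, Complex.ofReal_im, Complex.mul_im, Complex.ofReal_re, Complex.I_re, Complex.I_im] at this
      simpa [abs_of_pos hR0] using this
    · simp [abs_of_pos hx.1, hx.2]
    · simp [abs_of_pos hR0]
  have i2 : ‖∫ x in (0:ℝ)..R, g (x + R * I)‖ ≤ B * |R - 0| := by
    refine intervalIntegral.norm_integral_le_of_norm_le_const fun x hx => ?_
    rw [Set.uIoc_of_le hR0.le] at hx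
    refine edge_bound hC hF hz hR (by simp; exact hx.1.le) ?_ (hnle _ ?_ ?_)
    · have := Complex.abs_im_le_norm ((x:ℂ) + (R:ℝ) * I)
      simpa [abs_of_pos hR0] using this
    · simp [abs_of_pos hx.1, hx.2]
    · simp [abs_of_pos hR0]
  have i3 : ‖∫ y in (-R)..R, g (R + y * I)‖ ≤ B * |R - (-R)| := by
    refine intervalIntegral.norm_integral_le_of_norm_le_const fun x hx => ?_
    rw [Set.uIoc_of_le (by linarith)] at hx
    refine edge_bound hC hF hz hR (by simp; exact hR0.le) ?_ (hnle _ ?_ ?_)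
    · have := Complex.abs_re_le_norm ((R:ℂ) + x * I)
      simpa [abs_of_pos hR0] using this
    · simp [abs_of_pos hR0]
    · simp [abs_le]; exact ⟨hx.1.le, hx.2⟩
  rw [sub_zero, abs_of_pos hR0] at i1 i2
  rw [sub_neg_eq_add, abs_of_pos (by linarith)] at i3
  have e : (∫ t in (-R)..R, g (t * I)) = -I * ((∫ x in (0:ℝ)..R, g (x + (-R:ℝ) * I)) - (∫ x in (0:ℝ)..R, g (x + R * I)))
      + ∫ y in (-R)..R, g (R + y * I) := by
    simp only [smul_eq_mul, Complex.ofReal_zero, zero_add] at hrect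
    have := Complex.I_sq
    linear_combination (I) * hrect + (∫ t in (-R)..R, g (t * I)) * this - (∫ y in (-R)..R, g (R + y * I)) * this
  show ‖∫ t in (-R)..R, g (t * I)‖ ≤ _
  rw [e]
  have hB : 4 * (B * R) = 48 * C * ‖z‖ / Real.sqrt R := by
    simp only [B]; field_simp; ring
  rw [← hB]
  refine (norm_add_le _ _).trans ?_
  rw [norm_mul, norm_neg, norm_I, one_mul]
  have := norm_sub_le (∫ x in (0:ℝ)..R, g (x + (-R:ℝ) * I)) (∫ x in (0:ℝ)..R, g (x + R * I))
  linarith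

lemma two_kern_bd {z : ℂ} (hz : 0 < z.re) : ∃ K, 0 ≤ K ∧ ∀ t : ℝ, ‖2 * z / (z ^ 2 + (t:ℂ) ^ 2)‖ ≤ K / (1 + |t|) ^ 2 := by
  obtain ⟨K, hK, h⟩ := kern_bd hz
  refine ⟨‖2 * z‖ * K, by positivity, fun t => ?_⟩
  rw [div_eq_mul_one_div, norm_mul, mul_div_assoc]
  gcongr
  exact h t

lemma two_kern_meas (z : ℂ) : AEStronglyMeasurable (fun t : ℝ => (2 * z / (z ^ 2 + (t:ℂ) ^ 2) : ℂ)) := by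
  apply Measurable.aestronglyMeasurable; fun_prop

lemma herglotz (hRH : RiemannHypothesis) {δ : ℝ} (hδ : 0 < δ) {z : ℂ} (hz : 0 < z.re) :
    ∫ t : ℝ, (uu δ t : ℂ) * (2 * z / (z ^ 2 + (t:ℂ) ^ 2)) = 2 * Real.pi * FF δ z := by
  obtain ⟨K, hK, hb⟩ := two_kern_bd hz
  have hint := FF_mul_int hRH hδ (two_kern_meas z) hb
  have hintu := uu_mul_int hRH hδ (two_kern_meas z) hb
  -- the full integral of F
  have h1 : ∫ t : ℝ, FF δ (t * I) * (2 * z / (z ^ 2 + (t:ℂ) ^ 2)) = 2 * Real.pi * FF δ z := by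
    have t1 := intervalIntegral_tendsto_integral hint tendsto_neg_atTop_atBot tendsto_id
    have t2 := (herglotz_rect hRH hδ hz).neg.add ((kern_int_tendsto hz).mul_const (FF δ z))
    rw [neg_zero, zero_add] at t2
    refine tendsto_nhds_unique t1 (t2.congr fun R => ?_)
    have hkc : Continuous fun t : ℝ => (2 * z / (z ^ 2 + (t:ℂ) ^ 2) : ℂ) := by
      refine continuous_const.div (by fun_prop) fun t => ?_
      rw [kern_fac]; exact mul_ne_zero (kern_ne hz t) (kern_ne hz (-t))
    have e : ∀ t : ℝ, dslope (FF δ) z (t * I) * (2 * z / (t * I + z)) =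
        FF δ z * (2 * z / (z ^ 2 + (t:ℂ) ^ 2)) - FF δ (t * I) * (2 * z / (z ^ 2 + (t:ℂ) ^ 2)) := by
      intro t
      have hne : (t:ℂ) * I ≠ z := by
        intro h; rw [← h] at hz; simp at hz
      rw [dslope_of_ne _ hne, slope_def_field, kern_fac]
      have n1 := kern_ne hz t
      have n2 := kern_ne hz (-t)
      have n3 : (t:ℂ) * I - z ≠ 0 := sub_ne_zero.mpr hne
      have e1 : (t:ℂ) * I + z = z + t * I := by ring
      have e2 : z + ((-t:ℝ):ℂ) * I = -(t * I - z) := by push_cast; ring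
      rw [e2] at n2 ⊢
      rw [e1]
      field_simp
      ring
    simp_rw [e]
    have j1 : IntervalIntegrable (fun t:ℝ => FF δ z * (2*z/(z^2+(t:ℂ)^2))) volume (-R) R :=
      (continuous_const.mul hkc).intervalIntegrable _ _
    have j2 : IntervalIntegrable (fun t:ℝ => FF δ (t*I) * (2*z/(z^2+(t:ℂ)^2))) volume (-R) R :=
      ((FFline_cont hRH hδ).mul hkc).intervalIntegrable _ _
    rw [intervalIntegral.integral_sub j1 j2, intervalIntegral.integral_const_mul]
    simp only [id]
    ring
  -- symmetrise
  have h2 : ∫ t : ℝ, (starRingEnd ℂ (FF δ (t * I))) * (2 * z / (z ^ 2 + (t:ℂ) ^ 2)) = 2 * Real.pi * FF δ z := by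
    rw [← h1, ← integral_neg_eq_self (fun t : ℝ => FF δ (t * I) * (2 * z / (z ^ 2 + (t:ℂ) ^ 2)))]
    congr 1; ext t
    have : FF δ (((-t : ℝ):ℂ) * I) = starRingEnd ℂ (FF δ (t * I)) := by
      unfold FF
      rw [← fx_conj]
      congr 1
      have h3 : starRingEnd ℂ 2 = 2 := Complex.conj_ofNat 2
      simp [h3]
    rw [this]; push_cast; ring
  have hint2 : Integrable fun t : ℝ => (starRingEnd ℂ (FF δ (t * I))) * (2 * z / (z ^ 2 + (t:ℂ) ^ 2)) := by
    have : ∀ t : ℝ, (starRingEnd ℂ (FF δ (t * I))) * (2 * z / (z ^ 2 + (t:ℂ) ^ 2)) =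
      2 * ((uu δ t : ℂ) * (2 * z / (z ^ 2 + (t:ℂ) ^ 2))) - FF δ (t * I) * (2 * z / (z ^ 2 + (t:ℂ) ^ 2)) := by
      intro t
      have := Complex.add_conj (FF δ (t * I))
      have h3 : starRingEnd ℂ (FF δ (t * I)) = 2 * (uu δ t : ℂ) - FF δ (t * I) := by
        rw [uu]; push_cast at this; linear_combination this
      rw [h3]; ring
    simp_rw [this]
    exact (hintu.const_mul 2).sub hint
  have h4 : ∀ t : ℝ, (uu δ t : ℂ) * (2 * z / (z ^ 2 + (t:ℂ) ^ 2)) =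
      (1/2) * (FF δ (t * I) * (2 * z / (z ^ 2 + (t:ℂ) ^ 2)) + (starRingEnd ℂ (FF δ (t * I))) * (2 * z / (z ^ 2 + (t:ℂ) ^ 2))) := by
    intro t
    have := Complex.add_conj (FF δ (t * I))
    rw [← add_mul, this, uu]; push_cast; ring
  simp_rw [h4]
  rw [integral_const_mul, integral_add hint hint2, h1, h2]
  ring

end
end MRH

namespace MRH
section
open Complex MeasureTheory Filter Topology Set

/-- the Laplace variable on the line `Re w = 1`. -/
noncomputable def ww (τ : ℝ) : ℂ := 1 + τ * I

structure LT (φ : ℝ → ℂ) (Φ : ℝ → ℂ) (C : ℝ) : Prop where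
  cont : Continuous φ
  zero : ∀ y ≤ 0, φ y = 0
  bd : ∀ y, ‖φ y‖ ≤ C * Real.exp (y / 2)
  int : ∀ τ, ∫ y : ℝ, exp (-(ww τ) * y) * φ y = Φ τ

lemma ww_re (τ : ℝ) : (ww τ).re = 1 := by simp [ww]
lemma ww_ne (τ : ℝ) : ww τ ≠ 0 := by
  intro h; have := ww_re τ; rw [h] at this; simp at this

lemma norm_exp_ww (τ y : ℝ) : ‖exp (-(ww τ) * y)‖ = Real.exp (-y) := by
  rw [Complex.norm_exp]; simp [ww]

/-- dominating function -/
noncomputable def dom (y : ℝ) : ℝ := (Ioi (0:ℝ)).indicator (fun y => Real.exp (-(1/2) * y)) y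

lemma dom_int : Integrable dom := by
  unfold dom
  rw [integrable_indicator_iff measurableSet_Ioi]
  exact exp_neg_integrableOn_Ioi 0 (by norm_num)

lemma dom_bd {φ : ℝ → ℂ} {C : ℝ} (h0 : ∀ y ≤ 0, φ y = 0) (hb : ∀ y, ‖φ y‖ ≤ C * Real.exp (y / 2)) (τ y : ℝ) :
    ‖exp (-(ww τ) * y) * φ y‖ ≤ C * dom y := by
  unfold dom
  rcases le_or_gt y 0 with hy | hy
  · rw [h0 y hy, indicator_of_notMem (by simpa using hy)]; simp
  · rw [indicator_of_mem (by simpa using hy), norm_mul, norm_exp_ww]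
    calc _ ≤ Real.exp (-y) * (C * Real.exp (y/2)) := by gcongr; exact hb y
      _ = C * (Real.exp (-y) * Real.exp (y/2)) := by ring
      _ = _ := by rw [← Real.exp_add]; congr 2; ring

lemma LT.integrable {φ Φ C} (h : LT φ Φ C) (τ : ℝ) : Integrable (fun y : ℝ => exp (-(ww τ) * y) * φ y) := by
  refine (dom_int.const_mul C).mono' ?_ (Eventually.of_forall fun y => dom_bd h.zero h.bd τ y)
  have := h.cont
  exact (by fun_prop : Continuous fun y : ℝ => exp (-(ww τ) * y) * φ y).aestronglyMeasurable

lemma LT.add {φ Φ C φ' Φ' C'} (h : LT φ Φ C) (h' : LT φ' Φ' C') :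
    LT (fun y => φ y + φ' y) (fun τ => Φ τ + Φ' τ) (C + C') where
  cont := h.cont.add h'.cont
  zero y hy := by rw [h.zero y hy, h'.zero y hy, add_zero]
  bd y := (norm_add_le _ _).trans (by rw [add_mul]; exact add_le_add (h.bd y) (h'.bd y))
  int τ := by
    simp_rw [mul_add]
    rw [integral_add (h.integrable τ) (h'.integrable τ), h.int, h'.int]

lemma LT.smul {φ Φ C} (h : LT φ Φ C) (c : ℂ) :
    LT (fun y => c * φ y) (fun τ => c * Φ τ) (‖c‖ * C) where
  cont := continuous_const.mul h.cont
  zero y hy := by rw [h.zero y hy, mul_zero]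
  bd y := by rw [norm_mul, mul_assoc]; gcongr; exact h.bd y
  int τ := by
    rw [← h.int τ, ← integral_const_mul]; congr 1; ext y; ring

lemma LT.congr {φ Φ C Φ'} (h : LT φ Φ C) (e : ∀ τ, Φ τ = Φ' τ) : LT φ Φ' C := by
  rw [← show Φ = Φ' from funext e]; exact h

lemma LT.integ {ι : Type*} [MeasurableSpace ι] {ν : Measure ι} [SFinite ν] {φ : ι → ℝ → ℂ} {Φ : ι → ℝ → ℂ} {u : ι → ℝ}
    (h : ∀ i, LT (φ i) (Φ i) (u i)) (hu : Integrable u ν)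
    (hm1 : ∀ y, AEStronglyMeasurable (fun i => φ i y) ν)
    (hm : AEStronglyMeasurable (fun p : ι × ℝ => φ p.1 p.2) (ν.prod volume)) :
    LT (fun y => ∫ i, φ i y ∂ν) (fun τ => ∫ i, Φ i τ ∂ν) (∫ i, u i ∂ν) where
  cont := by
    have : Continuous fun y : ℝ => ∫ i, (exp (-(y/2)) * φ i y) ∂ν := by
      refine continuous_of_dominated (bound := u) (fun y => (hm1 y).const_mul _)
        (fun y => Eventually.of_forall fun i => ?_) hu
        (Eventually.of_forall fun i => ?_)
      · rw [norm_mul, Complex.norm_exp]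
        have := (h i).bd y
        calc _ ≤ Real.exp (-(y/2:ℂ)).re * (u i * Real.exp (y/2)) := by gcongr
          _ = u i * (Real.exp (-(y/2)) * Real.exp (y/2)) := by simp; ring
          _ = u i := by rw [← Real.exp_add]; simp
      · have := (h i).cont
        fun_prop
    have h2 : (fun y => ∫ i, φ i y ∂ν) = fun y : ℝ => exp (y/2) * ∫ i, (exp (-(y/2)) * φ i y) ∂ν := by
      ext y
      rw [integral_const_mul, ← mul_assoc, ← Complex.exp_add]; simp
    rw [h2]
    fun_prop
  zero y hy := by simp [(h _).zero y hy]
  bd y := by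
    rw [← integral_mul_const]
    exact norm_integral_le_of_norm_le (hu.mul_const _) (Eventually.of_forall fun i => (h i).bd y)
  int τ := by
    simp_rw [← integral_const_mul]
    have hI : Integrable (fun p : ℝ × ι => exp (-(ww τ) * p.1) * φ p.2 p.1) (volume.prod ν) := by
      have h1 : Integrable (fun p : ι × ℝ => exp (-(ww τ) * p.2) * φ p.1 p.2) (ν.prod volume) := by
        refine (hu.mul_prod dom_int).mono' ?_ (Eventually.of_forall fun p => dom_bd (h p.1).zero (h p.1).bd τ p.2)
        refine AEStronglyMeasurable.mul ?_ hm
        exact (by fun_prop : Measurable fun p : ι × ℝ => exp (-(ww τ) * p.2)).aestronglyMeasurable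
      exact h1.swap
    rw [integral_integral_swap hI]
    simp_rw [(h _).int]

lemma LT.tsum {φ : ℕ → ℝ → ℂ} {Φ : ℕ → ℝ → ℂ} {u : ℕ → ℝ}
    (h : ∀ i, LT (φ i) (Φ i) (u i)) (hu : Summable u) (hΦ : ∀ τ, Summable fun i => Φ i τ) :
    LT (fun y => ∑' i, φ i y) (fun τ => ∑' i, Φ i τ) (∑' i, u i) := by
  have hu0 : ∀ i, 0 ≤ u i := fun i => by
    have := (norm_nonneg _).trans ((h i).bd 0); simpa using this
  have key := LT.integ (ν := Measure.count) h (by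
      rw [integrable_count_iff]; exact hu.abs) (fun y => (measurable_of_countable _).aestronglyMeasurable)
      (by
        apply Measurable.aestronglyMeasurable
        apply measurable_from_prod_countable_right
        intro i; exact (h i).cont.measurable)
  have conv : ∀ f : ℕ → ℂ, Summable f → ∫ i, f i ∂Measure.count = ∑' i, f i := fun f hf => by
    rw [integral_countable' (by rw [integrable_count_iff]; exact hf.norm)]
    simp
  have convr : ∀ f : ℕ → ℝ, Summable f → ∫ i, f i ∂Measure.count = ∑' i, f i := fun f hf => by
    rw [integral_countable' (by rw [integrable_count_iff]; exact hf.abs)]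
    simp
  have hφ : ∀ y, Summable fun i => φ i y := fun y =>
    Summable.of_norm_bounded (hu.mul_right _) fun i => (h i).bd y
  rw [convr u hu] at key
  simp_rw [conv _ (hΦ _), conv _ (hφ _)] at key
  exact key

lemma LT.unique {φ C} (h : LT φ (fun _ => 0) C) (y : ℝ) : φ y = 0 := by
  set g : ℝ → ℂ := fun y => exp (-(y:ℂ)) * φ y with hg
  have hgc : Continuous g := by have := h.cont; fun_prop
  have hgi : Integrable g := by
    have := h.integrable 0
    refine this.congr (Eventually.of_forall fun y => ?_)
    simp [ww, g]
  have hF : FourierTransform.fourier g = 0 := by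
    ext x
    rw [Real.fourier_real_eq_integral_exp_smul]
    have := h.int (2 * Real.pi * x)
    rw [Pi.zero_apply, ← this]
    congr 1; ext v
    rw [hg, smul_eq_mul]
    simp only
    rw [← mul_assoc, ← Complex.exp_add]
    congr 2
    simp only [ww]; push_cast; ring
  have := hgc.fourierInv_fourier_eq hgi (by rw [hF]; exact integrable_zero _ _ _)
  have h2 : g y = 0 := by
    rw [← this, hF]
    simp [Real.fourierInv_eq]
  simpa [g] using h2
end
end MRH

namespace MRH
section
open Complex MeasureTheory Filter Topology Set

lemma int_Ioi {φ : ℝ → ℂ} (h0 : ∀ y ≤ 0, φ y = 0) (τ : ℝ) :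
    ∫ y : ℝ, exp (-(ww τ) * y) * φ y = ∫ y in Ioi (0:ℝ), exp (-(ww τ) * y) * φ y := by
  rw [setIntegral_eq_integral_of_forall_compl_eq_zero]
  intro y hy
  rw [h0 y (by simpa using hy), mul_zero]

lemma pow_int (τ : ℝ) (n : ℕ) : IntegrableOn (fun y : ℝ => exp (-(ww τ) * y) * (y:ℂ) ^ n) (Ioi 0) := by
  have := Real.GammaIntegral_convergent (s := (n:ℝ) + 1) (by positivity)
  refine Integrable.mono' this ?_ ?_
  · exact (by fun_prop : Continuous fun y : ℝ => exp (-(ww τ) * y) * (y:ℂ) ^ n).aestronglyMeasurable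
  · refine (ae_restrict_iff' measurableSet_Ioi).mpr (Eventually.of_forall fun y hy => ?_)
    have : (0:ℝ) < y := hy
    rw [norm_mul, norm_exp_ww, norm_pow, Complex.norm_real, Real.norm_of_nonneg this.le, add_sub_cancel_right,
      Real.rpow_natCast]

lemma pow_laplace (τ : ℝ) (n : ℕ) :
    ∫ y in Ioi (0:ℝ), exp (-(ww τ) * y) * (y:ℂ) ^ n = n.factorial / (ww τ) ^ (n + 1) := by
  induction n with
  | zero =>
    simp only [pow_zero, mul_one]
    have h : (-(ww τ)).re < 0 := by simp [ww_re]
    rw [integral_exp_mul_complex_Ioi h 0]; simp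
  | succ n ih =>
    have hd : ∀ y ∈ Ici (0:ℝ), HasDerivAt (fun y : ℝ => exp (-(ww τ) * y) * (y:ℂ) ^ (n+1))
        ((n+1) * (exp (-(ww τ) * y) * (y:ℂ) ^ n) - ww τ * (exp (-(ww τ) * y) * (y:ℂ) ^ (n+1))) y := by
      intro y _
      have h1 : HasDerivAt (fun y : ℂ => exp (-(ww τ) * y) * y ^ (n+1))
        ((n+1) * (exp (-(ww τ) * y) * (y:ℂ) ^ n) - ww τ * (exp (-(ww τ) * y) * (y:ℂ) ^ (n+1))) (y:ℂ) := by
        have a1 := (((hasDerivAt_id (y:ℂ)).const_mul (-(ww τ))).cexp).mul (hasDerivAt_pow (n+1) (y:ℂ))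
        refine a1.congr_deriv ?_
        simp; ring
      exact h1.comp_ofReal
    have i0 := (pow_int τ n).const_mul ((n:ℂ)+1)
    have i1 := (pow_int τ (n+1)).const_mul (ww τ)
    have ht : Tendsto (fun y : ℝ => exp (-(ww τ) * y) * (y:ℂ) ^ (n+1)) atTop (𝓝 0) := by
      rw [tendsto_zero_iff_norm_tendsto_zero]
      refine (Real.tendsto_pow_mul_exp_neg_atTop_nhds_zero (n+1)).congr' ?_
      filter_upwards [eventually_ge_atTop 0] with y hy
      rw [norm_mul, norm_exp_ww, norm_pow, Complex.norm_real, Real.norm_of_nonneg hy, mul_comm]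
    have := integral_Ioi_of_hasDerivAt_of_tendsto' hd (i0.sub i1) ht
    rw [integral_sub i0 i1, integral_const_mul, integral_const_mul, ih] at this
    have h0 := ww_ne τ
    simp at this
    rw [Nat.factorial_succ]
    push_cast
    have h3 : (ww τ * ∫ y in Ioi (0:ℝ), exp (-(ww τ) * y) * (y:ℂ) ^ (n+1)) = (n+1) * (n.factorial / (ww τ) ^ (n + 1)) := by
      simp only [neg_mul]
      linear_combination -this
    field_simp at h3 ⊢
    linear_combination h3

lemma self_le_exp (y : ℝ) (hy : 0 ≤ y) : y ≤ 2 * Real.exp (y/2) := by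
  have := Real.add_one_le_exp (y/2); linarith

lemma LT_one : LT (fun y => ((max y 0 : ℝ) : ℂ)) (fun τ => 1 / ww τ ^ 2) 2 where
  cont := by fun_prop
  zero y hy := by simp [hy]
  bd y := by
    rw [Complex.norm_real, Real.norm_of_nonneg (le_max_right _ _)]
    rcases le_or_gt y 0 with hy | hy
    · rw [max_eq_right hy]; positivity
    · rw [max_eq_left hy.le]; exact self_le_exp y hy.le
  int τ := by
    rw [int_Ioi (fun y hy => by simp [hy])]
    have := pow_laplace τ 1
    simp only [Nat.factorial_one, Nat.cast_one] at this
    rw [← this]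
    refine setIntegral_congr_fun measurableSet_Ioi fun y hy => ?_
    have : (0:ℝ) < y := hy
    simp [max_eq_left this.le]

lemma LT_sq : LT (fun y => ((max y 0 : ℝ) : ℂ) ^ 2 / 2) (fun τ => 1 / ww τ ^ 3) 4 where
  cont := by fun_prop
  zero y hy := by simp [hy]
  bd y := by
    rw [norm_div, norm_pow, Complex.norm_real, Real.norm_of_nonneg (le_max_right _ _)]
    simp only [Complex.norm_ofNat]
    rcases le_or_gt y 0 with hy | hy
    · rw [max_eq_right hy]; simp; positivity
    · rw [max_eq_left hy.le]
      have := Real.quadratic_le_exp_of_nonneg (x := y/2) (by positivity)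
      nlinarith
  int τ := by
    rw [int_Ioi (fun y hy => by simp [hy])]
    have := pow_laplace τ 2
    have e : (1:ℂ) / ww τ ^ 3 = (1/2) * ((Nat.factorial 2 : ℕ) / ww τ ^ (2+1)) := by
      simp [Nat.factorial]; ring
    rw [e, ← this, ← integral_const_mul]
    refine setIntegral_congr_fun measurableSet_Ioi fun y hy => ?_
    have : (0:ℝ) < y := hy
    simp [max_eq_left this.le]; ring

lemma LT_shift {c : ℝ} (hc : 0 ≤ c) :
    LT (fun y => ((max (y - c) 0 : ℝ) : ℂ)) (fun τ => exp (-(ww τ) * c) / ww τ ^ 2) (2 * Real.exp (-(c/2))) where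
  cont := by fun_prop
  zero y hy := by
    rw [max_eq_right (by linarith)]; simp
  bd y := by
    have := LT_one.bd (y - c)
    refine this.trans (le_of_eq ?_)
    rw [mul_assoc, ← Real.exp_add]; congr 2; ring
  int τ := by
    have := integral_sub_right_eq_self (μ := volume) (fun y : ℝ => exp (-(ww τ) * ((y + c : ℝ):ℂ)) * ((max y 0 : ℝ) : ℂ)) c
    simp only [sub_add_cancel] at this
    rw [this, div_eq_mul_one_div, ← LT_one.int τ, ← integral_const_mul]
    congr 1; ext y
    rw [← mul_assoc, ← Complex.exp_add]
    congr 2; push_cast; ring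

lemma exp_laplace (τ : ℝ) {a : ℂ} (ha : 0 ≤ a.re) :
    IntegrableOn (fun y : ℝ => exp (-(ww τ + a) * y)) (Ioi 0) ∧
    ∫ y in Ioi (0:ℝ), exp (-(ww τ + a) * y) = 1 / (ww τ + a) := by
  have h : (-(ww τ + a)).re < 0 := by simp [ww_re]; linarith
  refine ⟨integrableOn_exp_mul_complex_Ioi h 0, ?_⟩
  rw [integral_exp_mul_complex_Ioi h 0]; simp
  rw [← neg_add_rev, add_comm, neg_div_neg_eq, one_div]

lemma wa_ne (τ : ℝ) {a : ℂ} (ha : 0 ≤ a.re) : ww τ + a ≠ 0 := by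
  intro h
  have := congrArg Complex.re h
  simp [ww_re] at this; linarith

lemma LT_exp {a : ℂ} (ha : 0 < a.re) :
    LT (fun y => 1 - exp (-a * ((max y 0 : ℝ) : ℂ))) (fun τ => 1 / ww τ - 1 / (ww τ + a)) 2 where
  cont := by fun_prop
  zero y hy := by simp [hy]
  bd y := by
    rcases le_or_gt y 0 with hy | hy
    · rw [max_eq_right hy]; simp; positivity
    · refine (norm_sub_le _ _).trans ?_
      rw [Complex.norm_exp, norm_one]
      have h1 : Real.exp (-a * ((max y 0 : ℝ) : ℂ)).re ≤ 1 := by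
        rw [Real.exp_le_one_iff]
        rw [Complex.re_mul_ofReal, Complex.neg_re, max_eq_left hy.le]; nlinarith
      have : 1 ≤ Real.exp (y/2) := Real.one_le_exp (by linarith)
      linarith
  int τ := by
    rw [int_Ioi (fun y hy => by simp [hy])]
    obtain ⟨i0, e0⟩ := exp_laplace τ (a := 0) (by simp)
    obtain ⟨i1, e1⟩ := exp_laplace τ ha.le
    rw [add_zero] at i0 e0
    rw [← e0, ← e1, ← integral_sub i0 i1]
    refine setIntegral_congr_fun measurableSet_Ioi fun y hy => ?_
    have : (0:ℝ) < y := hy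
    simp only [max_eq_left this.le]
    rw [mul_sub, mul_one, ← Complex.exp_add]; congr 2; ring

/-- kernel for the trivial zeros -/
noncomputable def ph (a : ℂ) (y : ℝ) : ℂ := (1 / a ^ 2) * (1 - exp (-a * ((max y 0 : ℝ) : ℂ)))

lemma LT_ph {a : ℂ} (ha : 0 < a.re) :
    LT (ph a) (fun τ => 1 / (a * ww τ * (ww τ + a))) (‖1 / a ^ 2‖ * 2) := by
  refine ((LT_exp ha).smul (1 / a ^ 2)).congr fun τ => ?_
  have h0 := ww_ne τ
  have h1 := wa_ne τ ha.le
  have h2 : a ≠ 0 := by rintro rfl; simp at ha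
  field_simp
  ring
end
end MRH

namespace MRH
section
open Complex MeasureTheory Filter Topology Set
open ArithmeticFunction hiding log

/-- trivial zero exponents -/
noncomputable def ak (k : ℕ) : ℝ := 2 * k + 3

lemma ak_pos (k : ℕ) : 0 < ak k := by unfold ak; positivity
lemma ak_re (k : ℕ) : 0 < ((ak k : ℝ) : ℂ).re := by rw [Complex.ofReal_re]; exact ak_pos k

lemma ak_sq_summable : Summable fun k => 1 / (ak k) ^ 2 := by
  have h := Real.summable_one_div_nat_pow.mpr (by norm_num : 1 < 2)
  have h2 := (summable_nat_add_iff 1).mpr h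
  refine h2.of_nonneg_of_le (fun k => by positivity) fun k => ?_
  unfold ak
  apply one_div_le_one_div_of_le (by positivity)
  gcongr
  push_cast; linarith [(Nat.cast_nonneg k : (0:ℝ) ≤ k)]

lemma psum {w : ℂ} (hw : 0 < w.re) :
    HasSum (fun k : ℕ => 1 / (((ak k : ℝ):ℂ) * w * (w + ((ak k : ℝ):ℂ))))
      ((digamma ((1 + w)/2) / 2 - digamma (1/2) / 2 - (1 - 1 / (1 + w))) / w ^ 2) := by
  have hs : 0 < ((1 + w)/2).re := by rw [re_half]; simp; linarith
  have h12 : 0 < ((1/2 : ℂ)).re := by norm_num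
  have h := ((dt_summable hs).hasSum.sub (dt_summable h12).hasSum).mul_left (1/2)
  have e : ∀ k : ℕ, (1/2 : ℂ) * (dt ((1+w)/2) k - dt (1/2) k) = 1 / (2 * k + 1) - 1 / (2 * k + 1 + w) := by
    intro k
    have n1 := ks_ne hs k
    have n2 := ks_ne h12 k
    have n3 : (2 * (k:ℂ) + 1) ≠ 0 := by intro h; apply n2; linear_combination h/2
    have n4 : (2 * (k:ℂ) + 1 + w) ≠ 0 := by intro h; apply n1; linear_combination h/2
    unfold dt
    rw [show (k:ℂ) + (1+w)/2 = (2 * (k:ℂ) + 1 + w) / 2 by ring, show (k:ℂ) + 1/2 = (2 * (k:ℂ) + 1) / 2 by ring]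
    generalize (k:ℂ) + 1 = q
    field_simp
    ring
  simp_rw [e] at h
  rw [← hasSum_nat_add_iff' 1] at h
  have h3 := h.div_const (w ^ 2)
  have hw0 : w ≠ 0 := by rintro rfl; simp at hw
  have q1 : ∀ k : ℕ, (1 / (2 * (((k+1:ℕ)):ℂ) + 1) - 1 / (2 * (((k+1:ℕ)):ℂ) + 1 + w)) / w ^ 2 =
      1 / (((ak k : ℝ):ℂ) * w * (w + ((ak k : ℝ):ℂ))) := by
    intro k
    unfold ak
    push_cast
    have n1 := ks_ne hs (k+1)
    have n2 := ks_ne h12 (k+1)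
    have n3 : (2 * (k:ℂ) + 3) ≠ 0 := by intro h; apply n2; push_cast; linear_combination h/2
    have n4 : (2 * (k:ℂ) + 3 + w) ≠ 0 := by intro h; apply n1; push_cast; linear_combination h/2
    rw [show (2 * ((k:ℂ)+1) + 1) = 2 * k + 3 by ring, show w + (2 * (k:ℂ) + 3) = 2 * k + 3 + w by ring]
    field_simp
    ring
  simp_rw [q1] at h3
  have q2 : (digamma ((1 + w)/2) / 2 - digamma (1/2) / 2 - (1 - 1 / (1 + w))) / w ^ 2 =
    (1 / 2 * (∑' (b : ℕ), dt ((1 + w) / 2) b - ∑' (b : ℕ), dt (1 / 2) b) -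
        ∑ i ∈ Finset.range 1, (1 / (2 * (i:ℂ) + 1) - 1 / (2 * (i:ℂ) + 1 + w))) / w ^ 2 := by
    rw [digamma_eq hs, digamma_eq h12]; simp; ring
  rw [q2]; exact h3

lemma LT_triv : LT (fun y => ∑' k : ℕ, ph (ak k : ℝ) y)
    (fun τ => (digamma ((1 + ww τ)/2) / 2 - digamma (1/2) / 2 - (1 - 1 / (1 + ww τ))) / ww τ ^ 2)
    (∑' k, (‖1 / ((ak k : ℝ) : ℂ) ^ 2‖ * 2)) := by
  have hw : ∀ τ, 0 < (ww τ).re := fun τ => by rw [ww_re]; norm_num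
  refine (LT.tsum (fun k => LT_ph (ak_re k)) ?_ fun τ => (psum (hw τ)).summable).congr fun τ => (psum (hw τ)).tsum_eq
  refine Summable.mul_right _ (ak_sq_summable.congr fun k => ?_)
  rw [norm_div, norm_pow, Complex.norm_real, Real.norm_of_nonneg (ak_pos k).le]; simp

/-- the averaged von Mangoldt sum -/
noncomputable def GG (y : ℝ) : ℝ := ∑' n : ℕ, Λ n / n * max (y - Real.log n) 0

lemma GG_term (τ : ℝ) (n : ℕ) :
    ((Λ n / n : ℝ) : ℂ) * (exp (-(ww τ) * (Real.log n : ℝ)) / ww τ ^ 2) =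
     LSeries.term (fun n => (Λ n : ℂ)) (1 + ww τ) n / ww τ ^ 2 := by
  rw [← mul_div_assoc]
  congr 1
  rcases eq_or_ne n 0 with rfl | hn
  · simp
  · rw [LSeries.term_of_ne_zero hn, Complex.cpow_add _ _ (by exact_mod_cast hn), Complex.cpow_one,
      Complex.cpow_def_of_ne_zero (by exact_mod_cast hn) (ww τ), ← Complex.natCast_log, neg_mul, Complex.exp_neg,
      mul_comm (ww τ)]
    push_cast
    field_simp

lemma LT_GG : ∃ C, LT (fun y => (GG y : ℂ)) (fun τ => LL (1 + ww τ) / ww τ ^ 2) C := by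
  have hs : ∀ τ, 1 < (1 + ww τ).re := fun τ => by simp [ww_re]
  have h : ∀ n : ℕ, LT (fun y => ((Λ n / n : ℝ) : ℂ) * ((max (y - Real.log n) 0 : ℝ) : ℂ))
      (fun τ => LSeries.term (fun n => (Λ n : ℂ)) (1 + ww τ) n / ww τ ^ 2)
      (‖((Λ n / n : ℝ) : ℂ)‖ * (2 * Real.exp (-(Real.log n/2)))) := fun n =>
    ((LT_shift (Real.log_natCast_nonneg n)).smul _).congr fun τ => GG_term τ n
  have hu : Summable fun n : ℕ => ‖((Λ n / n : ℝ) : ℂ)‖ * (2 * Real.exp (-(Real.log n/2))) := by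
    have := (LSeriesSummable_vonMangoldt (s := ((3/2 : ℝ):ℂ)) (by simp; norm_num)).norm
    refine (this.mul_left 2).congr fun n => ?_
    have h2 : ‖LSeries.term (fun n => (Λ n : ℂ)) ((3/2:ℝ):ℂ) n‖ = Λ n / (n:ℝ) ^ (3/2:ℝ) := vm_term _ _
    rw [h2]
    rw [Complex.norm_real, Real.norm_of_nonneg (div_nonneg vonMangoldt_nonneg (by positivity))]
    rcases eq_or_ne n 0 with rfl | hn
    · simp
    · have hn0 : (0:ℝ) < n := by exact_mod_cast Nat.pos_of_ne_zero hn
      rw [show (3/2:ℝ) = 1 + 1/2 by norm_num, Real.rpow_add hn0, Real.rpow_one, Real.rpow_def_of_pos hn0,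
        Real.exp_neg]
      field_simp
  have key := LT.tsum h hu fun τ => (LSeriesSummable_vonMangoldt (hs τ)).div_const _
  have e : (fun y => (GG y : ℂ)) = fun y => ∑' n : ℕ, ((Λ n / n : ℝ) : ℂ) * ((max (y - Real.log n) 0 : ℝ) : ℂ) := by
    ext y; unfold GG; push_cast; rfl
  rw [e]
  refine ⟨_, key.congr fun τ => ?_⟩
  rw [tsum_div_const]; rfl

end
end MRH

namespace MRH
section
open Complex MeasureTheory Filter Topology Set
open ArithmeticFunction hiding log

lemma ph_meas (y : ℝ) (b : ℝ) : Measurable fun t : ℝ => ph ((b:ℂ) + t * I) y := by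
  unfold ph; fun_prop

noncomputable def kt (b t y : ℝ) : ℂ := ph ((b:ℂ) + t * I) y + ph ((b:ℂ) + (-t:ℝ) * I) y

lemma lam_norm (b t : ℝ) : ‖(1:ℂ) / ((b:ℂ) + t * I) ^ 2‖ = 1 / (b ^ 2 + t ^ 2) := by
  rw [norm_div, norm_pow, Complex.sq_norm, Complex.normSq_add_mul_I]; simp

lemma lam_bd {b : ℝ} (hb : 0 < b) : ∃ K, 0 ≤ K ∧ ∀ t : ℝ, ‖((1 / (b ^ 2 + t ^ 2) : ℝ) : ℂ)‖ ≤ K / (1 + |t|) ^ 2 := by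
  obtain ⟨K, hK, h⟩ := kern_bd (z := (b:ℂ)) (by simpa using hb)
  refine ⟨K, hK, fun t => ?_⟩
  have := h t
  push_cast; exact this

lemma uu_lam_int (hRH : RiemannHypothesis) {δ b : ℝ} (hδ : 0 < δ) (hb : 0 < b) :
    Integrable fun t : ℝ => uu δ t * (1 / (b ^ 2 + t ^ 2)) := by
  obtain ⟨K, hK, h⟩ := lam_bd hb
  have hm : AEStronglyMeasurable (fun t : ℝ => ((1 / (b ^ 2 + t ^ 2) : ℝ) : ℂ)) := by
    apply Measurable.aestronglyMeasurable; fun_prop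
  have := (uu_mul_int hRH hδ hm h).re
  refine this.congr (Eventually.of_forall fun t => ?_)
  show ((uu δ t : ℂ) * ((1 / (b ^ 2 + t ^ 2) : ℝ) : ℂ)).re = _
  rw [← Complex.ofReal_mul, Complex.ofReal_re]

lemma lam_re {b : ℝ} (hb : 0 < b) (t : ℝ) : 0 < ((b:ℂ) + t * I).re := by simpa using hb

lemma kt_alg {p q w b : ℂ} (hp : p ≠ 0) (hq : q ≠ 0) (hw : w ≠ 0) (hp' : w + p ≠ 0) (hq' : w + q ≠ 0) (hb : b = (p + q) / 2) :
    1 / (p * w * (w + p)) + 1 / (q * w * (w + q)) = (1 / w ^ 2) * (2 * b / (p * q) - 2 * (b + w) / ((w + p) * (w + q))) := by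
  subst hb
  field_simp
  ring

lemma LT_kt {b : ℝ} (hb : 0 < b) (t : ℝ) :
    LT (kt b t) (fun τ => (1 / ww τ ^ 2) * (2 * (b:ℂ) / ((b:ℂ) ^ 2 + (t:ℂ) ^ 2) - 2 * (b + ww τ) / (((b:ℂ) + ww τ) ^ 2 + (t:ℂ) ^ 2)))
      (4 * (1 / (b ^ 2 + t ^ 2))) := by
  have h := (LT_ph (lam_re hb t)).add (LT_ph (lam_re hb (-t)))
  rw [lam_norm, lam_norm] at h
  have e : 1 / (b ^ 2 + t ^ 2) * 2 + 1 / (b ^ 2 + (-t) ^ 2) * 2 = 4 * (1 / (b ^ 2 + t ^ 2)) := by rw [neg_sq]; ring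
  rw [e] at h
  refine LT.congr h fun τ => ?_
  have h0 := ww_ne τ
  have hz : 0 < ((b:ℂ) + ww τ).re := by simp [ww_re]; linarith
  have hb' : 0 < (b:ℂ).re := by simpa using hb
  have n1 := kern_ne hb' t
  have n2 := kern_ne hb' (-t)
  have n3 := kern_ne hz t
  have n4 := kern_ne hz (-t)
  rw [kern_fac, kern_fac, show (b:ℂ) + ww τ + t * I = ww τ + (b + t * I) by ring,
    show (b:ℂ) + ww τ + (-t:ℝ) * I = ww τ + (b + (-t:ℝ) * I) by ring]
  refine kt_alg n1 n2 h0 ?_ ?_ (by push_cast; ring)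
  · intro h; apply n3; rw [← h]; ring
  · intro h; apply n4; rw [← h]; ring

lemma herglotz' (hRH : RiemannHypothesis) {δ : ℝ} (hδ : 0 < δ) {z : ℂ} (hz : 0 < z.re) :
    Integrable (fun t : ℝ => (uu δ t : ℂ) * (2 * z / (z ^ 2 + (t:ℂ) ^ 2))) := by
  obtain ⟨K, hK, hb⟩ := two_kern_bd hz
  exact uu_mul_int hRH hδ (two_kern_meas z) hb

lemma LT_zero (hRH : RiemannHypothesis) {δ b : ℝ} (hδ : 0 < δ) (hb : 0 < b) :
    ∃ C, LT (fun y => ∫ t : ℝ, ((uu δ t / (2 * Real.pi) : ℝ) : ℂ) * kt b t y)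
      (fun τ => (FF δ b - FF δ (b + ww τ)) / ww τ ^ 2) C := by
  have h := fun t : ℝ => (LT_kt hb t).smul ((uu δ t / (2 * Real.pi) : ℝ) : ℂ)
  have hm : Measurable (uu δ) := (uu_cont hRH hδ).measurable
  have key := LT.integ (ν := volume) h (by
    refine ((uu_lam_int hRH hδ hb).const_mul (4 / (2 * Real.pi))).congr (Eventually.of_forall fun t => ?_)
    simp only
    rw [Complex.norm_real, Real.norm_of_nonneg (div_nonneg (uu_nonneg hRH hδ t) (by positivity))]
    ring) (fun y => by
      apply Measurable.aestronglyMeasurable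
      unfold kt ph; fun_prop) (by
      apply Measurable.aestronglyMeasurable
      unfold kt ph; fun_prop)
  refine ⟨_, key.congr fun τ => ?_⟩
  have hz : 0 < ((b:ℂ) + ww τ).re := by simp [ww_re]; linarith
  have hb' : 0 < (b:ℂ).re := by simpa using hb
  have e : ∀ t : ℝ, ((uu δ t / (2 * Real.pi) : ℝ) : ℂ) * ((1 / ww τ ^ 2) * (2 * (b:ℂ) / ((b:ℂ) ^ 2 + (t:ℂ) ^ 2) - 2 * (b + ww τ) / (((b:ℂ) + ww τ) ^ 2 + (t:ℂ) ^ 2)))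
     = (1 / (2 * Real.pi * ww τ ^ 2)) * ((uu δ t : ℂ) * (2 * (b:ℂ) / ((b:ℂ) ^ 2 + (t:ℂ) ^ 2)) - (uu δ t : ℂ) * (2 * (b + ww τ) / (((b:ℂ) + ww τ) ^ 2 + (t:ℂ) ^ 2))) := by
    intro t; push_cast; ring
  simp_rw [e]
  rw [integral_const_mul, integral_sub (herglotz' hRH hδ hb') (herglotz' hRH hδ hz), herglotz hRH hδ hb', herglotz hRH hδ hz]
  have h0 := ww_ne τ
  have hp : (Real.pi : ℂ) ≠ 0 := by exact_mod_cast Real.pi_ne_zero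
  field_simp

lemma explicit (hRH : RiemannHypothesis) {δ : ℝ} (hδ : 0 < δ) (hδ' : δ < 1/2) (y : ℝ) :
    (GG y : ℂ) = ((max y 0 : ℝ) : ℂ) ^ 2 / 2 - Real.eulerMascheroniConstant * ((max y 0 : ℝ) : ℂ)
      + (∑' k : ℕ, ph (ak k : ℝ) y) + ∫ t : ℝ, ((uu δ t / (2 * Real.pi) : ℝ) : ℂ) * kt (1/2 - δ) t y := by
  have hb : 0 < 1/2 - δ := by linarith
  obtain ⟨C1, h1⟩ := LT_GG
  obtain ⟨C2, h2⟩ := LT_zero hRH hδ hb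
  have h := ((h1.add (LT_sq.smul (-1))).add (LT_one.smul Real.eulerMascheroniConstant)).add ((LT_triv.smul (-1)).add (h2.smul (-1)))
  have := LT.unique (h.congr (Φ' := fun _ => 0) fun τ => ?_) y
  · linear_combination this
  · have hs : 1 < (1 + ww τ).re := by simp [ww_re]
    have e1 := fx_eq hs
    have e2 := fx_one
    have f1 : FF δ ((1/2 - δ : ℝ) : ℂ) = fx 1 := by unfold FF; congr 1; push_cast; ring
    have f2 : FF δ (((1/2 - δ : ℝ) : ℂ) + ww τ) = fx (1 + ww τ) := by unfold FF; congr 1; push_cast; ring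
    have h0 := ww_ne τ
    rw [f1, f2, e1, e2, digamma_one_half]
    have l4 : Real.log (4 * Real.pi) = 2 * Real.log 2 + Real.log Real.pi := by
      rw [Real.log_mul (by norm_num) Real.pi_ne_zero, show (4:ℝ) = 2 ^ 2 by norm_num, Real.log_pow]; push_cast; ring
    have l2 : Complex.log 2 = (Real.log 2 : ℝ) := by rw [← Complex.ofReal_ofNat, ← Complex.ofReal_log (by norm_num)]
    rw [l4, l2, add_sub_cancel_left]
    have h1w : 1 + ww τ ≠ 0 := re_ne_zero (by linarith)
    push_cast
    field_simp
    ring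
end
end MRH

namespace MRH
section
open Complex MeasureTheory Filter Topology Set

lemma one_sub_exp_le {z : ℂ} (hz : z.re ≤ 0) : ‖1 - exp z‖ ≤ ‖z‖ := by
  have := Convex.norm_image_sub_le_of_norm_deriv_le (f := exp) (C := 1) (s := {z : ℂ | z.re ≤ 0}) (x := z) (y := 0)
    (fun x _ => Complex.differentiableAt_exp) (fun x hx => by
      rw [Complex.deriv_exp, Complex.norm_exp, Real.exp_le_one_iff]; exact hx)
    (convex_halfSpace_re_le 0) hz (by simp)
  simpa using this

lemma one_sub_exp_le_two {z : ℂ} (hz : z.re ≤ 0) : ‖1 - exp z‖ ≤ 2 := by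
  refine (norm_sub_le _ _).trans ?_
  rw [Complex.norm_exp, norm_one]
  have : Real.exp z.re ≤ 1 := Real.exp_le_one_iff.mpr hz
  linarith

lemma ph_diff {a : ℂ} (ha : 0 < a.re) {y η : ℝ} (hy : 0 ≤ y) (hη : 0 < η) :
    ‖ph a (y + η) - ph a y‖ ≤ Real.exp (-a.re * y) * (η * min (1 / ‖a‖) ((2/η) / ‖a‖ ^ 2)) := by
  have e : ph a (y + η) - ph a y = exp (-a * y) * ((1 - exp (-a * η)) / a ^ 2) := by
    unfold ph
    rw [max_eq_left hy, max_eq_left (by linarith)]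
    push_cast
    rw [mul_add, Complex.exp_add]; ring
  rw [e, norm_mul, Complex.norm_exp, Complex.re_mul_ofReal, Complex.neg_re]
  have hz : (-a * (η:ℂ)).re ≤ 0 := by rw [Complex.re_mul_ofReal, Complex.neg_re]; nlinarith
  have ha0 : a ≠ 0 := by rintro rfl; simp at ha
  have han : 0 < ‖a‖ := norm_pos_iff.mpr ha0
  gcongr
  rw [mul_min_of_nonneg _ _ hη.le]
  refine le_min ?_ ?_
  · rw [norm_div, norm_pow]
    have := one_sub_exp_le hz
    rw [norm_mul, norm_neg, Complex.norm_real, Real.norm_of_nonneg hη.le] at this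
    rw [div_le_iff₀ (by positivity)]
    refine this.trans (le_of_eq ?_)
    field_simp
  · rw [norm_div, norm_pow]
    rw [show η * (2 / η / ‖a‖ ^ 2) = 2 / ‖a‖ ^ 2 by field_simp]
    gcongr
    exact one_sub_exp_le_two hz

lemma J_eq {t T : ℝ} (ht : 0 < t) : ∫ a in (4:ℝ)..T, 1 / (a ^ 2 + t ^ 2) = (1/t) * (Real.arctan (T/t) - Real.arctan (4/t)) := by
  have hd : ∀ a ∈ Set.uIcc 4 T, HasDerivAt (fun a => (1/t) * Real.arctan (a/t)) (1 / (a ^ 2 + t ^ 2)) a := by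
    intro a _
    have := ((Real.hasDerivAt_arctan (a/t)).comp a ((hasDerivAt_id a).div_const t)).const_mul (1/t)
    refine this.congr_deriv ?_
    have : 0 < a ^ 2 + t ^ 2 := by positivity
    have h2 : 0 < 1 + (a/t)^2 := by positivity
    field_simp
    ring
  rw [intervalIntegral.integral_eq_sub_of_hasDerivAt hd]
  · ring
  · apply Continuous.intervalIntegrable
    refine continuous_const.div (by fun_prop) fun a => ?_
    positivity

lemma arctan_le_self' {v : ℝ} (hv : 0 ≤ v) : Real.arctan v ≤ v := by
  have := Real.le_tan (Real.arctan_nonneg.mpr hv) (Real.arctan_lt_pi_div_two v)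
  rwa [Real.tan_arctan] at this

lemma arctan_ge' {v : ℝ} (hv : 0 ≤ v) : v / (1 + v ^ 2) ≤ Real.arctan v := by
  have hd : ∀ x : ℝ, HasDerivAt (fun v : ℝ => Real.arctan v - v / (1 + v ^ 2))
      (1 / (1 + x^2) - (1 * (1 + x ^2) - x * (2 * x)) / (1 + x ^2)^2) x := by
    intro x
    have h0 : (1 + x ^ 2) ≠ 0 := by positivity
    have h1 : HasDerivAt (fun v : ℝ => 1 + v ^ 2) (2 * x) x := by
      simpa using ((hasDerivAt_pow 2 x).const_add (1:ℝ))
    exact (Real.hasDerivAt_arctan x).sub ((hasDerivAt_id x).div h1 h0)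
  have hm : MonotoneOn (fun v : ℝ => Real.arctan v - v / (1 + v ^ 2)) (Ici 0) := by
    apply monotoneOn_of_deriv_nonneg (convex_Ici 0)
    · exact fun x _ => (hd x).continuousAt.continuousWithinAt
    · exact fun x _ => (hd x).differentiableAt.differentiableWithinAt
    · intro x hx
      rw [(hd x).deriv, sub_nonneg, div_le_div_iff₀ (by positivity) (by positivity)]
      nlinarith [sq_nonneg x, sq_nonneg (1 + x^2)]
  have := hm (by simp) hv hv
  simp at this; linarith

lemma majorant {b t T : ℝ} (hb : 0 < b) (hb' : b ≤ 1/2) (hT : 4 ≤ T) :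
    min (1 / Real.sqrt (b ^ 2 + t ^ 2)) (T / (Real.sqrt (b ^ 2 + t ^ 2)) ^ 2) ≤
      (2 / Real.pi) * (∫ a in (4:ℝ)..T, 1 / (a ^ 2 + t ^ 2)) + 2.7 * (1 / (b ^ 2 + t ^ 2)) + 1.4 * T * (1 / (T ^ 2 + t ^ 2)) := by
  wlog ht : 0 ≤ t generalizing t
  · have := this (t := -t) (by linarith)
    simpa using this
  have hp3 := Real.pi_gt_three
  have hp4 := Real.pi_lt_d2
  have hr0 : 0 < b ^ 2 + t ^ 2 := by positivity
  set r := Real.sqrt (b ^ 2 + t ^ 2) with hr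
  have hrp : 0 < r := Real.sqrt_pos.mpr hr0
  have hr2 : r ^ 2 = b ^ 2 + t ^ 2 := Real.sq_sqrt hr0.le
  have hJ : 0 ≤ ∫ a in (4:ℝ)..T, 1 / (a ^ 2 + t ^ 2) :=
    intervalIntegral.integral_nonneg hT fun a _ => by positivity
  rcases le_or_gt r 2.7 with h | h
  · refine (min_le_left _ _).trans ?_
    have : 1 / r ≤ 2.7 * (1 / (b ^ 2 + t ^ 2)) := by
      rw [← hr2]
      rw [mul_one_div, div_le_div_iff₀ hrp (by positivity)]; nlinarith
    have h3 : 0 ≤ 1.4 * T * (1 / (T ^ 2 + t ^ 2)) := by positivity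
    have h4 : 0 ≤ (2 / Real.pi) * (∫ a in (4:ℝ)..T, 1 / (a ^ 2 + t ^ 2)) := by positivity
    linarith
  · have ht2 : 7.04 ≤ t ^ 2 := by nlinarith
    have ht0 : 0 < t := by
      rcases eq_or_lt_of_le ht with h | h
      · rw [← h] at ht2; norm_num at ht2
      · exact h
    rw [J_eq ht0]
    have h4 : (2 / Real.pi) * Real.arctan (4/t) ≤ 2.7 * (t / (b ^ 2 + t ^ 2)) := by
      calc (2 / Real.pi) * Real.arctan (4/t) ≤ (2 / Real.pi) * (4 / t) := by
            gcongr; exact arctan_le_self' (by positivity)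
        _ = (8 / Real.pi) / t := by ring
        _ ≤ (2.548) / t := by
            gcongr; rw [div_le_iff₀ (by positivity)]; linarith [Real.pi_gt_d4]
        _ ≤ _ := by
            rw [mul_div_assoc', div_le_div_iff₀ ht0 hr0]; nlinarith
    have hTp : 0 < T := by linarith
    have key : ∀ X, X ≤ (2 / Real.pi) * Real.arctan (T/t) + 1.4 * (T / t / (1 + (T/t)^2)) →
       X / t ≤ 2 / Real.pi * (1 / t * (Real.arctan (T / t) - Real.arctan (4 / t))) + 2.7 * (1 / (b ^ 2 + t ^ 2)) +
        1.4 * T * (1 / (T ^ 2 + t ^ 2)) := by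
      intro X hX
      rw [div_le_iff₀ ht0]
      have e : (2 / Real.pi * (1 / t * (Real.arctan (T / t) - Real.arctan (4 / t))) + 2.7 * (1 / (b ^ 2 + t ^ 2)) +
        1.4 * T * (1 / (T ^ 2 + t ^ 2))) * t = (2 / Real.pi) * Real.arctan (T/t) + 1.4 * (T / t / (1 + (T/t)^2))
          + (2.7 * (t / (b ^ 2 + t ^ 2)) - (2 / Real.pi) * Real.arctan (4/t)) := by
        have : 0 < T ^ 2 + t ^ 2 := by positivity
        have h2 : 0 < 1 + (T/t) ^ 2 := by positivity
        have e3 : T / t / (1 + (T/t)^2) = T * t / (T ^ 2 + t ^ 2) := by field_simp; ring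
        rw [e3]; field_simp; ring
      rw [e]; linarith
    rcases le_or_gt t T with htT | htT
    · refine (min_le_left _ _).trans (le_trans ?_ (key 1 ?_))
      · gcongr
        rw [hr]; exact Real.le_sqrt_of_sq_le (by nlinarith)
      · have h5 : Real.arctan (T/t) = Real.pi / 2 - Real.arctan (t/T) := by
          rw [← Real.arctan_inv_of_pos (by positivity)]; congr 1; field_simp
        rw [h5]
        have h6 : (2 / Real.pi) * (Real.pi/2 - Real.arctan (t/T)) = 1 - (2 / Real.pi) * Real.arctan (t/T) := by
          field_simp
        rw [h6]
        have h7 : (2 / Real.pi) * Real.arctan (t/T) ≤ 0.7 * (t / T) := by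
          have := arctan_le_self' (v := t/T) (by positivity)
          have h8 : 2 / Real.pi ≤ 0.7 := by rw [div_le_iff₀ (by positivity)]; linarith
          have h9 : 0 ≤ Real.arctan (t/T) := Real.arctan_nonneg.mpr (by positivity)
          nlinarith
        have h8 : 0.7 * (t / T) ≤ 1.4 * (T / t / (1 + (T / t) ^ 2)) := by
          have e3 : T / t / (1 + (T/t)^2) = T * t / (T ^ 2 + t ^ 2) := by field_simp; ring
          rw [e3, mul_div_assoc', mul_div_assoc', div_le_div_iff₀ hTp (by positivity)]
          nlinarith [mul_pos ht0 hTp, mul_nonneg ht0.le (mul_nonneg (sub_nonneg.mpr htT) (by linarith : 0 ≤ T + t))]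
        linarith
    · refine (min_le_right _ _).trans (le_trans ?_ (key (T/t) ?_))
      · rw [hr2, div_div]
        gcongr; nlinarith
      · set v := T / t with hv
        have hv1 : v ≤ 1 := by rw [hv, div_le_one ht0]; exact htT.le
        have hv0 : 0 < v := by positivity
        have h5 := arctan_ge' hv0.le
        have h6 : 0.6 ≤ 2 / Real.pi := by rw [le_div_iff₀ (by positivity)]; linarith
        have h7 : 0 < v / (1 + v ^ 2) := by positivity
        have h8 : v ≤ 2 * (v / (1 + v ^ 2)) := by
          rw [mul_div_assoc', le_div_iff₀ (by positivity)]
          nlinarith [mul_pos hv0 hv0]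
        nlinarith
end
end MRH

namespace MRH
section
open Complex MeasureTheory Filter Topology Set

lemma uu_pois (hRH : RiemannHypothesis) {δ a : ℝ} (hδ : 0 < δ) (ha : 0 < a) :
    ∫ t : ℝ, uu δ t * (1 / (a ^ 2 + t ^ 2)) = Real.pi * ((FF δ a).re / a) := by
  have h := herglotz hRH hδ (z := (a:ℂ)) (by simpa using ha)
  have e : ∀ t : ℝ, (uu δ t : ℂ) * (2 * (a:ℂ) / ((a:ℂ) ^ 2 + (t:ℂ) ^ 2)) = ((2 * a * (uu δ t * (1 / (a ^ 2 + t ^ 2))) : ℝ) : ℂ) := by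
    intro t; push_cast; ring
  simp_rw [e] at h
  rw [integral_complex_ofReal, integral_const_mul] at h
  have h2 := congrArg Complex.re h
  have e3 : (2 * (Real.pi:ℂ) * FF δ a).re = 2 * Real.pi * (FF δ a).re := by
    rw [show 2 * (Real.pi:ℂ) = ((2 * Real.pi : ℝ) : ℂ) by push_cast; rfl, Complex.re_ofReal_mul]
  rw [Complex.ofReal_re, e3] at h2
  rw [mul_div_assoc', eq_div_iff ha.ne']
  linarith

lemma FF_le {δ a : ℝ} (hδ : 0 < δ) (hδ' : δ ≤ 0.1) (ha : 4 ≤ a) :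
    (FF δ a).re ≤ Real.log (a / (2 * Real.pi)) / 2 + 2.45 / a := by
  have hp := Real.pi_pos
  have e : FF δ a = fx ((1/2 + δ + a : ℝ) : ℂ) := by unfold FF; push_cast; rfl
  rw [e]
  have h := fx_real_le (a := 1/2 + δ + a) (by linarith)
  refine h.trans ?_
  have h1 : 1 / (1/2 + δ + a) ≤ 1 / a := by gcongr; linarith
  have h2 : 1 / (1/2 + δ + a - 1) ≤ 1.15 / a := by
    rw [div_le_div_iff₀ (by linarith) (by linarith)]; linarith
  have h3 : Real.log ((1/2 + δ + a) / (2 * Real.pi)) ≤ Real.log (a / (2 * Real.pi)) + 0.6 / a := by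
    have : (1/2 + δ + a) / (2 * Real.pi) = (a / (2 * Real.pi)) * ((1/2 + δ + a) / a) := by field_simp
    rw [this, Real.log_mul (by positivity) (by positivity)]
    have h4 := Real.log_le_sub_one_of_pos (x := (1/2 + δ + a) / a) (by positivity)
    have : (1/2 + δ + a) / a - 1 ≤ 0.6 / a := by
      rw [show (1/2 + δ + a) / a - 1 = (1/2 + δ) / a by field_simp; ring]
      gcongr; linarith
    linarith
  have : (2.45:ℝ) / a = 1 / a + 1.15 / a + 0.6 / a / 2 := by ring
  linarith

lemma h_int {T : ℝ} (hT : 4 ≤ T) :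
    IntervalIntegrable (fun a : ℝ => (Real.log (a / (2 * Real.pi)) / 2 + 2.45 / a) / a) volume 4 T ∧
    ∫ a in (4:ℝ)..T, (Real.log (a / (2 * Real.pi)) / 2 + 2.45 / a) / a ≤
      Real.log (T / (2 * Real.pi)) ^ 2 / 4 + 0.6125 := by
  have hp := Real.pi_pos
  have hpos : ∀ a ∈ Set.uIcc 4 T, 0 < a := fun a ha => by
    rw [Set.uIcc_of_le hT] at ha; linarith [ha.1]
  have hd : ∀ a ∈ Set.uIcc 4 T, HasDerivAt (fun a => Real.log (a / (2 * Real.pi)) ^ 2 / 4 - 2.45 * a⁻¹)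
      ((Real.log (a / (2 * Real.pi)) / 2 + 2.45 / a) / a) a := by
    intro a ha
    have h0 := hpos a ha
    have h1 : HasDerivAt (fun a => Real.log (a / (2 * Real.pi))) (1 / (2 * Real.pi) / (a / (2 * Real.pi))) a :=
      ((hasDerivAt_id a).div_const _).log (by simp; positivity)
    have h2 := ((h1.pow 2).div_const 4).sub ((hasDerivAt_inv h0.ne').const_mul 2.45)
    refine HasDerivAt.congr_deriv (f := fun a => Real.log (a / (2 * Real.pi)) ^ 2 / 4 - 2.45 * a⁻¹) h2 ?_
    field_simp
    norm_num
    ring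
  have hc : ContinuousOn (fun a : ℝ => (Real.log (a / (2 * Real.pi)) / 2 + 2.45 / a) / a) (Set.uIcc 4 T) := by
    intro a ha
    have h0 := (hpos a ha).ne'
    apply ContinuousAt.continuousWithinAt
    have : a / (2 * Real.pi) ≠ 0 := by positivity
    fun_prop (disch := assumption)
  refine ⟨hc.intervalIntegrable, ?_⟩
  rw [intervalIntegral.integral_eq_sub_of_hasDerivAt hd hc.intervalIntegrable]
  have : 0 ≤ Real.log (4 / (2 * Real.pi)) ^ 2 := sq_nonneg _
  have : 0 ≤ T⁻¹ := by positivity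
  norm_num
  linarith

lemma J_swap (hRH : RiemannHypothesis) {δ T : ℝ} (hδ : 0 < δ) (hT : 4 ≤ T) :
    Integrable (fun t : ℝ => uu δ t * ∫ a in (4:ℝ)..T, 1 / (a ^ 2 + t ^ 2)) ∧
    ∫ t : ℝ, uu δ t * (∫ a in (4:ℝ)..T, 1 / (a ^ 2 + t ^ 2)) = Real.pi * ∫ a in (4:ℝ)..T, (FF δ a).re / a := by
  have hm : Measurable (uu δ) := (uu_cont hRH hδ).measurable
  simp_rw [intervalIntegral.integral_of_le hT, ← integral_const_mul]
  have hI : Integrable (fun p : ℝ × ℝ => uu δ p.1 * (1 / (p.2 ^ 2 + p.1 ^ 2))) (volume.prod (volume.restrict (Ioc 4 T))) := by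
    have h0 : Integrable (fun p : ℝ × ℝ => (uu δ p.1 * (1 / (4 ^ 2 + p.1 ^ 2))) * 1) (volume.prod (volume.restrict (Ioc 4 T))) :=
      (uu_lam_int hRH hδ (by norm_num : (0:ℝ) < 4)).mul_prod (integrable_const 1)
    refine h0.mono' ?_ ?_
    · apply Measurable.aestronglyMeasurable; fun_prop
    · have hs : (volume : Measure ℝ).prod (volume.restrict (Ioc 4 T)) = (volume.prod volume).restrict (univ ×ˢ Ioc 4 T) := by
        rw [← Measure.prod_restrict, Measure.restrict_univ]
      rw [hs]
      refine (ae_restrict_iff' (MeasurableSet.univ.prod measurableSet_Ioc)).mpr (Eventually.of_forall fun p hp => ?_)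
      have h4 : 4 < p.2 := hp.2.1
      have h1 := uu_nonneg hRH hδ p.1
      rw [Real.norm_of_nonneg (by positivity), mul_one]
      gcongr
  refine ⟨hI.integral_prod_left, ?_⟩
  rw [integral_integral_swap hI]
  refine setIntegral_congr_fun measurableSet_Ioc fun a ha => ?_
  exact uu_pois hRH hδ (by linarith [ha.1])

lemma FF_int (hRH : RiemannHypothesis) {δ T : ℝ} (hδ : 0 < δ) (hT : 4 ≤ T) :
    IntervalIntegrable (fun a : ℝ => (FF δ a).re / a) volume 4 T := by
  apply ContinuousOn.intervalIntegrable
  intro a ha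
  rw [Set.uIcc_of_le hT] at ha
  have h0 : a ≠ 0 := by linarith [ha.1]
  apply ContinuousAt.continuousWithinAt
  refine ContinuousAt.div ?_ continuousAt_id h0
  have h1 : ContinuousAt (FF δ) (a:ℂ) := (FF_diff hRH (by simp; linarith [ha.1])).continuousAt
  exact Complex.continuous_re.continuousAt.comp (h1.comp Complex.continuous_ofReal.continuousAt)

/-- the majorant -/
noncomputable def mj (b T t : ℝ) : ℝ := (2 / Real.pi) * (∫ a in (4:ℝ)..T, 1 / (a ^ 2 + t ^ 2)) + 2.7 * (1 / (b ^ 2 + t ^ 2)) + 1.4 * T * (1 / (T ^ 2 + t ^ 2))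

lemma mj_bound (hRH : RiemannHypothesis) {δ T b : ℝ} (hδ : 0 < δ) (hδ' : δ ≤ 0.1) (hT : 4 ≤ T) (hb : 0 < b) :
    Integrable (fun t => uu δ t * mj b T t) ∧ ∫ t, uu δ t * mj b T t ≤
      Real.pi * (Real.log (T / (2 * Real.pi)) ^ 2 / (2 * Real.pi) + 0.6125 * (2 / Real.pi) + 2.7 * ((FF δ b).re / b) +
        1.4 * (Real.log (T / (2 * Real.pi)) / 2 + 2.45 / T)) := by
  have hp := Real.pi_pos
  have hT0 : 0 < T := by linarith
  obtain ⟨i1, e1⟩ := J_swap hRH hδ hT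
  have i2 := uu_lam_int hRH hδ hb
  have i3 := uu_lam_int hRH hδ hT0
  have e2 := uu_pois hRH hδ hb
  have e3 := uu_pois hRH hδ hT0
  have e : ∀ t, uu δ t * mj b T t = (2 / Real.pi) * (uu δ t * (∫ a in (4:ℝ)..T, 1 / (a ^ 2 + t ^ 2))) +
     2.7 * (uu δ t * (1 / (b ^ 2 + t ^ 2))) + 1.4 * T * (uu δ t * (1 / (T ^ 2 + t ^ 2))) := by
    intro t; unfold mj; ring
  simp_rw [e]
  have j1 := i1.const_mul (2 / Real.pi)
  have j2 := i2.const_mul 2.7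
  have j3 := i3.const_mul (1.4 * T)
  have j12 : Integrable (fun t => (2 / Real.pi) * (uu δ t * (∫ a in (4:ℝ)..T, 1 / (a ^ 2 + t ^ 2))) +
     2.7 * (uu δ t * (1 / (b ^ 2 + t ^ 2)))) := j1.add j2
  refine ⟨j12.add j3, ?_⟩
  rw [integral_add j12 j3, integral_add j1 j2, integral_const_mul, integral_const_mul, integral_const_mul, e1, e2, e3]
  have h4 := FF_le hδ hδ' hT
  obtain ⟨k1, k2⟩ := h_int hT
  have h5 : ∫ a in (4:ℝ)..T, (FF δ a).re / a ≤ Real.log (T / (2 * Real.pi)) ^ 2 / 4 + 0.6125 := by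
    refine le_trans ?_ k2
    refine intervalIntegral.integral_mono_on hT (FF_int hRH hδ hT) k1 fun a ha => ?_
    have : 0 < a := by linarith [ha.1]
    gcongr
    exact FF_le hδ hδ' ha.1
  have q1 : 2 / Real.pi * (Real.pi * ∫ a in (4:ℝ)..T, (FF δ a).re / a) ≤ Real.pi * (Real.log (T / (2 * Real.pi)) ^ 2 / (2 * Real.pi) + 0.6125 * (2 / Real.pi)) := by
    calc _ ≤ 2 / Real.pi * (Real.pi * (Real.log (T / (2 * Real.pi)) ^ 2 / 4 + 0.6125)) := by gcongr
      _ = _ := by field_simp; ring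
  have q3 : 1.4 * T * (Real.pi * ((FF δ T).re / T)) ≤ Real.pi * (1.4 * (Real.log (T / (2 * Real.pi)) / 2 + 2.45 / T)) := by
    calc _ = Real.pi * (1.4 * (FF δ T).re) := by field_simp
      _ ≤ _ := by gcongr
  linarith
end
end MRH

namespace MRH
section
open Complex MeasureTheory Filter Topology Set
open ArithmeticFunction hiding log

noncomputable def SS (x : ℝ) : ℝ := ∑ n ∈ Finset.range (⌊x⌋₊ + 1), Λ n / n

lemma GG_eq {y : ℝ} {N : ℕ} (h : Real.exp y ≤ N) : GG y = ∑ n ∈ Finset.range (N + 1), Λ n / n * max (y - Real.log n) 0 := by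
  unfold GG
  refine tsum_eq_sum fun n hn => ?_
  have h1 : N < n := by simpa using hn
  have h2 : (N:ℝ) < n := by exact_mod_cast h1
  have : y ≤ Real.log n := by
    rw [← Real.log_exp y]
    exact Real.log_le_log (Real.exp_pos y) (by linarith)
  rw [max_eq_right (by linarith), mul_zero]

lemma vn_nonneg (n : ℕ) : 0 ≤ Λ n / (n:ℝ) := div_nonneg vonMangoldt_nonneg (by positivity)

lemma GG_ge {y η : ℝ} (hη : 0 ≤ η) : η * SS (Real.exp y) ≤ GG (y + η) - GG y := by
  obtain ⟨N, hN⟩ := exists_nat_ge (Real.exp (y + η))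
  have hN' : Real.exp y ≤ N := (Real.exp_le_exp.mpr (by linarith)).trans hN
  rw [GG_eq hN, GG_eq hN', ← Finset.sum_sub_distrib, SS, Finset.mul_sum]
  have hfl : ⌊Real.exp y⌋₊ ≤ N := Nat.floor_le_of_le hN'
  have hle : ∀ n : ℕ, 0 ≤ Λ n / n * max (y + η - Real.log n) 0 - Λ n / n * max (y - Real.log n) 0 := by
    intro n
    rw [← mul_sub]
    refine mul_nonneg (vn_nonneg n) (sub_nonneg.mpr (max_le_max (by linarith) le_rfl))
  refine le_trans ?_ (Finset.sum_le_sum_of_subset_of_nonneg (Finset.range_subset_range.mpr (by omega : ⌊Real.exp y⌋₊ + 1 ≤ N + 1)) fun n _ _ => hle n)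
  refine Finset.sum_le_sum fun n hn => ?_
  rcases eq_or_ne n 0 with rfl | hn0
  · simp
  have h1 : n ≤ ⌊Real.exp y⌋₊ := by simp at hn; omega
  have h2 : (n:ℝ) ≤ Real.exp y := (Nat.le_floor_iff (Real.exp_pos y).le).mp h1
  have h3 : Real.log n ≤ y := by
    rw [← Real.log_exp y]; exact Real.log_le_log (by exact_mod_cast Nat.pos_of_ne_zero hn0) h2
  rw [max_eq_left (by linarith), max_eq_left (by linarith)]
  apply le_of_eq; ring

lemma GG_le {y η : ℝ} (hη : 0 ≤ η) : GG y - GG (y - η) ≤ η * SS (Real.exp y) := by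
  obtain ⟨N, hN⟩ := exists_nat_ge (Real.exp y)
  have hN' : Real.exp (y - η) ≤ N := (Real.exp_le_exp.mpr (by linarith)).trans hN
  rw [GG_eq hN, GG_eq hN', ← Finset.sum_sub_distrib, SS, Finset.mul_sum]
  have hfl : ⌊Real.exp y⌋₊ ≤ N := Nat.floor_le_of_le hN
  rw [← Finset.sum_subset (Finset.range_subset_range.mpr (by omega : ⌊Real.exp y⌋₊ + 1 ≤ N + 1))]
  · refine Finset.sum_le_sum fun n _ => ?_
    rw [← mul_sub, mul_comm η]
    refine mul_le_mul_of_nonneg_left ?_ (vn_nonneg n)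
    rcases max_cases (y - Real.log n) 0 with h | h <;> rcases max_cases (y - η - Real.log n) 0 with h' | h' <;> linarith
  · intro n _ hn
    have h1 : ⌊Real.exp y⌋₊ < n := by simp at hn; omega
    have h2 : Real.exp y < n := (Nat.floor_lt (Real.exp_pos y).le).mp h1
    have h3 : y ≤ Real.log n := by
      rw [← Real.log_exp y]; exact Real.log_le_log (Real.exp_pos y) h2.le
    rw [max_eq_right (by linarith), max_eq_right (by linarith)]; ring

lemma kt_int (hRH : RiemannHypothesis) {δ b : ℝ} (hδ : 0 < δ) (hb : 0 < b) (y : ℝ) :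
    Integrable fun t : ℝ => ((uu δ t / (2 * Real.pi) : ℝ) : ℂ) * kt b t y := by
  have hm : Measurable (uu δ) := (uu_cont hRH hδ).measurable
  refine ((uu_lam_int hRH hδ hb).const_mul (4 / (2 * Real.pi) * Real.exp (y/2))).mono' ?_ (Eventually.of_forall fun t => ?_)
  · apply Measurable.aestronglyMeasurable
    unfold kt ph; fun_prop
  · have h1 := uu_nonneg hRH hδ t
    have h2 := (LT_kt hb t).bd y
    rw [norm_mul, Complex.norm_real, Real.norm_of_nonneg (by positivity)]
    calc _ ≤ uu δ t / (2 * Real.pi) * (4 * (1 / (b ^ 2 + t ^ 2)) * Real.exp (y / 2)) := by gcongr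
      _ = _ := by ring

lemma lam_norm' (b t : ℝ) : ‖(b:ℂ) + t * I‖ = Real.sqrt (b ^ 2 + t ^ 2) := Complex.norm_add_mul_I b t

lemma zero_incr (hRH : RiemannHypothesis) {δ b : ℝ} (hδ : 0 < δ) (hb : 0 < b) (hb' : b ≤ 1/2) {y η : ℝ} (hy : 0 ≤ y) (hη : 0 < η)
    (hT : 4 ≤ 2 / η) (hi : Integrable (fun t => uu δ t * mj b (2/η) t)) :
    ‖(∫ t : ℝ, ((uu δ t / (2 * Real.pi) : ℝ) : ℂ) * kt b t (y + η)) - ∫ t : ℝ, ((uu δ t / (2 * Real.pi) : ℝ) : ℂ) * kt b t y‖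
      ≤ η * Real.exp (-b * y) * ((∫ t, uu δ t * mj b (2/η) t) / Real.pi) := by
  have hp := Real.pi_pos
  rw [← integral_sub (kt_int hRH hδ hb _) (kt_int hRH hδ hb _)]
  have e : η * Real.exp (-b * y) * ((∫ t, uu δ t * mj b (2/η) t) / Real.pi) =
    ∫ t, (η * Real.exp (-b * y) / Real.pi) * (uu δ t * mj b (2/η) t) := by rw [integral_const_mul]; ring
  rw [e]
  refine norm_integral_le_of_norm_le (hi.const_mul _) (Eventually.of_forall fun t => ?_)
  have h1 := uu_nonneg hRH hδ t
  rw [← mul_sub, norm_mul, Complex.norm_real, Real.norm_of_nonneg (by positivity)]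
  have a1 := ph_diff (lam_re hb t) hy hη
  have a2 := ph_diff (lam_re hb (-t)) hy hη
  rw [lam_norm'] at a1 a2
  have r1 : ((b:ℂ) + t * I).re = b := by simp
  have r2 : ((b:ℂ) + (-t:ℝ) * I).re = b := by simp
  rw [r1] at a1; rw [r2, neg_sq] at a2
  have hm := majorant (t := t) hb hb' hT
  have hk : ‖kt b t (y + η) - kt b t y‖ ≤ 2 * (Real.exp (-b * y) * (η * mj b (2/η) t)) := by
    unfold kt
    rw [add_sub_add_comm]
    refine (norm_add_le _ _).trans ?_
    have : Real.exp (-b * y) * (η * min (1 / √(b ^ 2 + t ^ 2)) (2 / η / √(b ^ 2 + t ^ 2) ^ 2)) ≤ Real.exp (-b * y) * (η * mj b (2/η) t) := by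
      gcongr; exact hm
    linarith
  calc _ ≤ uu δ t / (2 * Real.pi) * (2 * (Real.exp (-b * y) * (η * mj b (2/η) t))) := by gcongr
    _ = _ := by field_simp

noncomputable def KK (T : ℝ) : ℝ := Real.log (T / (2 * Real.pi)) ^ 2 / (2 * Real.pi) + 1.02 + 1.4 * (Real.log (T / (2 * Real.pi)) / 2 + 2.45 / T)

lemma fx_one_bd : (fx 1).re ≤ 0.093 := by
  rw [fx_one, Complex.ofReal_re]
  have h1 := Real.eulerMascheroniConstant_lt_two_thirds
  have h2 : Real.log 12 ≤ Real.log (4 * Real.pi) := Real.log_le_log (by norm_num) (by linarith [Real.pi_gt_three])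
  have h3 : Real.log 12 = 2 * Real.log 2 + Real.log 3 := by
    rw [show (12:ℝ) = 2 ^ 2 * 3 by norm_num, Real.log_mul (by norm_num) (by norm_num), Real.log_pow]; push_cast; ring
  have h4 := Real.log_two_gt_d9
  have h5 : 1.0985 ≤ Real.log 3 := by
    have : Real.log 3 = Real.log 2 + Real.log (3/2) := by
      rw [← Real.log_mul (by norm_num) (by norm_num)]; norm_num
    have h6 := Real.hasSum_log_sub_log_of_abs_lt_one (x := 1/5) (by norm_num [abs_of_pos])
    have h7 := sum_le_hasSum (Finset.range 3) (fun i _ => by positivity) h6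
    have h8 : Real.log (1 + 1/5) - Real.log (1 - 1/5) = Real.log (3/2) := by
      rw [← Real.log_div (by norm_num) (by norm_num)]; norm_num
    rw [h8] at h7
    norm_num [Finset.sum_range_succ] at h7
    linarith
  linarith

lemma triv_bd {y η : ℝ} (hy : 0 ≤ y) (hη : 0 < η) :
    ‖(∑' k : ℕ, ph (ak k : ℝ) (y + η)) - ∑' k : ℕ, ph (ak k : ℝ) y‖ ≤ 4 * Real.exp (-3 * y) := by
  have hs : ∀ y, Summable fun k : ℕ => ph (ak k : ℝ) y := fun y => by
    refine Summable.of_norm_bounded ((ak_sq_summable.mul_right 2).mul_right (Real.exp (y/2))) fun k => ?_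
    refine ((LT_ph (ak_re k)).bd y).trans (le_of_eq ?_)
    rw [norm_div, norm_pow, Complex.norm_real, Real.norm_of_nonneg (ak_pos k).le]; simp
  rw [← (hs _).tsum_sub (hs _)]
  have hz : HasSum (fun k : ℕ => 1 / ((k:ℝ) + 1) ^ 2) (Real.pi ^ 2 / 6) := by
    have := (hasSum_nat_add_iff' 1).mpr hasSum_zeta_two
    simpa using this
  have hz2 := hz.mul_left (2 * Real.exp (-3 * y))
  refine (tsum_of_norm_bounded hz2 fun k => ?_).trans ?_
  · refine (ph_diff (ak_re k) hy hη).trans ?_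
    rw [Complex.norm_real, Real.norm_of_nonneg (ak_pos k).le, Complex.ofReal_re]
    have h1 : Real.exp (-ak k * y) ≤ Real.exp (-3 * y) := by
      rw [Real.exp_le_exp]; have : 3 ≤ ak k := by unfold ak; linarith [(Nat.cast_nonneg k : (0:ℝ) ≤ k)]
      nlinarith
    have h2 : η * min (1 / ak k) (2 / η / ak k ^ 2) ≤ 2 * (1 / ((k:ℝ)+1)^2) := by
      calc _ ≤ η * (2 / η / ak k ^ 2) := by gcongr; exact min_le_right _ _
        _ = 2 * (1 / ak k ^ 2) := by field_simp
        _ ≤ _ := by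
          gcongr; unfold ak; linarith [(Nat.cast_nonneg k : (0:ℝ) ≤ k)]
    calc _ ≤ Real.exp (-3 * y) * (2 * (1 / ((k:ℝ)+1)^2)) := by
          have := (ak_pos k); gcongr
      _ = _ := by ring
  · have : Real.pi ^ 2 / 6 ≤ 2 := by nlinarith [Real.pi_lt_d2, Real.pi_gt_three]
    nlinarith [Real.exp_pos (-3 * y)]

lemma GG_incr_δ (hRH : RiemannHypothesis) {δ : ℝ} (hδ : 0 < δ) (hδ' : δ ≤ 0.1) {y η : ℝ} (hy : 0 ≤ y) (hη : 0 < η)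
    (hT : 4 ≤ 2 / η) :
    |GG (y + η) - GG y - (η * y + η ^ 2 / 2 - Real.eulerMascheroniConstant * η)| ≤
      4 * Real.exp (-3 * y) + η * Real.exp (-(1/2 - δ) * y) * KK (2 / η) := by
  have hb : 0 < 1/2 - δ := by linarith
  obtain ⟨hi, hq⟩ := mj_bound hRH hδ hδ' hT hb
  have h1 := zero_incr hRH hδ hb (by linarith) hy hη hT hi
  have h2 := triv_bd hy hη
  have e1 := explicit hRH hδ (by linarith) (y + η)
  have e2 := explicit hRH hδ (by linarith) y
  rw [max_eq_left (by linarith)] at e1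
  rw [max_eq_left hy] at e2
  have e : ((GG (y + η) - GG y - (η * y + η ^ 2 / 2 - Real.eulerMascheroniConstant * η) : ℝ) : ℂ) =
     ((∑' k : ℕ, ph (ak k : ℝ) (y + η)) - ∑' k : ℕ, ph (ak k : ℝ) y) +
     ((∫ t : ℝ, ((uu δ t / (2 * Real.pi) : ℝ) : ℂ) * kt (1/2-δ) t (y + η)) - ∫ t : ℝ, ((uu δ t / (2 * Real.pi) : ℝ) : ℂ) * kt (1/2-δ) t y) := by
    push_cast [e1, e2]; ring
  rw [← Real.norm_eq_abs, ← Complex.norm_real, e]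
  refine (norm_add_le _ _).trans (add_le_add h2 (h1.trans ?_))
  have hp := Real.pi_pos
  gcongr
  rw [div_le_iff₀' hp]
  refine hq.trans ?_
  unfold KK
  have f1 : FF δ ((1/2 - δ : ℝ) : ℂ) = fx 1 := by unfold FF; congr 1; push_cast; ring
  rw [f1]
  have hf := fx_one_bd
  have hdiv : (fx 1).re / (1/2 - δ) ≤ 0.2325 := by
    rw [div_le_iff₀ hb]; linarith
  have hpi : 2 / Real.pi ≤ 0.637 := by rw [div_le_iff₀ hp]; nlinarith [Real.pi_gt_d4]
  refine mul_le_mul_of_nonneg_left ?_ hp.le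
  linarith

lemma GG_incr (hRH : RiemannHypothesis) {y η : ℝ} (hy : 0 ≤ y) (hη : 0 < η) (hT : 4 ≤ 2 / η) :
    |GG (y + η) - GG y - (η * y + η ^ 2 / 2 - Real.eulerMascheroniConstant * η)| ≤
      4 * Real.exp (-3 * y) + η * Real.exp (-(1/2) * y) * KK (2 / η) := by
  have ht : Tendsto (fun δ : ℝ => 4 * Real.exp (-3 * y) + η * Real.exp (-(1/2 - δ) * y) * KK (2 / η)) (𝓝[>] 0)
      (𝓝 (4 * Real.exp (-3 * y) + η * Real.exp (-(1/2 - 0) * y) * KK (2 / η))) := by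
    apply Tendsto.mono_left _ nhdsWithin_le_nhds
    apply Continuous.tendsto
    fun_prop
  rw [sub_zero] at ht
  refine ge_of_tendsto ht ?_
  filter_upwards [Ioo_mem_nhdsGT (by norm_num : (0:ℝ) < 0.1)] with δ hδ
  exact GG_incr_δ hRH hδ.1 hδ.2.le hy hη hT
end
end MRH

namespace MRH
section
open MeasureTheory Filter Topology Set
open ArithmeticFunction hiding log

lemma KK_nonneg {s : ℝ} (hs : 100 ≤ s) : 0 ≤ KK s := by
  unfold KK
  have hp := Real.pi_pos
  have h1 : 0 ≤ Real.log (s / (2 * Real.pi)) := by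
    apply Real.log_nonneg
    rw [le_div_iff₀ (by positivity)]
    nlinarith [Real.pi_le_four]
  have h0 : 0 < s := by linarith
  positivity

lemma SS_bd (hRH : RiemannHypothesis) {s : ℝ} (hs : 100 ≤ s) :
    |SS (s ^ 2) - 2 * Real.log s + Real.eulerMascheroniConstant| ≤ (1.01 + 1.0102 * KK s) / s := by
  have h0 : 0 < s := by linarith
  set y := 2 * Real.log s with hy
  set η := 2 / s with hη
  have hη0 : 0 < η := by positivity
  have h2 : 2 / η = s := by rw [hη]; field_simp
  have hl : 0 ≤ Real.log s := Real.log_nonneg (by linarith)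
  have ey : Real.exp y = s ^ 2 := by
    rw [hy, mul_comm, Real.exp_mul, Real.exp_log h0]; norm_cast
  have e1 : Real.exp (-(1/2) * y) = s⁻¹ := by
    rw [hy, show -(1/2) * (2 * Real.log s) = -Real.log s by ring, Real.exp_neg, Real.exp_log h0]
  have e3 : Real.exp (-3 * y) = (s⁻¹) ^ 6 := by
    rw [← e1, ← Real.exp_nat_mul]; congr 1; push_cast; ring
  have hK := KK_nonneg hs
  set K := KK s with hKd
  have hη1 : η ≤ 0.02 := by rw [hη, div_le_iff₀ h0]; linarith
  have hs2 : s⁻¹ ^ 6 ≤ s⁻¹ * s⁻¹ * 1e-6 := by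
    have a : s⁻¹ ≤ 0.01 := by rw [inv_le_comm₀ h0 (by norm_num)]; norm_num; linarith
    have a0 : 0 ≤ s⁻¹ := by positivity
    have : s⁻¹ ^ 4 ≤ 0.01 ^ 4 := by gcongr
    calc s⁻¹ ^ 6 = s⁻¹ * s⁻¹ * s⁻¹ ^ 4 := by ring
      _ ≤ _ := by gcongr; linarith
  have u := GG_incr hRH (by positivity : 0 ≤ y) hη0 (by rw [h2]; linarith)
  have hyη : 0 ≤ y - η := by
    have : 1 ≤ Real.log s := by
      rw [Real.le_log_iff_exp_le h0]; linarith [Real.exp_one_lt_d9]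
    linarith
  have l := GG_incr hRH hyη hη0 (by rw [h2]; linarith)
  rw [h2, e1, e3] at u
  have f1 : Real.exp (-(1/2) * (y - η)) ≤ s⁻¹ * 1.0102 := by
    rw [show -(1/2) * (y - η) = -(1/2) * y + η / 2 by ring, Real.exp_add, e1]
    gcongr
    have : Real.exp (η/2) ≤ Real.exp 0.01 := Real.exp_le_exp.2 (by linarith)
    refine this.trans ?_
    have := Real.one_sub_le_exp_neg 0.01
    rw [Real.exp_neg] at this
    have := inv_anti₀ (by norm_num) this
    rw [inv_inv] at this
    refine this.trans (by norm_num)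
  have f3 : Real.exp (-3 * (y - η)) ≤ s⁻¹ ^ 6 * 1.1 := by
    rw [show -3 * (y - η) = -3 * y + 3 * η by ring, Real.exp_add, e3]
    gcongr
    have : Real.exp (3 * η) ≤ Real.exp 0.06 := Real.exp_le_exp.2 (by linarith)
    refine this.trans ?_
    have := Real.one_sub_le_exp_neg 0.06
    rw [Real.exp_neg] at this
    have := inv_anti₀ (by norm_num) this
    rw [inv_inv] at this
    refine this.trans (by norm_num)
  rw [h2] at l
  have ge := GG_ge (y := y) hη0.le
  have le := GG_le (y := y) hη0.le
  rw [ey] at ge le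
  rw [sub_add_cancel] at l
  have u' := (abs_le.1 u).2
  have l' := (abs_le.1 l).1
  set S := SS (s ^ 2)
  set g := Real.eulerMascheroniConstant
  have hsi : s⁻¹ = η / 2 := by rw [hη]; field_simp
  rw [div_eq_mul_inv, hsi]
  rw [hsi] at u' hs2 f1 f3
  have f1' : η * Real.exp (-(1/2) * (y - η)) * K ≤ η * (η / 2 * 1.0102) * K := by gcongr
  rw [abs_le]
  constructor
  · refine le_of_mul_le_mul_left ?_ hη0
    nlinarith
  · refine le_of_mul_le_mul_left ?_ hη0
    nlinarith [mul_nonneg (mul_nonneg hη0.le hη0.le) hK]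

lemma SS_tendsto (hRH : RiemannHypothesis) :
    Tendsto (fun x : ℝ => SS x - Real.log x) atTop (𝓝 (-Real.eulerMascheroniConstant)) := by
  have hlog : Tendsto (fun s : ℝ => Real.log (s / (2 * Real.pi))^2 / s) atTop (𝓝 0) := by
    have hp := Real.pi_pos
    have a : Tendsto (fun s : ℝ => s / (2 * Real.pi)) atTop atTop := tendsto_id.atTop_div_const (by positivity)
    have b := (Real.isLittleO_pow_log_id_atTop (n := 2)).tendsto_div_nhds_zero.comp a
    have c := b.div_const (2 * Real.pi)
    rw [zero_div] at c
    refine c.congr fun s => ?_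
    simp only [Function.comp, id]
    field_simp
  have hlog1 : Tendsto (fun s : ℝ => Real.log (s / (2 * Real.pi)) / s) atTop (𝓝 0) := by
    have hp := Real.pi_pos
    have a : Tendsto (fun s : ℝ => s / (2 * Real.pi)) atTop atTop := tendsto_id.atTop_div_const (by positivity)
    have b := (Real.isLittleO_pow_log_id_atTop (n := 1)).tendsto_div_nhds_zero.comp a
    have c := b.div_const (2 * Real.pi)
    rw [zero_div] at c
    refine c.congr fun s => ?_
    simp only [Function.comp, id]
    field_simp
  have hi : Tendsto (fun s : ℝ => s⁻¹) atTop (𝓝 0) := tendsto_inv_atTop_zero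
  have hB : Tendsto (fun s : ℝ => (1.01 + 1.0102 * KK s) / s) atTop (𝓝 0) := by
    have := ((hi.const_mul (1.01 + 1.0102 * 1.02)).add (hlog.const_mul (1.0102 / (2 * Real.pi)))).add
      ((hlog1.const_mul (1.0102*0.7)).add ((hi.mul hi).const_mul (1.0102 * 1.4 * 2.45)))
    simp only [mul_zero, add_zero] at this
    refine this.congr fun s => ?_
    unfold KK
    ring
  have h1 : Tendsto (fun x : ℝ => SS x - Real.log x + Real.eulerMascheroniConstant) atTop (𝓝 0) := by
    refine squeeze_zero_norm' ?_ (hB.comp Real.tendsto_sqrt_atTop)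
    filter_upwards [eventually_ge_atTop 10000] with x hx
    have := SS_bd hRH (s := √x) (Real.le_sqrt_of_sq_le (by linarith))
    rw [Real.sq_sqrt (by linarith), Real.log_sqrt (by linarith)] at this
    simpa [mul_div_cancel₀] using this
  have := h1.sub_const Real.eulerMascheroniConstant
  simpa using this
end
end MRH

namespace MRH
section
open Filter Topology
open ArithmeticFunction hiding log

lemma tele {f G : ℕ → ℝ} (hf : ∀ n, 0 ≤ f n) (N : ℕ) (hG : ∀ n, N ≤ n → 0 ≤ G n)
    (h : ∀ n, N ≤ n → f (n + 1) ≤ G n - G (n + 1)) :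
    Summable f ∧ ∑' n, f n ≤ ∑ n ∈ Finset.range (N + 1), f n + G N := by
  have key : ∀ k, ∑ n ∈ Finset.range (N + k + 1), f n + G (N + k) ≤ ∑ n ∈ Finset.range (N + 1), f n + G N := by
    intro k
    induction k with
    | zero => simp
    | succ k ih =>
      rw [← add_assoc, Finset.sum_range_succ]
      have := h (N + k) (by omega)
      linarith
  have hb : ∀ k, ∑ n ∈ Finset.range k, f n ≤ ∑ n ∈ Finset.range (N + 1), f n + G N := by
    intro k
    have h1 : ∑ n ∈ Finset.range k, f n ≤ ∑ n ∈ Finset.range (N + k + 1), f n :=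
      Finset.sum_le_sum_of_subset_of_nonneg (Finset.range_subset_range.2 (by omega)) fun i _ _ => hf i
    linarith [key k, hG (N + k) (by omega)]
  exact ⟨summable_of_sum_range_le hf hb, Real.tsum_le_of_sum_range_le hf hb⟩

noncomputable def pl (n : ℕ) : ℝ := if n.Prime then Real.log n else 0
noncomputable def cc (n : ℕ) : ℝ := (Λ n - pl n) / n

lemma pl_nonneg (n : ℕ) : 0 ≤ pl n := by
  unfold pl; split_ifs
  · exact Real.log_natCast_nonneg n
  · rfl
lemma pl_le (n : ℕ) : pl n ≤ Real.log n := by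
  unfold pl; split_ifs
  · rfl
  · exact Real.log_natCast_nonneg n
lemma cc_nonneg (n : ℕ) : 0 ≤ cc n := by
  unfold cc pl
  apply div_nonneg _ (by positivity)
  split_ifs with h
  · rw [vonMangoldt_apply_prime h, sub_self]
  · simpa using vonMangoldt_nonneg

lemma cc_pow (p : Nat.Primes) (k : ℕ) : cc ((p:ℕ) ^ (k + 2)) = Real.log p / (p:ℝ) ^ (k + 2) := by
  unfold cc pl
  rw [if_neg (Nat.Prime.not_prime_pow (by omega)), vonMangoldt_apply_pow (by omega), vonMangoldt_apply_prime p.2]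
  push_cast; ring
lemma cc_prime (p : Nat.Primes) : cc (p:ℕ) = 0 := by
  unfold cc pl
  rw [if_pos p.2, vonMangoldt_apply_prime p.2]; simp

lemma cc_supp : Function.support cc ⊆ {n | IsPrimePow n} := by
  intro n hn
  by_contra h
  apply hn
  have : Λ n = 0 := vonMangoldt_eq_zero_iff.2 h
  have h2 : ¬ n.Prime := fun hp => h hp.isPrimePow
  simp [cc, pl, this, h2]

lemma prsum (f : ℕ → ℝ) : ∑' p : Nat.Primes, f p = ∑' n, (if n.Prime then f n else 0) := by
  have := tsum_subtype {n : ℕ | n.Prime} f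
  rw [show ∑' p : Nat.Primes, f p = ∑' x : {n : ℕ | n.Prime}, f x from rfl, this]
  refine tsum_congr fun n => ?_
  simp [Set.indicator_apply]

lemma prsummable {f : ℕ → ℝ} (h : Summable (fun n => if n.Prime then f n else 0)) :
    Summable (fun p : Nat.Primes => f p) := by
  have := h.comp_injective (i := fun p : Nat.Primes => (p:ℕ)) Nat.Primes.coe_nat_injective
  refine this.congr fun p => ?_
  simp [p.2]

lemma pow_two_le (p : Nat.Primes) : (2:ℝ) ≤ p := by exact_mod_cast p.2.two_le

lemma geom_p (p : Nat.Primes) : HasSum (fun k : ℕ => Real.log p / (p:ℝ) ^ (k + 2)) (Real.log p / (p * (p - 1))) := by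
  have hp := pow_two_le p
  have h := (hasSum_geometric_of_lt_one (r := (p:ℝ)⁻¹) (by positivity) (inv_lt_one_of_one_lt₀ (by linarith))).mul_left (Real.log p / p ^ 2)
  have h1 : (p:ℝ) - 1 ≠ 0 := by linarith
  rw [show Real.log p / (p * (p - 1)) = Real.log p / (p:ℝ) ^ 2 * (1 - (p:ℝ)⁻¹)⁻¹ by
    have : (1 - (p:ℝ)⁻¹) ≠ 0 := by
      intro h; apply h1; field_simp at h; linarith
    field_simp]
  refine h.congr_fun ?_ |> id
  intro k
  rw [inv_pow, pow_add]; field_simp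

lemma AA_eq (x : ℝ) : ∑ p ∈ (Finset.range (⌊x⌋₊ + 1)).filter Nat.Prime, Real.log p / p =
    ∑ n ∈ Finset.range (⌊x⌋₊ + 1), pl n / n := by
  rw [Finset.sum_filter]
  refine Finset.sum_congr rfl fun n _ => ?_
  unfold pl; split_ifs <;> simp

lemma SS_sub (x : ℝ) : SS x - ∑ n ∈ Finset.range (⌊x⌋₊ + 1), pl n / n = ∑ n ∈ Finset.range (⌊x⌋₊ + 1), cc n := by
  unfold SS cc
  rw [← Finset.sum_sub_distrib]
  refine Finset.sum_congr rfl fun n _ => ?_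
  ring

lemma cc_hasSum (hRH : RiemannHypothesis) {E : ℝ} (hE : Filter.Tendsto
      (fun x : ℝ => (∑ p ∈ (Finset.range (⌊x⌋₊ + 1)).filter Nat.Prime,
        Real.log p / p) - Real.log x) Filter.atTop (nhds E)) :
    HasSum cc (-Real.eulerMascheroniConstant - E) := by
  rw [hasSum_iff_tendsto_nat_of_nonneg cc_nonneg]
  rw [← tendsto_add_atTop_iff_nat 1]
  have h := ((SS_tendsto hRH).sub hE).comp tendsto_natCast_atTop_atTop
  refine h.congr fun n => ?_
  simp only [Function.comp]
  rw [AA_eq]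
  have := SS_sub (n:ℝ)
  rw [Nat.floor_natCast] at this ⊢
  linarith
end
end MRH

namespace MRH
section
open Filter Topology
open ArithmeticFunction hiding log

lemma theta_succ (n : ℕ) : Chebyshev.theta ((n + 1 : ℕ) : ℝ) = Chebyshev.theta n + pl (n + 1) := by
  unfold Chebyshev.theta pl
  rw [Nat.floor_natCast, Nat.floor_natCast, Finset.sum_filter, Finset.sum_filter, Finset.sum_Ioc_succ_top (by omega)]

lemma theta_eq_pl (N : ℕ) : ∑ n ∈ Finset.range (N + 1), pl n = Chebyshev.theta N := by
  induction N with
  | zero => simp [pl, Chebyshev.theta]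
  | succ n ih => rw [Finset.sum_range_succ, ih, theta_succ]

lemma wdiff {n : ℝ} (hn : 1 ≤ n) : 0 ≤ 1 / ((n + 1) * n) - 1 / ((n + 2) * (n + 1)) ∧
    (n + 1) * (1 / ((n + 1) * n) - 1 / ((n + 2) * (n + 1))) = 1 / n + 1 / (n + 1) - 1 / (n + 1) - 1 / (n + 2) := by
  constructor
  · rw [sub_nonneg]
    apply one_div_le_one_div_of_le (by positivity)
    nlinarith
  · field_simp
    ring

noncomputable def wf (x : ℝ) (N n : ℕ) : ℝ := if n ≤ N then 2 / x else 1 / ((n:ℝ) * (n - 1))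

lemma wf_sum {x : ℝ} {N : ℕ} (hN : 1 ≤ N) (hx : 0 < x) (hx2 : x ≤ 2 * N * (N + 1)) :
    Summable (fun n => pl n * wf x N n) ∧ ∑' n, pl n * wf x N n ≤ Real.log 4 * (2 * N / x + 1 / N) := by
  have hN' : (1:ℝ) ≤ N := by exact_mod_cast hN
  have l4 : 0 ≤ Real.log 4 := Real.log_nonneg (by norm_num)
  have wnn : ∀ n, 0 ≤ pl n * wf x N n := by
    intro n
    apply mul_nonneg (pl_nonneg n)
    unfold wf
    split_ifs with h
    · positivity
    · have : (1:ℝ) ≤ n := by exact_mod_cast (by omega : 1 ≤ n)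
      have : 0 ≤ (n:ℝ) - 1 := by linarith
      positivity
  have hh := tele (f := fun n => pl n * wf x N n)
    (G := fun n => Real.log 4 * (1 / n + 1 / (n + 1)) - Chebyshev.theta n * (1 / (((n:ℝ) + 1) * n))) wnn N ?_ ?_
  · obtain ⟨h1, h2⟩ := hh
    refine ⟨h1, h2.trans ?_⟩
    have e : ∑ n ∈ Finset.range (N + 1), pl n * wf x N n = Chebyshev.theta N * (2 / x) := by
      rw [← theta_eq_pl, Finset.sum_mul]
      refine Finset.sum_congr rfl fun n hn => ?_
      rw [wf, if_pos (by simpa [Nat.lt_succ_iff] using hn)]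
    rw [e]
    have ht := Chebyshev.theta_le_log4_mul_x (x := (N:ℝ)) (by positivity)
    have hc : 0 ≤ 2 / x - 1 / (((N:ℝ) + 1) * N) := by
      rw [sub_nonneg, div_le_div_iff₀ (by positivity) hx]
      linarith
    have := mul_le_mul_of_nonneg_right ht hc
    have e2 : Real.log 4 * N * (2 / x - 1 / (((N:ℝ) + 1) * N)) = Real.log 4 * (2 * N / x - 1 / (N + 1)) := by
      field_simp
    rw [e2] at this
    linarith
  · intro n hn
    have hn' : (1:ℝ) ≤ n := by exact_mod_cast (by omega : 1 ≤ n)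
    have ht := Chebyshev.theta_le_log4_mul_x (x := (n:ℝ)) (by positivity)
    have := mul_le_mul_of_nonneg_right ht (by positivity : 0 ≤ 1 / (((n:ℝ) + 1) * n))
    have e2 : Real.log 4 * n * (1 / (((n:ℝ) + 1) * n)) = Real.log 4 * (1 / (n + 1)) := by
      field_simp
    rw [e2] at this
    have : 0 ≤ Real.log 4 * (1 / (n:ℝ)) := by positivity
    linarith
  · intro n hn
    have hn' : (1:ℝ) ≤ n := by exact_mod_cast (by omega : 1 ≤ n)
    have ht := Chebyshev.theta_le_log4_mul_x (x := ((n + 1 : ℕ):ℝ)) (by positivity)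
    obtain ⟨w0, w1⟩ := wdiff hn'
    have := mul_le_mul_of_nonneg_right ht w0
    have hs := theta_succ n
    simp only [wf]
    rw [if_neg (by omega)]
    push_cast at *
    rw [mul_assoc, w1] at this
    rw [show (n:ℝ) + 1 + 1 = n + 2 by ring, show (n:ℝ) + 1 - 1 = n by ring]
    rw [hs] at this ⊢
    linarith

lemma inner_le {x : ℝ} (hx : 0 < x) {N : ℕ} (hNx : (N:ℝ) ^ 2 ≤ x) (p : Nat.Primes) :
    Summable (fun k : ℕ => if x < ((p:ℕ):ℝ) ^ (k + 2) then Real.log p / ((p:ℕ):ℝ) ^ (k + 2) else 0) ∧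
    ∑' k : ℕ, (if x < ((p:ℕ):ℝ) ^ (k + 2) then Real.log p / ((p:ℕ):ℝ) ^ (k + 2) else 0) ≤ pl p * wf x N p := by
  have hp := pow_two_le p
  have hl : 0 ≤ Real.log p := Real.log_natCast_nonneg _
  have hpl : pl p = Real.log p := by simp [pl, p.2]
  have hnn : ∀ k : ℕ, 0 ≤ (if x < ((p:ℕ):ℝ) ^ (k + 2) then Real.log p / ((p:ℕ):ℝ) ^ (k + 2) else 0) := by
    intro k; split_ifs <;> positivity
  have hle : ∀ k : ℕ, (if x < ((p:ℕ):ℝ) ^ (k + 2) then Real.log p / ((p:ℕ):ℝ) ^ (k + 2) else 0) ≤ Real.log p / ((p:ℕ):ℝ) ^ (k + 2) := by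
    intro k; split_ifs
    · rfl
    · positivity
  have hsum := Summable.of_nonneg_of_le hnn hle (geom_p p).summable
  refine ⟨hsum, ?_⟩
  rw [hpl, wf]
  split_ifs with hpN
  · have hpx : ((p:ℕ):ℝ) ^ 2 ≤ x := by
      refine le_trans ?_ hNx
      have : ((p:ℕ):ℝ) ≤ N := by exact_mod_cast hpN
      gcongr
    have h := (tele (G := fun k => Real.log p * min (2 / x) (1 / ((p:ℕ):ℝ) ^ (k + 2))) hnn 0 ?_ ?_).2
    · refine h.trans ?_
      simp only [zero_add, Finset.sum_range_one]
      rw [if_neg (by linarith), zero_add]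
      gcongr
      exact min_le_left _ _
    · intro k _; positivity
    · intro k _
      rw [← mul_sub]
      have hq : 2 * (1 / ((p:ℕ):ℝ) ^ (k + 1 + 2)) ≤ 1 / ((p:ℕ):ℝ) ^ (k + 2) := by
        rw [show k + 1 + 2 = (k + 2) + 1 by ring, pow_succ]
        rw [mul_one_div, div_le_div_iff₀ (by positivity) (by positivity)]
        have : 0 < ((p:ℕ):ℝ) ^ (k + 2) := by positivity
        nlinarith
      set q := ((p:ℕ):ℝ) ^ (k + 1 + 2) with hqd
      have q0 : 0 < q := by positivity
      have q1 : 0 < 1 / q := by positivity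
      split_ifs with hc
      · rw [div_eq_mul_one_div]
        gcongr
        have a : min (2/x) (1/q) ≤ 1/q := min_le_right _ _
        have b : 2 * (1/q) ≤ min (2/x) (1 / ((p:ℕ):ℝ) ^ (k + 2)) := by
          apply le_min _ hq
          rw [mul_one_div]
          gcongr
        linarith
      · apply mul_nonneg hl
        rw [sub_nonneg]
        apply min_le_min_left
        linarith
  · refine (hsum.tsum_le_tsum hle (geom_p p).summable).trans ?_
    rw [(geom_p p).tsum_eq, mul_one_div]

lemma RR_bd {P : ℝ} (hP : HasSum cc P) {x : ℝ} (hx : 1 ≤ x) {N : ℕ} (hN : 1 ≤ N) (hNx : (N:ℝ) ^ 2 ≤ x)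
    (hx2 : x ≤ 2 * N * (N + 1)) :
    0 ≤ P - ∑ n ∈ Finset.range (⌊x⌋₊ + 1), cc n ∧
    P - ∑ n ∈ Finset.range (⌊x⌋₊ + 1), cc n ≤ Real.log 4 * (2 * N / x + 1 / N) := by
  have hx0 : 0 < x := by linarith
  constructor
  · rw [sub_nonneg]
    exact sum_le_hasSum _ (fun i _ => cc_nonneg i) hP
  let f : ℕ → ℝ := fun n => if x < n then cc n else 0
  have hfs : Summable f := Summable.of_nonneg_of_le (fun n => by
      simp only [f]; split_ifs
      · exact cc_nonneg n
      · rfl) (fun n => by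
      simp only [f]; split_ifs
      · rfl
      · exact cc_nonneg n) hP.summable
  have e1 : P - ∑ n ∈ Finset.range (⌊x⌋₊ + 1), cc n = ∑' n, f n := by
    have h1 : HasSum (fun n => cc n - f n) (∑ n ∈ Finset.range (⌊x⌋₊ + 1), (cc n - f n)) := by
      apply hasSum_sum_of_ne_finset_zero
      intro n hn
      have : x < n := by
        rw [Finset.mem_range, not_lt] at hn
        exact (Nat.floor_lt hx0.le).1 (by omega)
      simp [f, this]
    have h2 : ∑ n ∈ Finset.range (⌊x⌋₊ + 1), (cc n - f n) = ∑ n ∈ Finset.range (⌊x⌋₊ + 1), cc n := by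
      refine Finset.sum_congr rfl fun n hn => ?_
      have : ¬ x < n := by
        rw [Finset.mem_range] at hn
        rw [not_lt]
        exact (Nat.le_floor_iff hx0.le).1 (by omega)
      simp [f, this]
    have h3 := hP.sub hfs.hasSum
    have := h1.unique h3
    linarith
  have hsupp : Function.support f ⊆ {n | IsPrimePow n} := by
    intro n hn
    apply cc_supp
    intro h0
    apply hn
    simp [f, h0]
  rw [e1, tsum_eq_tsum_primes_add_tsum_primes_of_support_subset_prime_powers hfs hsupp]
  have z : ∑' p : Nat.Primes, f p = 0 := by
    rw [← tsum_zero (α := ℝ) (β := Nat.Primes)]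
    refine tsum_congr fun p => ?_
    simp [f, cc_prime p]
  rw [z, zero_add]
  have e2 : ∀ (p : Nat.Primes) (k : ℕ), f ((p:ℕ) ^ (k + 2)) = if x < ((p:ℕ):ℝ) ^ (k + 2) then Real.log p / ((p:ℕ):ℝ) ^ (k + 2) else 0 := by
    intro p k
    simp only [f, cc_pow]
    push_cast; rfl
  simp_rw [e2]
  obtain ⟨w1, w2⟩ := wf_sum hN hx0 hx2
  have ew : ∀ n : ℕ, (if n.Prime then pl n * wf x N n else 0) = pl n * wf x N n := by
    intro n; unfold pl; split_ifs <;> simp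
  have ws : Summable (fun p : Nat.Primes => pl p * wf x N p) := by
    apply prsummable (f := fun n => pl n * wf x N n)
    simpa only [ew] using w1
  refine le_trans (Summable.tsum_le_tsum (fun p => (inner_le hx0 hNx p).2) ?_ ws) ?_
  · refine Summable.of_nonneg_of_le (fun p => ?_) (fun p => (inner_le hx0 hNx p).2) ws
    apply tsum_nonneg
    intro k
    have hl : 0 ≤ Real.log p := Real.log_natCast_nonneg _
    split_ifs <;> positivity
  · rw [prsum (fun n => pl n * wf x N n)]
    simpa only [ew] using w2
end
end MRH

namespace MRH
section
open Filter Topology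

lemma log_pow_ge {a : ℝ} (ha : 0 < a) (m k : ℕ) (h : (2:ℝ) ^ m ≤ a ^ k) : m * 0.693147 ≤ k * Real.log a := by
  have h1 := Real.log_le_log (by positivity) h
  rw [Real.log_pow, Real.log_pow] at h1
  have := Real.log_two_gt_d9
  have hm : (0:ℝ) ≤ m := by positivity
  nlinarith

lemma large (hRH : RiemannHypothesis) {E : ℝ} (hE : Filter.Tendsto
      (fun x : ℝ => (∑ p ∈ (Finset.range (⌊x⌋₊ + 1)).filter Nat.Prime,
        Real.log p / p) - Real.log x) Filter.atTop (nhds E)) {x : ℝ} (hx : 10000 ≤ x) :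
    |(∑ p ∈ (Finset.range (⌊x⌋₊ + 1)).filter Nat.Prime, Real.log p / p)
          - Real.log x - E|
        ≤ 3 * (Real.log x) ^ 2 / (8 * Real.pi * Real.sqrt x) := by
  set s := √x with hs
  have hs100 : 100 ≤ s := Real.le_sqrt_of_sq_le (by linarith)
  have s0 : 0 < s := by linarith
  have hsx : s ^ 2 = x := Real.sq_sqrt (by linarith)
  have hb := SS_bd hRH hs100
  rw [hsx] at hb
  have hlx : Real.log x = 2 * Real.log s := by rw [← hsx, Real.log_pow]; norm_num
  rw [AA_eq]
  have hW := SS_sub x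
  set N := ⌊s⌋₊ with hN
  have hN1 : (N:ℝ) ≤ s := Nat.floor_le s0.le
  have hN2 : s < N + 1 := Nat.lt_floor_add_one s
  have hN3 : 0.99 * s ≤ N := by linarith
  have hN0 : (0:ℝ) < N := by nlinarith
  have hRR := RR_bd (cc_hasSum hRH hE) (x := x) (by linarith) (N := N) (by exact_mod_cast (by linarith : (1:ℝ) ≤ N))
    (by rw [← hsx]; gcongr) (by rw [← hsx]; nlinarith)
  obtain ⟨r0, r1⟩ := hRR
  have r2 : Real.log 4 * (2 * N / x + 1 / N) ≤ 4.18 / s := by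
    have l4 : Real.log 4 ≤ 1.3863 := by
      rw [show (4:ℝ) = 2 ^ 2 by norm_num, Real.log_pow]
      have := Real.log_two_lt_d9
      push_cast; linarith
    have a : 2 * N / x ≤ 2 / s := by
      rw [← hsx, div_le_div_iff₀ (by positivity) s0]; nlinarith
    have b : 1 / (N:ℝ) ≤ 1.011 / s := by
      rw [div_le_div_iff₀ hN0 s0]; nlinarith
    calc _ ≤ 1.3863 * (2 / s + 1.011 / s) := by gcongr
      _ = (1.3863 * 3.011) / s := by ring
      _ ≤ _ := by gcongr; norm_num
  set A := ∑ n ∈ Finset.range (⌊x⌋₊ + 1), pl n / n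
  set W := ∑ n ∈ Finset.range (⌊x⌋₊ + 1), cc n
  have main : |A - Real.log x - E| ≤ (1.01 + 1.0102 * KK s) / s + 4.18 / s := by
    rw [abs_le] at hb ⊢
    have : 0 < 4.18 / s := by positivity
    rw [hlx]
    constructor <;> linarith [hb.1, hb.2]
  refine main.trans ?_
  have hp := Real.pi_pos
  have p1 := Real.pi_gt_d4
  have p2 := Real.pi_lt_d4
  rw [← add_div, hlx, show 3 * (2 * Real.log s) ^ 2 / (8 * Real.pi * s) = (3 * (2 * Real.log s) ^ 2 / (8 * Real.pi)) / s by
    rw [div_div]]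
  gcongr
  unfold KK
  rw [Real.log_div s0.ne' (by positivity)]
  have c1 : 1.83 ≤ Real.log (2 * Real.pi) := by
    have := log_pow_ge (a := 6.283) (by norm_num) 37 14 (by norm_num)
    have h2 : Real.log 6.283 ≤ Real.log (2 * Real.pi) := Real.log_le_log (by norm_num) (by linarith)
    norm_num at this ⊢; linarith
  have c2 : Real.log (2 * Real.pi) ≤ Real.log s := Real.log_le_log (by positivity) (by linarith)
  have l1 : 4.6 ≤ Real.log s := by
    have := log_pow_ge (a := 100) (by norm_num) 93 14 (by norm_num)
    have h2 : Real.log 100 ≤ Real.log s := Real.log_le_log (by norm_num) (by linarith)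
    norm_num at this ⊢; linarith
  set l := Real.log s
  set c := Real.log (2 * Real.pi)
  have i1 : 1 / Real.pi ≤ 0.31832 := by rw [div_le_iff₀ hp]; nlinarith
  have i2 : 0.3183 ≤ 1 / Real.pi := by rw [le_div_iff₀ hp]; nlinarith
  have q1 : (l - c) ^ 2 / (2 * Real.pi) ≤ (l - 1.83) ^ 2 * 0.15916 := by
    have : (l - c) ^ 2 ≤ (l - 1.83) ^ 2 := by
      apply pow_le_pow_left₀ <;> linarith
    calc _ = (l - c) ^ 2 * (1 / Real.pi * (1/2)) := by field_simp
      _ ≤ (l - 1.83) ^ 2 * (0.31832 * (1/2)) := by gcongr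
      _ = _ := by ring
  have q2 : l ^ 2 * 0.47745 ≤ 3 * (2 * l) ^ 2 / (8 * Real.pi) := by
    rw [show 3 * (2 * l) ^ 2 / (8 * Real.pi) = l ^ 2 * (1.5 * (1 / Real.pi)) by field_simp; ring]
    gcongr; linarith
  have q3 : 2.45 / s ≤ 0.0245 := by rw [div_le_iff₀ s0]; linarith
  refine le_trans ?_ q2
  nlinarith
end
end MRH

namespace MRH
section
open Filter Topology
open ArithmeticFunction hiding log

lemma logsq_step {n : ℕ} (hn : 4 ≤ n) : Real.log ((n + 1 : ℕ):ℝ) / ((n + 1 : ℕ):ℝ) ^ 2 ≤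
    (Real.log n + 1) / n - (Real.log ((n + 1 : ℕ):ℝ) + 1) / ((n + 1 : ℕ):ℝ) := by
  have hn' : (4:ℝ) ≤ n := by exact_mod_cast hn
  have n0 : (0:ℝ) < n := by linarith
  have h1 : Real.log ((n + 1 : ℕ):ℝ) - 1 / n ≤ Real.log n := by
    have := Real.log_le_sub_one_of_pos (x := ((n:ℝ) + 1) / n) (by positivity)
    rw [Real.log_div (by positivity) n0.ne'] at this
    push_cast
    have e : ((n:ℝ) + 1) / n - 1 = 1 / n := by field_simp; ring
    linarith
  have h2 : 1.3 ≤ Real.log ((n + 1 : ℕ):ℝ) := by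
    have a : Real.log 4 ≤ Real.log ((n + 1 : ℕ):ℝ) := Real.log_le_log (by norm_num) (by push_cast; linarith)
    rw [show (4:ℝ) = 2 ^ 2 by norm_num, Real.log_pow] at a
    have := Real.log_two_gt_d9
    push_cast at a ⊢; linarith
  push_cast at *
  set L := Real.log ((n:ℝ) + 1)
  have h3 : (L - 1 / n + 1) / n ≤ (Real.log n + 1) / n := by gcongr
  refine le_trans ?_ (sub_le_sub_right h3 _)
  rw [← sub_nonneg]
  have : (L - 1 / (n:ℝ) + 1) / n - (L + 1) / (n + 1) - L / (n + 1) ^ 2 = (L * n - n - 1) / (n ^ 2 * (n + 1) ^ 2) := by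
    field_simp; ring
  rw [this]
  apply div_nonneg _ (by positivity)
  nlinarith

lemma log_nn (n : ℕ) : 0 ≤ Real.log (n:ℝ) := Real.log_natCast_nonneg n

lemma logsq {N : ℕ} (hN : 4 ≤ N) : Summable (fun n : ℕ => Real.log n / (n:ℝ) ^ 2) ∧
    ∑' n : ℕ, Real.log n / (n:ℝ) ^ 2 ≤ ∑ n ∈ Finset.range (N + 1), Real.log n / (n:ℝ) ^ 2 + (Real.log N + 1) / N :=
  tele (f := fun n : ℕ => Real.log n / (n:ℝ) ^ 2) (G := fun n : ℕ => (Real.log n + 1) / n)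
    (fun n => div_nonneg (log_nn n) (by positivity)) N
    (fun n _ => div_nonneg (by linarith [log_nn n]) (by positivity)) (fun n hn => logsq_step (hN.trans hn))

lemma pl_if (f : ℕ → ℝ) (n : ℕ) : (if n.Prime then Real.log n * f n else 0) = pl n * f n := by
  unfold pl; split_ifs <;> simp

lemma P_eq {P : ℝ} (hP : HasSum cc P) : P = ∑' n, pl n * (1 / ((n:ℝ) * (n - 1))) := by
  rw [← hP.tsum_eq, tsum_eq_tsum_primes_add_tsum_primes_of_support_subset_prime_powers hP.summable cc_supp]
  have z : ∑' p : Nat.Primes, cc p = 0 := by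
    rw [← tsum_zero (α := ℝ) (β := Nat.Primes)]
    exact tsum_congr fun p => cc_prime p
  rw [z, zero_add]
  rw [← tsum_congr (pl_if fun n : ℕ => 1 / ((n:ℝ) * (n - 1))), ← prsum (fun n : ℕ => Real.log n * (1 / ((n:ℝ) * (n - 1))))]
  refine tsum_congr fun p => ?_
  rw [tsum_congr (cc_pow p), (geom_p p).tsum_eq, mul_one_div]

lemma vm_summable : Summable (fun n : ℕ => Λ n / (n:ℝ) ^ 2) :=
  Summable.of_nonneg_of_le (fun n => div_nonneg vonMangoldt_nonneg (by positivity))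
    (fun n => by gcongr; exact vonMangoldt_le_log) (logsq (le_refl 4)).1

lemma geom_sq (p : Nat.Primes) : HasSum (fun k : ℕ => Λ ((p:ℕ) ^ (k + 1)) / (((p:ℕ) ^ (k + 1) : ℕ):ℝ) ^ 2) (Real.log p * (1 / ((p:ℝ) ^ 2 - 1))) := by
  have hp := pow_two_le p
  have hp2 : (1:ℝ) < (p:ℝ) ^ 2 := by nlinarith
  have h := (hasSum_geometric_of_lt_one (r := ((p:ℝ) ^ 2)⁻¹) (by positivity) (inv_lt_one_of_one_lt₀ hp2)).mul_left (Real.log p / p ^ 2)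
  have h1 : (p:ℝ) ^ 2 - 1 ≠ 0 := by linarith
  rw [show Real.log p * (1 / ((p:ℝ) ^ 2 - 1)) = Real.log p / (p:ℝ) ^ 2 * (1 - ((p:ℝ) ^ 2)⁻¹)⁻¹ by
    have : (1 - ((p:ℝ) ^ 2)⁻¹) ≠ 0 := by
      intro h; apply h1; field_simp at h; linarith
    field_simp]
  refine h.congr_fun ?_ |> id
  intro k
  rw [vonMangoldt_apply_pow (by omega), vonMangoldt_apply_prime p.2]
  push_cast
  rw [inv_pow, ← pow_mul, ← pow_mul, show (k + 1) * 2 = 2 * k + 2 by ring, pow_add]; field_simp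

lemma M_eq : ∑' n : ℕ, Λ n / (n:ℝ) ^ 2 = ∑' n, pl n * (1 / ((n:ℝ) ^ 2 - 1)) := by
  rw [tsum_eq_tsum_primes_of_support_subset_prime_powers vm_summable]
  · rw [← tsum_congr (pl_if fun n : ℕ => 1 / ((n:ℝ) ^ 2 - 1)), ← prsum (fun n : ℕ => Real.log n * (1 / ((n:ℝ) ^ 2 - 1)))]
    exact tsum_congr fun p => (geom_sq p).tsum_eq
  · intro n hn
    by_contra h
    apply hn
    have : Λ n = 0 := vonMangoldt_eq_zero_iff.2 h
    simp [this]

lemma M_val : (∑' n : ℕ, Λ n / (n:ℝ) ^ 2) * (Real.pi ^ 2 / 6) = ∑' n : ℕ, Real.log n / (n:ℝ) ^ 2 := by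
  have h2 : (1:ℝ) < (2:ℂ).re := by norm_num
  have h := LSeries_convolution' (LSeriesSummable_vonMangoldt h2) (LSeriesSummable_one_iff.2 h2)
  rw [convolution_vonMangoldt_const_one, LSeries_one_eq_riemannZeta h2, riemannZeta_two] at h
  have e : ∀ f : ℕ → ℝ, f 0 = 0 → LSeries (fun n => (f n : ℂ)) 2 = ((∑' n, f n / (n:ℝ) ^ 2 : ℝ) : ℂ) := by
    intro f f0
    rw [LSeries, Complex.ofReal_tsum]
    refine tsum_congr fun n => ?_
    rw [LSeries.term_def₀ (by simp [f0])]
    rw [Complex.cpow_neg]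
    push_cast
    rw [div_eq_mul_inv]; norm_cast
  rw [e _ (by simp)] at h
  have e2 := e (fun n => Real.log n) (by simp)
  simp only [Complex.ofReal_log (Nat.cast_nonneg _), Complex.ofReal_natCast] at e2
  rw [e2] at h
  exact_mod_cast h.symm

lemma P_up {P : ℝ} (hP : HasSum cc P) {N : ℕ} (hN : 4 ≤ N) :
    P ≤ 6 / Real.pi ^ 2 * (∑ n ∈ Finset.range (N + 1), Real.log n / (n:ℝ) ^ 2 + (Real.log N + 1) / N)
      + (∑ n ∈ Finset.range (N + 1), pl n * (1 / ((n:ℝ) * (n ^ 2 - 1))) + 2 / N * ((Real.log N + 1) / N)) := by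
  have hM : ∑' n : ℕ, Λ n / (n:ℝ) ^ 2 ≤ 6 / Real.pi ^ 2 * (∑ n ∈ Finset.range (N + 1), Real.log n / (n:ℝ) ^ 2 + (Real.log N + 1) / N) := by
    have hp := Real.pi_pos
    have : ∑' n : ℕ, Λ n / (n:ℝ) ^ 2 = 6 / Real.pi ^ 2 * ∑' n : ℕ, Real.log n / (n:ℝ) ^ 2 := by
      rw [← M_val]; field_simp
    rw [this]
    gcongr
    exact (logsq hN).2
  have bd2 : ∀ n : ℕ, 0 ≤ pl n * (1 / ((n:ℝ) ^ 2 - 1)) ∧ pl n * (1 / ((n:ℝ) ^ 2 - 1)) ≤ 2 * (Real.log n / (n:ℝ) ^ 2) ∧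
      0 ≤ pl n * (1 / ((n:ℝ) * (n ^ 2 - 1))) ∧ 2 * n * (pl n * (1 / ((n:ℝ) * (n ^ 2 - 1)))) ≤ 4 * (Real.log n / (n:ℝ) ^ 2) ∧
      pl n * (1 / ((n:ℝ) * (n - 1))) = pl n * (1 / ((n:ℝ) ^ 2 - 1)) + pl n * (1 / ((n:ℝ) * (n ^ 2 - 1))) := by
    intro n
    by_cases hpr : n.Prime
    · have h2 : (2:ℝ) ≤ n := by exact_mod_cast hpr.two_le
      have hl := log_nn n
      have e : pl n = Real.log n := by simp [pl, hpr]
      have q : (0:ℝ) < (n:ℝ) ^ 2 - 1 := by nlinarith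
      have hq : 1 / ((n:ℝ) ^ 2 - 1) ≤ 2 * (1 / (n:ℝ) ^ 2) := by
        rw [mul_one_div, div_le_div_iff₀ q (by positivity)]; nlinarith
      have m := mul_le_mul_of_nonneg_left hq hl
      rw [e]
      refine ⟨by positivity, ?_, by positivity, ?_, ?_⟩
      · calc _ ≤ _ := m
          _ = _ := by ring
      · calc _ = 2 * (Real.log n * (1 / ((n:ℝ) ^ 2 - 1))) := by field_simp
          _ ≤ 2 * _ := mul_le_mul_of_nonneg_left m (by norm_num)
          _ = _ := by ring
      · have : (n:ℝ) - 1 ≠ 0 := by linarith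
        have q' := q.ne'
        rw [← mul_add]
        congr 1
        rw [show (n:ℝ) ^ 2 - 1 = (n - 1) * (n + 1) by ring]
        field_simp
    · have e : pl n = 0 := by simp [pl, hpr]
      rw [e]
      have := log_nn n
      refine ⟨by simp, ?_, by simp, ?_, by simp⟩ <;> simp <;> positivity
  have ls := (logsq (le_refl 4)).1
  have s1 : Summable (fun n : ℕ => pl n * (1 / ((n:ℝ) ^ 2 - 1))) :=
    Summable.of_nonneg_of_le (fun n => (bd2 n).1) (fun n => (bd2 n).2.1) (ls.mul_left 2)
  have N0 : (0:ℝ) < N := by exact_mod_cast (by omega : 0 < N)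
  have hq := tele (f := fun n : ℕ => pl n * (1 / ((n:ℝ) * (n ^ 2 - 1)))) (G := fun n : ℕ => 2 / N * ((Real.log n + 1) / n))
    (fun n => (bd2 n).2.2.1) N
    (fun n _ => mul_nonneg (by positivity) (div_nonneg (by linarith [log_nn n]) (by positivity))) (fun n hn => by
      have h1 := logsq_step (hN.trans hn)
      have h2 := (bd2 (n + 1)).2.2.2.1
      have h3 := (bd2 (n + 1)).2.2.1
      set q := pl (n + 1) * (1 / (((n + 1 : ℕ):ℝ) * (((n + 1 : ℕ):ℝ) ^ 2 - 1)))
      rw [← mul_sub]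
      refine le_trans ?_ (mul_le_mul_of_nonneg_left h1 (by positivity))
      rw [div_mul_eq_mul_div, le_div_iff₀ N0]
      have hNn : (N:ℝ) ≤ ((n + 1 : ℕ):ℝ) := by exact_mod_cast (by omega)
      nlinarith)
  rw [P_eq hP]
  calc _ = ∑' n : ℕ, (pl n * (1 / ((n:ℝ) ^ 2 - 1)) + pl n * (1 / ((n:ℝ) * (n ^ 2 - 1)))) :=
        tsum_congr fun n => (bd2 n).2.2.2.2
    _ = _ := s1.tsum_add hq.1
    _ ≤ _ := by rw [← M_eq]; exact add_le_add hM hq.2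

lemma P_lo {P : ℝ} (hP : HasSum cc P) (N : ℕ) : ∑ n ∈ Finset.range (N + 1), pl n * (1 / ((n:ℝ) * (n - 1))) ≤ P := by
  rw [P_eq hP]
  have hnn : ∀ n : ℕ, 0 ≤ pl n * (1 / ((n:ℝ) * (n - 1))) ∧ pl n * (1 / ((n:ℝ) * (n - 1))) ≤ 2 * (Real.log n / (n:ℝ) ^ 2) := by
    intro n
    by_cases hpr : n.Prime
    · have h2 : (2:ℝ) ≤ n := by exact_mod_cast hpr.two_le
      have hl := log_nn n
      have e : pl n = Real.log n := by simp [pl, hpr]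
      have q : (0:ℝ) < (n:ℝ) - 1 := by nlinarith
      rw [e]
      refine ⟨by positivity, ?_⟩
      rw [show 2 * (Real.log n / (n:ℝ) ^ 2) = Real.log n * (2 / (n:ℝ) ^ 2) by ring]
      refine mul_le_mul_of_nonneg_left ?_ hl
      rw [div_le_div_iff₀ (by positivity) (by positivity)]; nlinarith
    · have e : pl n = 0 := by simp [pl, hpr]
      rw [e]
      have := log_nn n
      refine ⟨by simp, ?_⟩
      simp; positivity
  exact Summable.sum_le_tsum _ (fun n _ => (hnn n).1)
    (Summable.of_nonneg_of_le (fun n => (hnn n).1) (fun n => (hnn n).2) ((logsq (le_refl 4)).1.mul_left 2))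
end
end MRH

namespace MRH
section

def isP (n : ℕ) : Bool := Nat.beq (Nat.gcd n 2305567963945518424753102147331756070) 1 ||
  (Nat.blt n 100 && Nat.beq (Nat.gcd n 210) 1) || (Nat.beq n 2 || Nat.beq n 3 || Nat.beq n 5 || Nat.beq n 7)

def upc (a l x : ℕ) : Bool :=
  Nat.ble ((a + 13325900000000000 - l) * (a + 13325900000000000 - l) * 64 * 986961 * x * 100000000000000000000000000000000)
    (9000000 * (l * l * (l * l)))

def lowi (l n : ℕ) : ℕ := l + (20000000000000000 / (2 * n + 1) + 20000000000000000 / (3 * (2 * n + 1) ^ 3) +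
  20000000000000000 / (5 * (2 * n + 1) ^ 5) + 20000000000000000 / (7 * (2 * n + 1) ^ 7))
def upi (l n : ℕ) : ℕ := l + (20000000000000000 / (2 * n + 1) + 20000000000000000 / (3 * (2 * n + 1) ^ 3) +
  20000000000000000 / (5 * (2 * n + 1) ^ 5) + 20000000000000000 / (7 * (2 * n + 1) ^ 5 * ((2 * n + 1) ^ 2 - 1)) + 4)

def chk (n l u' A B : ℕ) : Bool :=
  Nat.blt n 43 || (Nat.ble u' (A + 13320000000000000) &&
    (cond (Nat.beq n 43) (upc B (l + 20000000000000000 / 861) 431) (upc B l (10 * n))))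

def fin (n l u H D Q P : ℕ) : Bool :=
  Nat.ble (H + n + (600000 * (D + (u + 10000000000000000) / n + 1) / 986960 + 1) + Q + (2 * (u + 10000000000000000) / (n * n) + 1))
    (13325900000000000 + l + 10000000000000000 / (2 * n + 1)) &&
  Nat.ble (13320000000000000 + u + 10000000000000000 / n + 1) (H + P)

def frc (x : ℕ) (f : ℕ → Bool) : Bool := Nat.rec (f 0) (fun k _ => f (k + 1)) x

def go (k : ℕ) : ℕ → ℕ → ℕ → ℕ → ℕ → ℕ → ℕ → ℕ → ℕ → Bool :=
  Nat.rec (fun n l u _ _ H D Q P => fin n l u H D Q P)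
  (fun _ r n l u A B H D Q P =>
    frc (lowi l n) fun l' => frc (upi u n) fun u' => frc (n + 1) fun m =>
    frc (H + 10000000000000000 / m) fun H' => frc (D + (u' / m ^ 2 + 1)) fun D' =>
    chk n l u' A B &&
    cond (isP m)
      (frc (A + l' / m) fun A' => frc (B + (u' / m + 1)) fun B' =>
       frc (Q + (u' / (m * (m ^ 2 - 1)) + 1)) fun Q' => frc (P + l' / (m * n)) fun P' =>
        r m l' u' A' B' H' D' Q' P')
      (r m l' u' A B H' D' Q P)) k

set_option maxRecDepth 100000 in
theorem go_ok : go 9998 2 6931471803000000 6931471809000000 3465735901500000 3465735904500001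
   15000000000000000 1732867952250001 1155245301500001 3465735901500000 = true := by decide +kernel
end
end MRH

namespace MRH
section

lemma frc_eq (x : ℕ) (f : ℕ → Bool) : frc x f = f x := by cases x <;> rfl

lemma isP_small : ∀ m < 100, 2 ≤ m → (isP m = true ↔ Nat.Prime m) := by
  intro m h1 h2
  interval_cases m <;> norm_num [isP]

lemma dvdM : ∀ q < 101, Nat.Prime q → q ∣ 2305567963945518424753102147331756070 := by
  intro q hq hp
  interval_cases q <;> revert hp <;> norm_num

lemma isP_iff {m : ℕ} (h2 : 2 ≤ m) (h : m ≤ 10000) : isP m = true ↔ Nat.Prime m := by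
  by_cases hm : m < 100
  · exact isP_small m hm h2
  have e : isP m = true ↔ Nat.gcd m 2305567963945518424753102147331756070 = 1 := by
    have a : Nat.blt m 100 = false := by
      cases hc : Nat.blt m 100
      · rfl
      · rw [Nat.blt_eq] at hc; omega
    have hb : ∀ k, k < 100 → Nat.beq m k = false := by
      intro k hk
      cases hc : Nat.beq m k
      · rfl
      · have := Nat.eq_of_beq_eq_true hc; omega
    simp [isP, a, hb]
  rw [e]
  constructor
  · intro hg
    by_contra hp
    have h3 := Nat.minFac_sq_le_self (by omega : 0 < m) hp
    have h4 : m.minFac < 101 := by nlinarith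
    have h5 := dvdM _ h4 (Nat.minFac_prime (by omega))
    have h6 := Nat.dvd_gcd (Nat.minFac_dvd m) h5
    rw [hg] at h6
    exact (Nat.minFac_prime (by omega : m ≠ 1)).one_lt.ne' (Nat.dvd_one.1 h6)
  · intro hp
    rw [← Nat.coprime_iff_gcd_eq_one, Nat.Prime.coprime_iff_not_dvd hp]
    intro hd
    have : 2305567963945518424753102147331756070 ∣ Nat.factorial 97 := by decide +kernel
    have := (Nat.Prime.dvd_factorial hp).1 (hd.trans this)
    omega

lemma log_step {n : ℕ} (hn : 1 ≤ n) :
    2 * (1 / (2 * n + 1 : ℝ) + 1 / (3 * (2 * n + 1 : ℝ) ^ 3) + 1 / (5 * (2 * n + 1 : ℝ) ^ 5) + 1 / (7 * (2 * n + 1 : ℝ) ^ 7))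
      ≤ Real.log ((n + 1 : ℕ) : ℝ) - Real.log n ∧
    Real.log ((n + 1 : ℕ) : ℝ) - Real.log n ≤
    2 * (1 / (2 * n + 1 : ℝ) + 1 / (3 * (2 * n + 1 : ℝ) ^ 3) + 1 / (5 * (2 * n + 1 : ℝ) ^ 5) + 1 / (7 * (2 * n + 1 : ℝ) ^ 5 * ((2 * n + 1 : ℝ) ^ 2 - 1))) := by
  have n0 : (1:ℝ) ≤ n := by exact_mod_cast hn
  have h := Real.hasSum_log_one_add_inv (a := (n:ℝ)) (by linarith)
  have e : Real.log (1 + (n:ℝ)⁻¹) = Real.log ((n + 1 : ℕ) : ℝ) - Real.log n := by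
    rw [← Real.log_div (by positivity) (by positivity)]
    congr 1; push_cast; field_simp
  rw [e] at h
  set L := Real.log ((n + 1 : ℕ) : ℝ) - Real.log n
  have hm : (3:ℝ) ≤ 2 * n + 1 := by linarith
  set m := (2 * n + 1 : ℝ) with hmd
  clear_value m L
  have m0 : 0 < m := by linarith
  constructor
  · have := sum_le_hasSum (Finset.range 4) (fun i _ => by positivity) h
    refine le_trans (le_of_eq ?_) this
    simp only [Finset.sum_range_succ, Finset.sum_range_zero]
    norm_num
    field_simp
  · have h3 := (hasSum_nat_add_iff' 3).2 h
    have hq1 : (m ^ 2)⁻¹ < 1 := inv_lt_one_of_one_lt₀ (by nlinarith)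
    have hg := (hasSum_geometric_of_lt_one (r := (m ^ 2)⁻¹) (by positivity) hq1).mul_left (2 / 7 * (1 / m) ^ 7)
    have := hasSum_le (fun k => ?_) h3 hg
    · rw [sub_le_iff_le_add] at this
      refine this.trans (le_of_eq ?_)
      simp only [Finset.sum_range_succ, Finset.sum_range_zero]
      have : m ^ 2 - 1 ≠ 0 := by nlinarith
      rw [show (1 - (m ^ 2)⁻¹)⁻¹ = m ^ 2 / (m ^ 2 - 1) by
        rw [← one_div_div, sub_div, div_self (by positivity), one_div, one_div]]
      generalize m ^ 2 - 1 = z at *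
      norm_num
      field_simp
      ring
    · rw [show 2 / 7 * (1 / m) ^ 7 * ((m ^ 2)⁻¹) ^ k = 2 * (1 / 7) * (1 / m) ^ (2 * (k + 3) + 1) by
        rw [show 2 * (k + 3) + 1 = 7 + 2 * k by ring, pow_add, pow_mul, one_div, inv_pow m 2]; ring]
      gcongr
      push_cast
      have : (0:ℝ) ≤ k := by positivity
      linarith
end
end MRH

namespace MRH
section

noncomputable def sA (n : ℕ) : ℝ := ∑ i ∈ Finset.range (n + 1), pl i / i
noncomputable def sD (n : ℕ) : ℝ := ∑ i ∈ Finset.range (n + 1), Real.log i / (i:ℝ) ^ 2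
noncomputable def sQ (n : ℕ) : ℝ := ∑ i ∈ Finset.range (n + 1), pl i * (1 / ((i:ℝ) * (i ^ 2 - 1)))
noncomputable def sP (n : ℕ) : ℝ := ∑ i ∈ Finset.range (n + 1), pl i * (1 / ((i:ℝ) * (i - 1)))
noncomputable def sH (n : ℕ) : ℝ := ((harmonic n : ℚ) : ℝ)

structure Inv (n l u A B H D Q P : ℕ) : Prop where
  hl : (l:ℝ) ≤ 1e16 * Real.log n
  hu : 1e16 * Real.log n ≤ u
  hA : (A:ℝ) ≤ 1e16 * sA n
  hB : 1e16 * sA n ≤ B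
  hH : (H:ℝ) ≤ 1e16 * sH n
  hH' : 1e16 * sH n ≤ H + n
  hD : 1e16 * sD n ≤ D
  hQ : 1e16 * sQ n ≤ Q
  hP : (P:ℝ) ≤ 1e16 * sP n

lemma nd1 (a b : ℕ) {t : ℝ} (h : (a:ℝ) / b ≤ t) : ((a / b : ℕ) : ℝ) ≤ t := Nat.cast_div_le.trans h
lemma nd2 (a b : ℕ) {t : ℝ} (h : t ≤ (a:ℝ) / b) : t ≤ ((a / b : ℕ) : ℝ) + 1 := by
  refine h.trans ?_
  rw [← Nat.floor_div_eq_div (K := ℝ)]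
  exact (Nat.lt_floor_add_one _).le

lemma lowi_ok {n l : ℕ} (hn : 1 ≤ n) (h : (l:ℝ) ≤ 1e16 * Real.log n) : ((lowi l n : ℕ):ℝ) ≤ 1e16 * Real.log ((n + 1 : ℕ):ℝ) := by
  have hs := (log_step hn).1
  unfold lowi
  rw [Nat.cast_add, Nat.cast_add, Nat.cast_add, Nat.cast_add]
  have a1 := nd1 20000000000000000 (2 * n + 1) le_rfl
  have a2 := nd1 20000000000000000 (3 * (2 * n + 1) ^ 3) le_rfl
  have a3 := nd1 20000000000000000 (5 * (2 * n + 1) ^ 5) le_rfl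
  have a4 := nd1 20000000000000000 (7 * (2 * n + 1) ^ 7) le_rfl
  push_cast at a1 a2 a3 a4 hs ⊢
  rw [div_eq_mul_one_div] at a1 a2 a3 a4
  linarith

lemma upi_ok {n u : ℕ} (hn : 1 ≤ n) (h : 1e16 * Real.log n ≤ u) : 1e16 * Real.log ((n + 1 : ℕ):ℝ) ≤ ((upi u n : ℕ):ℝ) := by
  have hs := (log_step hn).2
  unfold upi
  have a1 := nd2 20000000000000000 (2 * n + 1) le_rfl
  have a2 := nd2 20000000000000000 (3 * (2 * n + 1) ^ 3) le_rfl
  have a3 := nd2 20000000000000000 (5 * (2 * n + 1) ^ 5) le_rfl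
  have a4 := nd2 20000000000000000 (7 * (2 * n + 1) ^ 5 * ((2 * n + 1) ^ 2 - 1)) le_rfl
  have e : (((2 * n + 1) ^ 2 - 1 : ℕ):ℝ) = (2 * n + 1 : ℝ) ^ 2 - 1 := by
    rw [Nat.cast_sub (Nat.one_le_pow _ _ (by omega))]; push_cast; rfl
  rw [Nat.cast_add, Nat.cast_add, Nat.cast_add, Nat.cast_add, Nat.cast_add]
  simp only [Nat.cast_mul, Nat.cast_pow, Nat.cast_add, Nat.cast_ofNat, Nat.cast_one, e] at a1 a2 a3 a4 hs ⊢
  rw [div_eq_mul_one_div] at a1 a2 a3 a4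
  linarith

lemma sA_succ (n : ℕ) : sA (n + 1) = sA n + pl (n + 1) / ((n + 1 : ℕ):ℝ) := Finset.sum_range_succ _ _
lemma sD_succ (n : ℕ) : sD (n + 1) = sD n + Real.log ((n + 1 : ℕ):ℝ) / ((n + 1 : ℕ):ℝ) ^ 2 := Finset.sum_range_succ _ _
lemma sQ_succ (n : ℕ) : sQ (n + 1) = sQ n + pl (n + 1) * (1 / (((n + 1 : ℕ):ℝ) * (((n + 1 : ℕ):ℝ) ^ 2 - 1))) := Finset.sum_range_succ _ _
lemma sP_succ (n : ℕ) : sP (n + 1) = sP n + pl (n + 1) * (1 / (((n + 1 : ℕ):ℝ) * (((n + 1 : ℕ):ℝ) - 1))) := Finset.sum_range_succ _ _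
lemma sH_succ (n : ℕ) : sH (n + 1) = sH n + 1 / ((n + 1 : ℕ):ℝ) := by
  unfold sH; rw [harmonic_succ]; push_cast; ring

lemma inv_np {n l u A B H D Q P : ℕ} (hn : 2 ≤ n) (h : Inv n l u A B H D Q P) (hp : ¬ (n + 1).Prime) :
    Inv (n + 1) (lowi l n) (upi u n) A B (H + 10000000000000000 / (n + 1)) (D + (upi u n / (n + 1) ^ 2 + 1)) Q P := by
  have e : pl (n + 1) = 0 := by simp [pl, hp]
  have hu := upi_ok (by omega) h.hu
  have hl := lowi_ok (by omega) h.hl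
  have m0 : (0:ℝ) < ((n + 1 : ℕ):ℝ) := by positivity
  have aH := nd1 10000000000000000 (n + 1) le_rfl
  have aH' := nd2 10000000000000000 (n + 1) le_rfl
  have aD := nd2 (upi u n) ((n + 1) ^ 2) (t := 1e16 * (Real.log ((n + 1 : ℕ):ℝ) / ((n + 1 : ℕ):ℝ) ^ 2)) (by
    rw [Nat.cast_pow, ← mul_div_assoc]; gcongr)
  refine ⟨hl, hu, ?_, ?_, ?_, ?_, ?_, ?_, ?_⟩
  · rw [sA_succ, e]; have := h.hA; simpa using this
  · rw [sA_succ, e]; have := h.hB; simpa using this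
  · rw [sH_succ, Nat.cast_add]; have := h.hH
    rw [div_eq_mul_one_div] at aH
    push_cast at *; linarith
  · rw [sH_succ, Nat.cast_add]; have := h.hH'
    rw [div_eq_mul_one_div] at aH'
    push_cast at *; linarith
  · rw [sD_succ, Nat.cast_add, Nat.cast_add]; have := h.hD; push_cast at *; linarith
  · rw [sQ_succ, e]; have := h.hQ; simpa using this
  · rw [sP_succ, e]; have := h.hP; simpa using this

lemma inv_p {n l u A B H D Q P : ℕ} (hn : 2 ≤ n) (h : Inv n l u A B H D Q P) (hp : (n + 1).Prime) :
    Inv (n + 1) (lowi l n) (upi u n) (A + lowi l n / (n + 1)) (B + (upi u n / (n + 1) + 1))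
      (H + 10000000000000000 / (n + 1)) (D + (upi u n / (n + 1) ^ 2 + 1))
      (Q + (upi u n / ((n + 1) * ((n + 1) ^ 2 - 1)) + 1)) (P + lowi l n / ((n + 1) * n)) := by
  have e : pl (n + 1) = Real.log ((n + 1 : ℕ):ℝ) := by simp only [pl, hp, if_true]
  have hu := upi_ok (by omega) h.hu
  have hl := lowi_ok (by omega) h.hl
  have c : ∀ a b : ℕ, ((a + (b + 1) : ℕ):ℝ) = a + (b + 1) := by intros; push_cast; ring
  have n0 : (0:ℝ) < (n:ℝ) := by exact_mod_cast (by omega : 0 < n)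
  have m0 : (0:ℝ) < ((n + 1 : ℕ):ℝ) := by positivity
  have aH := nd1 10000000000000000 (n + 1) le_rfl
  have aH' := nd2 10000000000000000 (n + 1) le_rfl
  have aA := nd1 (lowi l n) (n + 1) (t := 1e16 * (Real.log ((n + 1 : ℕ):ℝ) / ((n + 1 : ℕ):ℝ))) (by
    rw [← mul_div_assoc]; gcongr)
  have aB := nd2 (upi u n) (n + 1) (t := 1e16 * (Real.log ((n + 1 : ℕ):ℝ) / ((n + 1 : ℕ):ℝ))) (by
    rw [← mul_div_assoc]; gcongr)
  have aD := nd2 (upi u n) ((n + 1) ^ 2) (t := 1e16 * (Real.log ((n + 1 : ℕ):ℝ) / ((n + 1 : ℕ):ℝ) ^ 2)) (by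
    rw [Nat.cast_pow, ← mul_div_assoc]; gcongr)
  have eq : ((((n + 1) ^ 2 - 1 : ℕ)):ℝ) = ((n + 1 : ℕ):ℝ) ^ 2 - 1 := by
    rw [Nat.cast_sub (Nat.one_le_pow _ _ (by omega))]; push_cast; rfl
  have q0 : (0:ℝ) < ((n + 1 : ℕ):ℝ) ^ 2 - 1 := by push_cast; nlinarith
  have aQ := nd2 (upi u n) ((n + 1) * ((n + 1) ^ 2 - 1)) (t := 1e16 * (Real.log ((n + 1 : ℕ):ℝ) * (1 / (((n + 1 : ℕ):ℝ) * (((n + 1 : ℕ):ℝ) ^ 2 - 1))))) (by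
    rw [Nat.cast_mul, eq, mul_one_div, ← mul_div_assoc]; gcongr)
  have aP := nd1 (lowi l n) ((n + 1) * n) (t := 1e16 * (Real.log ((n + 1 : ℕ):ℝ) * (1 / (((n + 1 : ℕ):ℝ) * (((n + 1 : ℕ):ℝ) - 1))))) (by
    rw [show ((n + 1 : ℕ):ℝ) - 1 = n by push_cast; ring, Nat.cast_mul, mul_one_div, ← mul_div_assoc]; gcongr)
  refine ⟨hl, hu, ?_, ?_, ?_, ?_, ?_, ?_, ?_⟩
  · rw [sA_succ, e, Nat.cast_add]; have := h.hA; linarith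
  · rw [sA_succ, e, c B]; have := h.hB; linarith
  · rw [sH_succ, Nat.cast_add]; have := h.hH
    rw [div_eq_mul_one_div] at aH
    push_cast at *; linarith
  · rw [sH_succ, Nat.cast_add]; have := h.hH'
    rw [div_eq_mul_one_div] at aH'
    push_cast at *; linarith
  · rw [sD_succ, c D]; have := h.hD; linarith
  · rw [sQ_succ, e, c Q]; have := h.hQ; linarith
  · rw [sP_succ, e, Nat.cast_add]; have := h.hP; linarith

lemma go_sound (k : ℕ) : ∀ n l u A B H D Q P : ℕ, 2 ≤ n → n + k ≤ 10000 → Inv n l u A B H D Q P →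
    go k n l u A B H D Q P = true →
    (∀ m, n ≤ m → m < n + k → ∃ l u A B H D Q P, Inv m l u A B H D Q P ∧ chk m l (upi u m) A B = true) ∧
    ∃ l u A B H D Q P, Inv (n + k) l u A B H D Q P ∧ fin (n + k) l u H D Q P = true := by
  induction k with
  | zero =>
    intro n l u A B H D Q P _ _ hi hg
    exact ⟨fun m h1 h2 => by omega, l, u, A, B, H, D, Q, P, hi, hg⟩
  | succ k ih =>
    intro n l u A B H D Q P hn hk hi hg
    have hgo : go (k + 1) n l u A B H D Q P = (chk n l (upi u n) A B &&
      cond (isP (n + 1)) (go k (n + 1) (lowi l n) (upi u n) (A + lowi l n / (n + 1)) (B + (upi u n / (n + 1) + 1))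
      (H + 10000000000000000 / (n + 1)) (D + (upi u n / (n + 1) ^ 2 + 1))
      (Q + (upi u n / ((n + 1) * ((n + 1) ^ 2 - 1)) + 1)) (P + lowi l n / ((n + 1) * n)))
      (go k (n + 1) (lowi l n) (upi u n) A B (H + 10000000000000000 / (n + 1)) (D + (upi u n / (n + 1) ^ 2 + 1)) Q P)) := by
      unfold go
      simp only [frc_eq]
    rw [hgo, Bool.and_eq_true] at hg
    obtain ⟨hc, hg⟩ := hg
    have hnx : ∃ A' B' Q' P', Inv (n + 1) (lowi l n) (upi u n) A' B' (H + 10000000000000000 / (n + 1)) (D + (upi u n / (n + 1) ^ 2 + 1)) Q' P' ∧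
        go k (n + 1) (lowi l n) (upi u n) A' B' (H + 10000000000000000 / (n + 1)) (D + (upi u n / (n + 1) ^ 2 + 1)) Q' P' = true := by
      have hiff := isP_iff (m := n + 1) (by omega) (by omega)
      cases hb : isP (n + 1)
      · rw [hb] at hg
        have hp : ¬ (n + 1).Prime := fun h => by rw [← hiff, hb] at h; cases h
        exact ⟨_, _, _, _, inv_np hn hi hp, hg⟩
      · rw [hb] at hg
        exact ⟨_, _, _, _, inv_p hn hi (hiff.1 hb), hg⟩
    obtain ⟨A', B', Q', P', hi', hg'⟩ := hnx
    obtain ⟨r1, r2⟩ := ih _ _ _ _ _ _ _ _ _ (by omega) (by omega) hi' hg'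
    constructor
    · intro m h1 h2
      by_cases hm : m = n
      · subst hm
        exact ⟨l, u, A, B, H, D, Q, P, hi, hc⟩
      · exact r1 m (by omega) (by omega)
    · rwa [show n + (k + 1) = n + 1 + k by ring]

lemma inv_two : Inv 2 6931471803000000 6931471809000000 3465735901500000 3465735904500001
   15000000000000000 1732867952250001 1155245301500001 3465735901500000 := by
  have h1 := Real.log_two_gt_d9
  have h2 := Real.log_two_lt_d9
  have p0 : pl 0 = 0 := by norm_num [pl]
  have p1 : pl 1 = 0 := by norm_num [pl]
  have p2 : pl 2 = Real.log 2 := by norm_num [pl, Nat.prime_two]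
  refine ⟨?_, ?_, ?_, ?_, ?_, ?_, ?_, ?_, ?_⟩ <;>
    (try simp only [sA, sH, sD, sQ, sP, Finset.sum_range_succ, Finset.sum_range_zero, p0, p1, p2, harmonic]) <;> push_cast <;> norm_num <;> linarith

end
end MRH

namespace MRH
section
open Filter Topology

noncomputable def bb (x : ℝ) : ℝ := 3 * (Real.log x) ^ 2 / (8 * Real.pi * Real.sqrt x)

lemma hmono : MonotoneOn (fun y : ℝ => y + 3 / (8 * Real.pi) * (y ^ 2 * Real.exp (-(1/2) * y))) (Set.Ici 0) := by
  have hd : ∀ y : ℝ, HasDerivAt (fun y : ℝ => y + 3 / (8 * Real.pi) * (y ^ 2 * Real.exp (-(1/2) * y)))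
      (1 + 3 / (8 * Real.pi) * (2 * y * Real.exp (-(1/2) * y) + y ^ 2 * (Real.exp (-(1/2) * y) * (-(1/2))))) y := by
    intro y
    have h1 : HasDerivAt (fun y : ℝ => y ^ 2) (2 * y) y := by simpa using hasDerivAt_pow 2 y
    have h2 : HasDerivAt (fun y : ℝ => Real.exp (-(1/2) * y)) (Real.exp (-(1/2) * y) * (-(1/2))) y := by
      have := ((hasDerivAt_id y).const_mul (-(1/2))).exp
      simpa using this
    exact (hasDerivAt_id y).add ((h1.mul h2).const_mul _)
  apply monotoneOn_of_deriv_nonneg (convex_Ici 0)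
  · exact fun y _ => (hd y).continuousAt.continuousWithinAt
  · exact fun y _ => (hd y).differentiableAt.differentiableWithinAt
  · intro y hy
    rw [interior_Ici, Set.mem_Ioi] at hy
    rw [(hd y).deriv]
    have hp := Real.pi_gt_three
    have hk : 3 / (8 * Real.pi) ≤ 1 / 8 := by
      rw [div_le_div_iff₀ (by positivity) (by norm_num)]; linarith
    have hk0 : 0 ≤ 3 / (8 * Real.pi) := by positivity
    have he := Real.quadratic_le_exp_of_nonneg (x := 1/2 * y) (by positivity)
    have hee : Real.exp (-(1/2) * y) * Real.exp (1/2 * y) = 1 := by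
      rw [← Real.exp_add]; simp
    have e0 := Real.exp_pos (-(1/2) * y)
    set e := Real.exp (-(1/2) * y)
    have h8 : y ^ 2 * e ≤ 8 := by nlinarith [mul_le_mul_of_nonneg_left he e0.le, mul_pos e0 hy]
    have h3 : -4 ≤ 2 * y * e + y ^ 2 * (e * (-(1/2))) := by nlinarith [mul_pos e0 hy]
    nlinarith [mul_le_mul_of_nonneg_left h3 hk0]

lemma gmono {a b : ℝ} (ha : 1 ≤ a) (hab : a ≤ b) : Real.log a + bb a ≤ Real.log b + bb b := by
  have key : ∀ x : ℝ, 1 ≤ x → Real.log x + bb x = Real.log x + 3 / (8 * Real.pi) * (Real.log x ^ 2 * Real.exp (-(1/2) * Real.log x)) := by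
    intro x hx
    have x0 : 0 < x := by linarith
    have : Real.exp (-(1/2) * Real.log x) = (√x)⁻¹ := by
      rw [show -(1/2) * Real.log x = -(Real.log x / 2) by ring, Real.exp_neg, ← Real.log_sqrt x0.le, Real.exp_log (Real.sqrt_pos.2 x0)]
    rw [this]
    unfold bb
    have := Real.sqrt_pos.2 x0
    field_simp
  rw [key a ha, key b (ha.trans hab)]
  exact hmono (Set.mem_Ici.2 (Real.log_nonneg ha)) (Set.mem_Ici.2 (Real.log_nonneg (ha.trans hab)))
    (Real.log_le_log (by linarith) hab)

lemma upc_ok {a l x : ℕ} {X s : ℝ} (hX : X = x / 10) (hx : 0 < x) (h : upc a l x = true)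
    (hs : 1e16 * s ≤ a) (hl : (l:ℝ) ≤ 1e16 * Real.log X) : s + 1.33259 ≤ Real.log X + bb X := by
  have X0 : 0 < X := by rw [hX]; positivity
  have hsq : 0 < √X := Real.sqrt_pos.2 X0
  have hp := Real.pi_pos
  have b0 : 0 ≤ bb X := by unfold bb; positivity
  by_cases hle : a + 13325900000000000 ≤ l
  · have : ((a + 13325900000000000 : ℕ):ℝ) ≤ l := by exact_mod_cast hle
    push_cast at this
    linarith
  unfold upc at h
  rw [Nat.ble_eq] at h
  have hsub : ((a + 13325900000000000 - l : ℕ):ℝ) = a + 13325900000000000 - l := by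
    rw [Nat.cast_sub (by omega)]; push_cast; rfl
  have hR : (((a + 13325900000000000 - l : ℕ):ℝ) * ((a + 13325900000000000 - l : ℕ):ℝ) * 64 * 986961 * (x:ℝ) * 100000000000000000000000000000000) ≤
      9000000 * ((l:ℝ) * l * (l * l)) := by exact_mod_cast h
  rw [hsub] at hR
  set t : ℝ := ((a:ℝ) + 13325900000000000 - l) / 1e16 with ht
  set c : ℝ := (l:ℝ) / 1e16 with hc
  have et : (a:ℝ) + 13325900000000000 - l = 1e16 * t := by rw [ht]; ring
  have ec : (l:ℝ) = 1e16 * c := by rw [hc]; ring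
  have ex : (x:ℝ) = 10 * X := by rw [hX]; ring
  have c0 : 0 ≤ c := by rw [hc]; positivity
  have hlc : c ≤ Real.log X := by linarith
  rw [et, ec, ex] at hR
  have hR2 : t ^ 2 * 64 * 9.86961 * X ≤ 9 * c ^ 4 := by
    nlinarith
  have hpi : Real.pi ^ 2 ≤ 9.86961 := by nlinarith [Real.pi_lt_d6, Real.pi_gt_three]
  have hsqe : √X ^ 2 = X := Real.sq_sqrt X0.le
  have h1 : (t * (8 * Real.pi * √X)) ^ 2 ≤ (3 * c ^ 2) ^ 2 := by
    have e1 : (t * (8 * Real.pi * √X)) ^ 2 = t ^ 2 * 64 * Real.pi ^ 2 * X := by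
      rw [mul_pow, mul_pow, mul_pow, hsqe]; ring
    rw [e1]
    calc _ ≤ t ^ 2 * 64 * 9.86961 * X := by gcongr
      _ ≤ _ := hR2
      _ = _ := by ring
  have h2 := abs_le_of_sq_le_sq h1 (by positivity)
  have h3 : t ≤ bb X := by
    unfold bb
    rw [le_div_iff₀ (by positivity)]
    refine ((le_abs_self _).trans h2).trans ?_
    gcongr
  have : s + 1.33259 ≤ t + c := by
    rw [ht, hc]
    rw [← add_div, le_div_iff₀ (by norm_num)]
    linarith
  linarith

lemma gam_up {n : ℕ} (hn : 1 ≤ n) : Real.eulerMascheroniConstant ≤ sH n - Real.log n - 1 / (2 * n + 1) := by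
  have ha : Antitone (fun n : ℕ => sH (n + 1) - Real.log ((n + 1 : ℕ):ℝ) - 1 / (2 * ((n + 1 : ℕ):ℝ) + 1)) := by
    apply antitone_nat_of_succ_le
    intro n
    rw [sH_succ (n + 1)]
    have h := (log_step (n := n + 1) (by omega)).1
    have hb : 2 * (1 / (2 * ((n + 1 : ℕ):ℝ) + 1)) ≤ Real.log ((n + 1 + 1 : ℕ):ℝ) - Real.log ((n + 1 : ℕ):ℝ) := by
      refine le_trans ?_ h
      have : 0 ≤ 1 / (3 * (2 * ((n + 1 : ℕ):ℝ) + 1) ^ 3) + 1 / (5 * (2 * ((n + 1 : ℕ):ℝ) + 1) ^ 5) + 1 / (7 * (2 * ((n + 1 : ℕ):ℝ) + 1) ^ 7) := by positivity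
      linarith
    have e : 1 / ((n + 1 + 1 : ℕ):ℝ) ≤ 1 / (2 * ((n + 1 + 1 : ℕ):ℝ) + 1) + 1 / (2 * ((n + 1 : ℕ):ℝ) + 1) := by
      push_cast
      have : (0:ℝ) ≤ n := by positivity
      rw [div_add_div _ _ (by positivity) (by positivity), div_le_div_iff₀ (by positivity) (by positivity)]
      nlinarith
    linarith
  have ht : Tendsto (fun n : ℕ => sH (n + 1) - Real.log ((n + 1 : ℕ):ℝ) - 1 / (2 * ((n + 1 : ℕ):ℝ) + 1)) atTop (𝓝 Real.eulerMascheroniConstant) := by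
    have h1 := (tendsto_add_atTop_iff_nat 1).2 Real.tendsto_eulerMascheroniSeq'
    have h2 : Tendsto (fun n : ℕ => 1 / (2 * ((n + 1 : ℕ):ℝ) + 1)) atTop (𝓝 0) := by
      have a := (tendsto_add_atTop_iff_nat 1).2 (tendsto_natCast_atTop_atTop (R := ℝ))
      have b := tendsto_atTop_add_const_right _ (1:ℝ) (a.const_mul_atTop (by norm_num : (0:ℝ) < 2))
      refine b.inv_tendsto_atTop.congr fun n => ?_
      rw [Pi.inv_apply, one_div]
    have h3 := h1.sub h2
    rw [sub_zero] at h3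
    refine h3.congr fun n => ?_
    simp [Real.eulerMascheroniSeq', sH]
  have := ha.le_of_tendsto ht (n - 1)
  rwa [Nat.sub_add_cancel hn] at this

lemma gam_lo {n : ℕ} (hn : 1 ≤ n) : sH n - Real.log n - 1 / n ≤ Real.eulerMascheroniConstant := by
  have h := Real.eulerMascheroniSeq_lt_eulerMascheroniConstant n
  unfold Real.eulerMascheroniSeq at h
  have n0 : (0:ℝ) < n := by exact_mod_cast hn
  have := Real.log_le_sub_one_of_pos (x := ((n:ℝ) + 1) / n) (by positivity)
  rw [Real.log_div (by positivity) n0.ne'] at this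
  have e : ((n:ℝ) + 1) / n - 1 = 1 / n := by field_simp; ring
  unfold sH
  linarith

lemma fin_aux {n l u H D Q P : ℕ} (hf : fin n l u H D Q P = true) : ∃ w1 w2 w3 w4 w5 : ℕ,
    (H + n + (w2 + 1) + Q + (w3 + 1) : ℝ) ≤ 13325900000000000 + l + w4 ∧
    (13320000000000000 + u + w5 + 1 : ℝ) ≤ H + P ∧
    (u + 10000000000000000 : ℝ) / n ≤ w1 + 1 ∧
    (600000 * (D + w1 + 1) : ℝ) / 986960 ≤ w2 + 1 ∧
    (2 * (u + 10000000000000000) : ℝ) / (n * n) ≤ w3 + 1 ∧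
    (w4 : ℝ) ≤ 10000000000000000 / (2 * n + 1) ∧
    (10000000000000000 : ℝ) / n ≤ w5 + 1 := by
  unfold fin at hf
  rw [Bool.and_eq_true, Nat.ble_eq, Nat.ble_eq] at hf
  obtain ⟨f1, f2⟩ := hf
  refine ⟨(u + 10000000000000000) / n, 600000 * (D + (u + 10000000000000000) / n + 1) / 986960,
    2 * (u + 10000000000000000) / (n * n), 10000000000000000 / (2 * n + 1), 10000000000000000 / n,
    ?_, ?_, ?_, ?_, ?_, ?_, ?_⟩
  · exact_mod_cast f1
  · exact_mod_cast f2
  · refine nd2 _ _ (le_of_eq ?_); push_cast; rfl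
  · refine nd2 _ _ (le_of_eq ?_); simp only [Nat.cast_mul, Nat.cast_add, Nat.cast_ofNat, Nat.cast_one]
  · refine nd2 _ _ (le_of_eq ?_); push_cast; rfl
  · refine nd1 _ _ (le_of_eq ?_); push_cast; rfl
  · refine nd2 _ _ (le_of_eq ?_); push_cast; rfl

lemma fin_ok {P' : ℝ} (hP : HasSum cc P') {n l u A B H D Q P : ℕ} (hn : 4 ≤ n) (h : Inv n l u A B H D Q P)
    (hf : fin n l u H D Q P = true) :
    Real.eulerMascheroniConstant + P' ≤ 1.33259 ∧ 1.332 ≤ Real.eulerMascheroniConstant + P' := by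
  obtain ⟨w1, w2, w3, w4, w5, F1, F2, d1, d2, d3, d4, d5⟩ := fin_aux hf
  have n0 : (0:ℝ) < n := by exact_mod_cast (by omega : 0 < n)
  have g1 := gam_up (n := n) (by omega)
  have g2 := gam_lo (n := n) (by omega)
  have p1 := P_up hP hn
  have p2 := P_lo hP n
  obtain ⟨hl, hu, -, -, hH, hH', hD, hQ, hPP⟩ := h
  constructor
  · rw [show ∑ i ∈ Finset.range (n + 1), Real.log i / (i:ℝ) ^ 2 = sD n from rfl,
      show ∑ i ∈ Finset.range (n + 1), pl i * (1 / ((i:ℝ) * (i ^ 2 - 1))) = sQ n from rfl] at p1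
    have hL0 := log_nn n
    have a1 : 1e16 * ((Real.log n + 1) / n) ≤ w1 + 1 := by
      refine le_trans ?_ d1
      rw [← mul_div_assoc]; gcongr; linarith
    have sD0 : 0 ≤ sD n := Finset.sum_nonneg fun i _ => div_nonneg (log_nn i) (by positivity)
    have a2 : 1e16 * (6 / Real.pi ^ 2 * (sD n + (Real.log n + 1) / n)) ≤ w2 + 1 := by
      refine le_trans ?_ d2
      have hpi : (9.8696:ℝ) ≤ Real.pi ^ 2 := by nlinarith [Real.pi_gt_d6]
      calc _ = 6 * (1e16 * sD n + 1e16 * ((Real.log n + 1) / n)) / Real.pi ^ 2 := by ring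
        _ ≤ 6 * (D + (w1 + 1)) / 9.8696 := by gcongr
        _ = _ := by ring
    have a3 : 1e16 * (2 / n * ((Real.log n + 1) / n)) ≤ w3 + 1 := by
      refine le_trans ?_ d3
      rw [div_mul_div_comm, ← mul_div_assoc]
      refine div_le_div_of_nonneg_right ?_ (by positivity)
      linarith
    have a4 : (w4:ℝ) ≤ 1e16 * (1 / (2 * n + 1)) := by
      refine d4.trans (le_of_eq ?_); rw [mul_one_div]; norm_num
    linarith
  · rw [show ∑ i ∈ Finset.range (n + 1), pl i * (1 / ((i:ℝ) * (i - 1))) = sP n from rfl] at p2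
    have a5 : 1e16 * (1 / (n:ℝ)) ≤ w5 + 1 := by
      refine le_trans (le_of_eq ?_) d5; rw [mul_one_div]; norm_num
    linarith

lemma go_wrap {k n l u A B H D Q P N : ℕ} (hn : 2 ≤ n) (hN : n + k = N) (hN' : N ≤ 10000)
    (hi : Inv n l u A B H D Q P) (hg : go k n l u A B H D Q P = true) :
    (∀ m, n ≤ m → m < N → ∃ l u A B H D Q P, Inv m l u A B H D Q P ∧ chk m l (upi u m) A B = true) ∧
    ∃ l u A B H D Q P, Inv N l u A B H D Q P ∧ fin N l u H D Q P = true := by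
  subst hN
  exact go_sound k n l u A B H D Q P hn hN' hi hg

lemma go_fin : ∃ N : ℕ, N = 10000 ∧
    (∀ m, 2 ≤ m → m < N → ∃ l u A B H D Q P, Inv m l u A B H D Q P ∧ chk m l (upi u m) A B = true) ∧
    ∃ l u A B H D Q P, Inv N l u A B H D Q P ∧ fin N l u H D Q P = true := by
  have h : 2 + 9998 = 10000 := by norm_num
  exact ⟨10000, rfl, go_wrap (k := 9998) (n := 2) (N := 10000) (le_refl 2) h (le_refl 10000) inv_two go_ok⟩

lemma c43 {l : ℕ} (h1 : (l:ℝ) ≤ 1e16 * Real.log (43:ℕ)) :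
    ((l + 20000000000000000 / 861 : ℕ):ℝ) ≤ 1e16 * Real.log 43.1 := by
  have h2 := (log_step (n := 430) (by norm_num)).1
  have h3 : Real.log (43.1:ℝ) = Real.log (43:ℕ) + (Real.log ((430 + 1 : ℕ):ℝ) - Real.log (430 : ℕ)) := by
    rw [← Real.log_div (by norm_num) (by norm_num), ← Real.log_mul (by norm_num) (by norm_num)]
    norm_num
  have h4 := nd1 20000000000000000 861 le_rfl
  have h5 : 2 * (1 / 861) ≤ (Real.log ((430 + 1 : ℕ):ℝ) - Real.log (430 : ℕ)) := by
    refine le_trans ?_ h2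
    norm_num
  rw [Nat.cast_add, h3]
  generalize (20000000000000000 / 861 : ℕ) = w at *
  rw [Nat.cast_ofNat, Nat.cast_ofNat] at h4
  linarith

lemma small (hRH : RiemannHypothesis) {E : ℝ} (hE : Filter.Tendsto
      (fun x : ℝ => (∑ p ∈ (Finset.range (⌊x⌋₊ + 1)).filter Nat.Prime,
        Real.log p / p) - Real.log x) Filter.atTop (nhds E)) {x : ℝ} (hx : 43.1 ≤ x) (hx2 : x < 10000) :
    |(∑ p ∈ (Finset.range (⌊x⌋₊ + 1)).filter Nat.Prime, Real.log p / p)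
          - Real.log x - E|
        ≤ 3 * (Real.log x) ^ 2 / (8 * Real.pi * Real.sqrt x) := by
  rw [AA_eq]
  change |sA ⌊x⌋₊ - Real.log x - E| ≤ bb x
  obtain ⟨N, hN, r1, l, u, A, B, H, D, Q, P, hi, hf⟩ := go_fin
  obtain ⟨e1, e2⟩ := fin_ok (cc_hasSum hRH hE) (by omega) hi hf
  clear l u A B H D Q P hi hf
  have x0 : 0 < x := by linarith
  have hm1 : 43 ≤ ⌊x⌋₊ := Nat.le_floor (by push_cast; linarith)
  have hm2 : ⌊x⌋₊ < 10000 := (Nat.floor_lt x0.le).2 (by push_cast; exact hx2)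
  have hm3 := Nat.floor_le x0.le
  have hm4 := Nat.lt_floor_add_one x
  set m := ⌊x⌋₊ with hm
  clear_value m
  obtain ⟨l, u, A, B, H, D, Q, P, hi, hc⟩ := r1 m (by omega) (by omega)
  unfold chk at hc
  have hb : Nat.blt m 43 = false := by
    cases hc : Nat.blt m 43
    · rfl
    · rw [Nat.blt_eq] at hc; omega
  rw [hb, Bool.false_or, Bool.and_eq_true, Nat.ble_eq] at hc
  obtain ⟨c1, c2⟩ := hc
  have low : Real.log x ≤ sA m + 1.332 := by
    have a := upi_ok (by omega) hi.hu
    have b : ((upi u m : ℕ):ℝ) ≤ ((A + 13320000000000000 : ℕ):ℝ) := by exact_mod_cast c1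
    have c : Real.log x ≤ Real.log ((m + 1 : ℕ):ℝ) := Real.log_le_log x0 (by push_cast; exact hm4.le)
    have := hi.hA
    rw [Nat.cast_add] at b
    push_cast at b
    linarith
  have up : sA m + 1.33259 ≤ Real.log x + bb x := by
    by_cases h43 : m = 43
    · subst h43
      have hbe : Nat.beq 43 43 = true := rfl
      rw [hbe, cond_true] at c2
      exact (upc_ok (X := 43.1) (by norm_num) (by norm_num) c2 hi.hB (c43 hi.hl)).trans (gmono (by norm_num) hx)
    · have hbe : Nat.beq m 43 = false := by
        cases hc : Nat.beq m 43
        · rfl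
        · exact absurd (Nat.eq_of_beq_eq_true hc) h43
      rw [hbe, cond_false] at c2
      have m1 : (1:ℝ) ≤ m := by exact_mod_cast (by omega : 1 ≤ m)
      exact (upc_ok (X := m) (by push_cast; ring) (by omega) c2 hi.hB hi.hl).trans (gmono m1 hm3)
  have b0 : 0 ≤ bb x := by
    have := Real.pi_pos
    unfold bb; positivity
  rw [abs_le]
  constructor <;> linarith
end
end MRH

open Real Finset Filter

theorem mertens_first_RH (hRH : RiemannHypothesis) (E : ℝ)
    (hE : Filter.Tendsto
      (fun x : ℝ => (∑ p ∈ (Finset.range (⌊x⌋₊ + 1)).filter Nat.Prime,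
        Real.log p / p) - Real.log x) Filter.atTop (nhds E)) :
    ∀ x : ℝ, 43.1 ≤ x →
      |(∑ p ∈ (Finset.range (⌊x⌋₊ + 1)).filter Nat.Prime, Real.log p / p)
          - Real.log x - E|
        ≤ 3 * (Real.log x) ^ 2 / (8 * π * Real.sqrt x) := by
  intro x hx
  rcases lt_or_ge x 10000 with h | h
  · exact MRH.small hRH hE hx h
  · exact MRH.large hRH hE h
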